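/- arXiv:2410.18614 — 6 statements merged into one kernel-verified Lean document; each statement's English description precedes it below -/
import Mathlib

section
/- Let d ≥ 1 and α ∈ (0,2). There exists a constant C = C(d,α) > 0 such that for all t > 0 and all z = (x,v) ∈ ℝ^d × ℝ^d, |∇_x p_t(x,v)| ≤ C · t^{−1/α − 1} · p_t(x,v) and |∇_v p_t(x,v)| ≤ C · t^{−1/α} · p_t(x,v); equivalently, t^{1/α+1}|∇_x log p_t(z)| + t^{1/α}|∇_v log p_t(z)| is bounded by a constant depending only on d and α. -/
open MeasureTheory Real RealInnerProductSpace

/-- The kinetic heat kernel of `Δ_v^{α/2} + v·∇_x`, via its Fourier integral. -/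
noncomputable def kinHeat (d : ℕ) (α t : ℝ) (x v : EuclideanSpace ℝ (Fin d)) : ℝ :=
  (2 * π) ^ (-(2 * (d : ℝ))) *
    ∫ w : EuclideanSpace ℝ (Fin d) × EuclideanSpace ℝ (Fin d),
      Real.cos (⟪x, w.1⟫ + ⟪v, w.2⟫) *
        Real.exp (-∫ s in (0 : ℝ)..t, ‖s • w.1 + w.2‖ ^ α)

open scoped ENNReal NNReal Nat
open Filter Topology
open Complex (I)

set_option linter.unusedSectionVars false

section ConvolutionExponential

variable {V : Type*} [NormedAddCommGroup V] [InnerProductSpace ℝ V] [MeasurableSpace V]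
  [BorelSpace V] [SecondCountableTopology V]

/-- The convolution powers of a measure. -/
noncomputable def convPow (σ : Measure V) : ℕ → Measure V
  | 0 => Measure.dirac 0
  | n + 1 => σ ∗ convPow σ n

instance (σ : Measure V) [IsFiniteMeasure σ] (n : ℕ) : IsFiniteMeasure (convPow σ n) := by
  induction n with
  | zero => unfold convPow; infer_instance
  | succ n ih => unfold convPow; infer_instance

lemma convPow_univ (σ : Measure V) [IsFiniteMeasure σ] (n : ℕ) :
    convPow σ n Set.univ = σ Set.univ ^ n := by
  induction n with
  | zero => simp [convPow]
  | succ n ih =>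
    rw [convPow, Measure.conv, Measure.map_apply (by fun_prop) MeasurableSet.univ,
      Set.preimage_univ, Measure.prod_apply MeasurableSet.univ]
    simp [ih, pow_succ, mul_comm]

lemma charFun_convPow (σ : Measure V) [IsFiniteMeasure σ] (n : ℕ) (w : V) :
    charFun (convPow σ n) w = charFun σ w ^ n := by
  induction n with
  | zero => simp [convPow, charFun_dirac]
  | succ n ih => rw [convPow, charFun_conv, ih, pow_succ, mul_comm]

/-- The exponential of a measure with respect to convolution. -/
noncomputable def convExp (σ : Measure V) : Measure V :=
  Measure.sum fun n => ((n ! : ℝ≥0∞)⁻¹) • convPow σ n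

/-- The measure `τ` with `convExp σ = dirac 0 + σ ∗ τ`. -/
noncomputable def convExpTail (σ : Measure V) : Measure V :=
  Measure.sum fun n => (((n + 1)! : ℝ≥0∞)⁻¹) • convPow σ n

lemma inv_factorial_eq (n : ℕ) : ((n ! : ℝ≥0∞)⁻¹) = ENNReal.ofReal ((n ! : ℝ)⁻¹) := by
  rw [ENNReal.ofReal_inv_of_pos (by positivity)]
  simp

instance (σ : Measure V) [IsFiniteMeasure σ] : IsFiniteMeasure (convExp σ) := by
  refine ⟨?_⟩
  rw [convExp, Measure.sum_apply _ MeasurableSet.univ]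
  have h : ∀ n : ℕ, (((n ! : ℝ≥0∞)⁻¹) • convPow σ n) Set.univ =
      ENNReal.ofReal ((σ.real Set.univ) ^ n / n !) := by
    intro n
    rw [Measure.smul_apply, convPow_univ, smul_eq_mul, inv_factorial_eq, div_eq_inv_mul,
      ENNReal.ofReal_mul (by positivity), ENNReal.ofReal_pow (by positivity)]
    simp [Measure.real]
  simp_rw [h]
  rw [← ENNReal.ofReal_tsum_of_nonneg (fun n => by positivity) (Real.summable_pow_div_factorial _)]
  exact ENNReal.ofReal_lt_top

lemma convExpTail_le (σ : Measure V) : convExpTail σ ≤ convExp σ := by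
  refine Measure.le_iff.2 fun s hs => ?_
  rw [convExp, convExpTail, Measure.sum_apply _ hs, Measure.sum_apply _ hs]
  refine ENNReal.tsum_le_tsum fun n => ?_
  simp only [Measure.smul_apply, smul_eq_mul]
  gcongr
  exact n.le_succ

instance (σ : Measure V) [IsFiniteMeasure σ] : IsFiniteMeasure (convExpTail σ) :=
  isFiniteMeasure_of_le _ (convExpTail_le σ)

lemma charFun_convExp (σ : Measure V) [IsFiniteMeasure σ] (w : V) :
    charFun (convExp σ) w = Complex.exp (charFun σ w) := by
  have hexpI : Integrable (fun x : V => Complex.exp ((⟪x, w⟫ : ℝ) * I)) (convExp σ) :=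
    (integrable_const (1 : ℝ)).mono (by fun_prop) (by simp)
  rw [charFun_apply, convExp, integral_sum_measure hexpI,
    show Complex.exp (charFun σ w) = ∑' n : ℕ, charFun σ w ^ n / (n ! : ℂ) by
      rw [Complex.exp_eq_exp_ℂ, NormedSpace.exp_eq_tsum_div]]
  refine tsum_congr fun n => ?_
  rw [integral_smul_measure, ← charFun_apply, charFun_convPow]
  simp [div_eq_inv_mul]

/-- Convolution of a function with a measure. -/
noncomputable def convFun (μ : Measure V) (f : V → ℝ≥0∞) (z : V) : ℝ≥0∞ := ∫⁻ y, f (z - y) ∂μ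

lemma measurable_convFun (μ : Measure V) [SFinite μ] {f : V → ℝ≥0∞} (hf : Measurable f) :
    Measurable (convFun μ f) := by
  unfold convFun
  exact Measurable.lintegral_prod_right' (f := fun p : V × V => f (p.1 - p.2)) (by fun_prop)

lemma convFun_conv (μ ν : Measure V) [SFinite ν] {f : V → ℝ≥0∞} (hf : Measurable f) :
    convFun (μ ∗ ν) f = convFun μ (convFun ν f) := by
  ext z
  rw [convFun, Measure.lintegral_conv (by fun_prop)]
  simp [convFun, sub_sub]

lemma convFun_comm (μ ν : Measure V) [SFinite μ] [SFinite ν] {f : V → ℝ≥0∞} (hf : Measurable f) :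
    convFun μ (convFun ν f) = convFun ν (convFun μ f) := by
  rw [← convFun_conv _ _ hf, ← convFun_conv _ _ hf, Measure.conv_comm]

lemma convFun_mono (μ : Measure V) {f g : V → ℝ≥0∞} (h : ∀ z, f z ≤ g z) (z : V) :
    convFun μ f z ≤ convFun μ g z := lintegral_mono fun _ => h _

lemma convFun_add (μ : Measure V) {f g : V → ℝ≥0∞} (hf : Measurable f) :
    convFun μ (f + g) = convFun μ f + convFun μ g := by
  ext z
  simp only [convFun, Pi.add_apply]
  exact lintegral_add_left (by fun_prop) _

lemma convFun_const_mul (μ : Measure V) (C : ℝ≥0∞) {f : V → ℝ≥0∞} (hf : Measurable f) (z : V) :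
    convFun μ (fun x => C * f x) z = C * convFun μ f z :=
  lintegral_const_mul _ (by fun_prop)

lemma convFun_convExp (σ : Measure V) [IsFiniteMeasure σ] {f : V → ℝ≥0∞} (hf : Measurable f) :
    convFun (convExp σ) f = f + convFun (convExpTail σ) (convFun σ f) := by
  ext z
  rw [Pi.add_apply]
  simp only [convFun, convExp, convExpTail, lintegral_sum_measure, lintegral_smul_measure]
  rw [tsum_eq_zero_add' ENNReal.summable]
  congr 1
  · simp [convPow, lintegral_dirac]
  · refine tsum_congr fun n => ?_
    congr 1
    have := congrFun (convFun_comm σ (convPow σ n) hf) z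
    rw [← convFun_conv _ _ hf] at this
    exact this

lemma le_convFun_convExpTail (σ : Measure V) (f : V → ℝ≥0∞) (z : V) :
    f z ≤ convFun (convExpTail σ) f z := by
  simp only [convFun, convExpTail, lintegral_sum_measure, lintegral_smul_measure]
  refine le_trans ?_ (ENNReal.le_tsum 0)
  simp only [convPow]
  rw [lintegral_dirac]
  simp

/-- Comparison of two functions after convolution with a product of convolution exponentials: it
suffices to compare them up to at most one convolution factor of each kind. -/
lemma convFun_convExp_convExp_le (σ₁ σ₂ : Measure V) [IsFiniteMeasure σ₁] [IsFiniteMeasure σ₂]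
    {F q : V → ℝ≥0∞} (hF : Measurable F) (hq : Measurable q) (C : ℝ≥0∞)
    (h₀ : ∀ z, F z ≤ C * convFun σ₁ (convFun σ₂ q) z)
    (h₁ : ∀ z, convFun σ₁ F z ≤ C * convFun σ₁ (convFun σ₂ q) z)
    (h₂ : ∀ z, convFun σ₂ F z ≤ C * convFun σ₁ (convFun σ₂ q) z)
    (h₁₂ : ∀ z, convFun σ₁ (convFun σ₂ F) z ≤ C * convFun σ₁ (convFun σ₂ q) z) (z : V) :
    convFun (convExp σ₁) (convFun (convExp σ₂) F) z ≤
      4 * C * convFun (convExp σ₁) (convFun (convExp σ₂) q) z := by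
  set E₁ := convExpTail σ₁
  set E₂ := convExpTail σ₂
  set H := convFun σ₁ (convFun σ₂ q) with hH
  have mH : Measurable H := measurable_convFun _ (measurable_convFun _ hq)
  have expand : ∀ f : V → ℝ≥0∞, Measurable f →
      convFun (convExp σ₁) (convFun (convExp σ₂) f) = f + convFun E₂ (convFun σ₂ f) +
        (convFun E₁ (convFun σ₁ f) + convFun E₁ (convFun E₂ (convFun σ₁ (convFun σ₂ f)))) := by
    intro f hf
    have m2 : Measurable (convFun σ₂ f) := measurable_convFun _ hf
    rw [convFun_convExp σ₂ hf, convFun_convExp σ₁ (hf.add (measurable_convFun _ m2)),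
      convFun_add σ₁ hf, convFun_comm σ₁ _ m2, convFun_add _ (measurable_convFun _ hf)]
  have up : ∀ z, convFun E₁ (convFun E₂ H) z ≤ convFun (convExp σ₁) (convFun (convExp σ₂) q) z := by
    intro z
    rw [expand q hq]
    simp only [Pi.add_apply]
    exact le_add_left (le_add_left le_rfl)
  have e2 : ∀ {f : V → ℝ≥0∞}, (∀ z, f z ≤ C * H z) → ∀ z, convFun E₂ f z ≤ C * convFun E₂ H z :=
    fun h z => (convFun_mono E₂ h z).trans_eq (convFun_const_mul _ _ mH z)
  have e1 : ∀ {f : V → ℝ≥0∞}, (∀ z, f z ≤ C * H z) → ∀ z, convFun E₁ f z ≤ C * convFun E₁ H z :=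
    fun h z => (convFun_mono E₁ h z).trans_eq (convFun_const_mul _ _ mH z)
  have l2 : ∀ z, H z ≤ convFun E₂ H z := le_convFun_convExpTail _ _
  have l12 : ∀ z, convFun E₂ H z ≤ convFun E₁ (convFun E₂ H) z := le_convFun_convExpTail _ _
  have b0 : F z ≤ C * convFun E₁ (convFun E₂ H) z :=
    (h₀ z).trans (mul_le_mul_right ((l2 z).trans (l12 z)) C)
  have b2 : convFun E₂ (convFun σ₂ F) z ≤ C * convFun E₁ (convFun E₂ H) z :=
    (e2 h₂ z).trans (mul_le_mul_right (l12 z) C)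
  have b1 : convFun E₁ (convFun σ₁ F) z ≤ C * convFun E₁ (convFun E₂ H) z :=
    (e1 h₁ z).trans (mul_le_mul_right (convFun_mono E₁ l2 z) C)
  have b12 : convFun E₁ (convFun E₂ (convFun σ₁ (convFun σ₂ F))) z ≤
      C * convFun E₁ (convFun E₂ H) z :=
    (convFun_mono E₁ (e2 h₁₂) z).trans_eq (convFun_const_mul _ _ (measurable_convFun _ mH) z)
  rw [expand F hF]
  simp only [Pi.add_apply]
  calc _ ≤ (C * convFun E₁ (convFun E₂ H) z + C * convFun E₁ (convFun E₂ H) z) +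
        (C * convFun E₁ (convFun E₂ H) z + C * convFun E₁ (convFun E₂ H) z) := by gcongr
    _ = 4 * C * convFun E₁ (convFun E₂ H) z := by ring
    _ ≤ _ := by gcongr; exact up z

end ConvolutionExponential

section Rays

variable {E : Type*} [NormedAddCommGroup E] [InnerProductSpace ℝ E] [FiniteDimensional ℝ E]
  [MeasurableSpace E] [BorelSpace E]

/-- The displacement `(s u, u)` of (position, velocity) caused by a velocity jump `u`. -/
def ray (s : ℝ) (u : E) : WithLp 2 (E × E) := WithLp.toLp 2 (s • u, u)

@[fun_prop]
lemma continuous_ray : Continuous fun p : ℝ × E => ray p.1 p.2 := by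
  unfold ray; fun_prop

@[fun_prop]
lemma Measurable.ray {X : Type*} [MeasurableSpace X] {f : X → ℝ} {g : X → E} (hf : Measurable f)
    (hg : Measurable g) : Measurable fun x => ray (f x) (g x) :=
  continuous_ray.measurable.comp (hf.prodMk hg)

lemma norm_ray_le {s : ℝ} (hs : s ∈ Set.Icc (0 : ℝ) 1) (u : E) : ‖ray s u‖ ≤ 2 * ‖u‖ := by
  have h : ‖ray s u‖ ^ 2 ≤ (2 * ‖u‖) ^ 2 := by
    have e1 : (ray s u).fst = s • u := rfl
    have e2 : (ray s u).snd = u := rfl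
    rw [WithLp.prod_norm_sq_eq_of_L2, e1, e2, norm_smul, Real.norm_of_nonneg hs.1]
    have : s * ‖u‖ ≤ ‖u‖ := mul_le_of_le_one_left (norm_nonneg u) hs.2
    nlinarith [mul_nonneg hs.1 (norm_nonneg u), norm_nonneg u]
  exact (sq_le_sq₀ (norm_nonneg _) (by positivity)).1 h

/-- The image of `ds ⊗ ρ` on `I × E` under `(s, u) ↦ (s u, u)`. -/
noncomputable def rayMeasure (I : Set ℝ) (ρ : Measure E) : Measure (WithLp 2 (E × E)) :=
  (((volume : Measure ℝ).restrict I).prod ρ).map fun p => ray p.1 p.2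

lemma convFun_rayMeasure (I : Set ℝ) (ρ : Measure E) [SFinite ρ] {f : WithLp 2 (E × E) → ℝ≥0∞}
    (hf : Measurable f) (z : WithLp 2 (E × E)) :
    convFun (rayMeasure I ρ) f z = ∫⁻ s in I, ∫⁻ u, f (z - ray s u) ∂ρ := by
  rw [convFun, rayMeasure, lintegral_map (by fun_prop) (by fun_prop),
    lintegral_prod _ (by fun_prop)]

lemma norm_le_of_ray_add_ray {s₁ s₂ : ℝ} (h₁ : s₁ ∈ Set.Icc (0 : ℝ) (1 / 3))
    (h₂ : s₂ ∈ Set.Icc (2 / 3 : ℝ) 1) (a b : E) :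
    ‖a‖ ≤ 6 * ‖ray s₁ a + ray s₂ b‖ ∧ ‖b‖ ≤ 6 * ‖ray s₁ a + ray s₂ b‖ := by
  set z := ray s₁ a + ray s₂ b with hz
  have hfst : z.fst = s₁ • a + s₂ • b := by simp [hz, ray]
  have hsnd : z.snd = a + b := by simp [hz, ray]
  have n1 : ‖z.fst‖ ≤ ‖z‖ := WithLp.norm_fst_le _ z
  have n2 : ‖z.snd‖ ≤ ‖z‖ := WithLp.norm_snd_le _ z
  obtain ⟨h10, h11⟩ := h₁
  obtain ⟨h20, h21⟩ := h₂
  have hb : (s₂ - s₁) • b = z.fst - s₁ • z.snd := by rw [hfst, hsnd]; module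
  have ha : (s₂ - s₁) • a = s₂ • z.snd - z.fst := by rw [hfst, hsnd]; module
  have hb' : (s₂ - s₁) * ‖b‖ ≤ ‖z.fst‖ + s₁ * ‖z.snd‖ := by
    have := norm_sub_le z.fst (s₁ • z.snd)
    rwa [← hb, norm_smul, norm_smul, Real.norm_of_nonneg (by linarith),
      Real.norm_of_nonneg h10] at this
  have ha' : (s₂ - s₁) * ‖a‖ ≤ s₂ * ‖z.snd‖ + ‖z.fst‖ := by
    have := norm_sub_le (s₂ • z.snd) z.fst
    rwa [← ha, norm_smul, norm_smul, Real.norm_of_nonneg (by linarith),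
      Real.norm_of_nonneg (by linarith)] at this
  constructor
  · nlinarith [norm_nonneg a, norm_nonneg z.snd]
  · nlinarith [norm_nonneg b, norm_nonneg z.snd]

lemma exists_ray_add_ray {s₁ s₂ : ℝ} (h : s₁ ≠ s₂) (z : WithLp 2 (E × E)) :
    ∃ a b : E, z = ray s₁ a + ray s₂ b := by
  have h' : s₂ - s₁ ≠ 0 := sub_ne_zero.2 h.symm
  refine ⟨z.snd - (s₂ - s₁)⁻¹ • (z.fst - s₁ • z.snd), (s₂ - s₁)⁻¹ • (z.fst - s₁ • z.snd), ?_⟩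
  refine (WithLp.ofLp_injective 2) (Prod.ext ?_ ?_)
  · change z.fst = s₁ • (z.snd - (s₂ - s₁)⁻¹ • (z.fst - s₁ • z.snd)) +
      s₂ • (s₂ - s₁)⁻¹ • (z.fst - s₁ • z.snd)
    have : (s₂ - s₁) • (s₂ - s₁)⁻¹ • (z.fst - s₁ • z.snd) = z.fst - s₁ • z.snd :=
      smul_inv_smul₀ h' _
    calc z.fst = (s₂ - s₁) • (s₂ - s₁)⁻¹ • (z.fst - s₁ • z.snd) + s₁ • z.snd := by
          rw [this]; abel
      _ = _ := by module
  · change z.snd = z.snd - (s₂ - s₁)⁻¹ • (z.fst - s₁ • z.snd) +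
      (s₂ - s₁)⁻¹ • (z.fst - s₁ • z.snd)
    module

/-- The weight `(1 + ‖u‖)⁻¹`. -/
noncomputable def weight {X : Type*} [NormedAddCommGroup X] (u : X) : ℝ≥0∞ := (1 + ‖u‖ₑ)⁻¹

@[fun_prop]
lemma measurable_weight {X : Type*} [NormedAddCommGroup X] [MeasurableSpace X] [BorelSpace X] :
    Measurable (weight : X → ℝ≥0∞) := by
  unfold weight; fun_prop

lemma weight_eq_ofReal {X : Type*} [NormedAddCommGroup X] (u : X) :
    weight u = ENNReal.ofReal ((1 + ‖u‖)⁻¹) := by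
  rw [weight, ENNReal.ofReal_inv_of_pos (by positivity), ENNReal.ofReal_add (by simp) (by simp)]
  simp

lemma weight_le_one {X : Type*} [NormedAddCommGroup X] (u : X) : weight u ≤ 1 := by
  rw [weight, ENNReal.inv_le_one]; exact le_self_add

lemma weight_mul_weight_sub_le {X : Type*} [NormedAddCommGroup X] (a u : X) :
    weight u * weight (a - u) ≤ weight a := by
  rw [weight_eq_ofReal, weight_eq_ofReal, weight_eq_ofReal,
    ← ENNReal.ofReal_mul (by positivity), ← mul_inv]
  refine ENNReal.ofReal_le_ofReal (inv_anti₀ (by positivity) ?_)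
  have := norm_add_le u (a - u)
  rw [add_sub_cancel] at this
  nlinarith [norm_nonneg u, norm_nonneg (a - u)]

lemma weight_le_mul {X Y : Type*} [NormedAddCommGroup X] [NormedAddCommGroup Y] {a : X} {b : Y}
    {C : ℝ} (hC : 1 ≤ C) (h : ‖b‖ ≤ C * ‖a‖) : weight a ≤ ENNReal.ofReal C * weight b := by
  rw [weight_eq_ofReal, weight_eq_ofReal, ← ENNReal.ofReal_mul (by positivity)]
  refine ENNReal.ofReal_le_ofReal ?_
  rw [← div_eq_mul_inv, ← inv_div]
  refine inv_anti₀ (by positivity) ?_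
  rw [div_le_iff₀ (by positivity)]
  nlinarith

lemma lintegral_weight_pow_lt_top {B : ℕ} (hB : Module.finrank ℝ E < B) :
    ∫⁻ u : E, weight u ^ B < ∞ := by
  have := finite_integral_one_add_norm (E := E) (μ := volume) (r := B) (by exact_mod_cast hB)
  refine lt_of_le_of_lt (lintegral_mono fun u => ?_) this
  rw [weight_eq_ofReal, ← ENNReal.ofReal_pow (by positivity), Real.rpow_neg (by positivity),
    Real.rpow_natCast, inv_pow]

/-- The measure on `E` with density `c (1 + ‖u‖) ^ (-B)`. -/
noncomputable def weightMeasure (E : Type*) [NormedAddCommGroup E] [InnerProductSpace ℝ E]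
    [FiniteDimensional ℝ E] [MeasurableSpace E] [BorelSpace E] (c : ℝ≥0∞) (B : ℕ) : Measure E :=
  volume.withDensity fun u => c * weight u ^ B

instance (c : ℝ≥0∞) (B : ℕ) : SFinite (weightMeasure E c B) := by
  unfold weightMeasure; infer_instance

lemma lintegral_weightMeasure (c : ℝ≥0∞) (B : ℕ) {f : E → ℝ≥0∞} (hf : Measurable f) :
    ∫⁻ u, f u ∂weightMeasure E c B = ∫⁻ u, c * weight u ^ B * f u := by
  rw [weightMeasure, lintegral_withDensity_eq_lintegral_mul _ (by fun_prop) hf]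
  rfl

lemma lintegral_weight_sub_le (c : ℝ≥0∞) (B : ℕ) (a : E) :
    ∫⁻ u, weight (a - u) ^ (2 * B) ∂weightMeasure E c B ≤
      (c * ∫⁻ u : E, weight u ^ B) * weight a ^ B := by
  rw [lintegral_weightMeasure _ _ (by fun_prop)]
  calc ∫⁻ u, c * weight u ^ B * weight (a - u) ^ (2 * B)
      ≤ ∫⁻ u, c * weight a ^ B * weight (a - u) ^ B := by
        refine lintegral_mono fun u => ?_
        calc c * weight u ^ B * weight (a - u) ^ (2 * B)
            = c * (weight u * weight (a - u)) ^ B * weight (a - u) ^ B := by ring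
          _ ≤ _ := by gcongr; exact weight_mul_weight_sub_le a u
    _ = c * weight a ^ B * ∫⁻ u : E, weight u ^ B := by
        rw [lintegral_const_mul _ (by fun_prop)]
        congr 1
        exact lintegral_sub_left_eq_self (fun u : E => weight u ^ B) a
    _ = _ := by ring

lemma weightMeasure_ball_ge (c : ℝ≥0∞) (B : ℕ) (a : E) {r : ℝ} (hr : r ≤ 1) :
    c * 2⁻¹ ^ B * volume (Metric.ball (0 : E) r) * weight a ^ B ≤
      weightMeasure E c B (Metric.ball a r) := by
  rw [weightMeasure, withDensity_apply _ Metric.isOpen_ball.measurableSet,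
    ← Measure.addHaar_ball_center volume a r]
  calc _ = ∫⁻ _ in Metric.ball a r, c * (2⁻¹ * weight a) ^ B := by
        rw [setLIntegral_const, mul_pow]; ring
    _ ≤ _ := by
        refine setLIntegral_mono' Metric.isOpen_ball.measurableSet fun u hu => ?_
        have h2 : 2⁻¹ * weight a ≤ weight u := by
          rw [weight_eq_ofReal, weight_eq_ofReal, show (2⁻¹ : ℝ≥0∞) = ENNReal.ofReal 2⁻¹ by
            rw [ENNReal.ofReal_inv_of_pos (by norm_num)]; simp,
            ← ENNReal.ofReal_mul (by positivity), ← mul_inv]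
          refine ENNReal.ofReal_le_ofReal (inv_anti₀ (by positivity) ?_)
          have h3 : ‖u - a‖ < r := by simpa [dist_eq_norm] using hu
          have h4 : ‖u‖ ≤ ‖a‖ + ‖u - a‖ := by simpa using norm_add_le a (u - a)
          nlinarith [norm_nonneg a]
        gcongr

/-- Functions with fast decay are dominated by the two-fold ray average of any function which is
bounded below near the origin, even after averaging along one or both rays. -/
lemma exists_ray_average_bound (c : ℝ≥0∞) (hc : c ≠ 0) (hc' : c ≠ ∞) {B : ℕ}
    (hB : Module.finrank ℝ E < B) {K q₀ : ℝ≥0∞} (hK : K ≠ ∞) (hq₀ : q₀ ≠ 0) (hq₀' : q₀ ≠ ∞)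
    {r : ℝ} (hr : 0 < r) {F q : WithLp 2 (E × E) → ℝ≥0∞}
    (hFK : ∀ z, F z ≤ K * weight z ^ (4 * B)) (hq : ∀ z, ‖z‖ < r → q₀ ≤ q z) :
    ∃ C : ℝ≥0∞, C ≠ ∞ ∧ ∀ s₁ ∈ Set.Icc (0 : ℝ) (1 / 3), ∀ s₂ ∈ Set.Icc (2 / 3 : ℝ) 1, ∀ z,
      let A := C * ∫⁻ u₁, ∫⁻ u₂, q (z - ray s₁ u₁ - ray s₂ u₂) ∂weightMeasure E c B
        ∂weightMeasure E c B
      F z ≤ A ∧ ∫⁻ u, F (z - ray s₁ u) ∂weightMeasure E c B ≤ A ∧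
        ∫⁻ u, F (z - ray s₂ u) ∂weightMeasure E c B ≤ A ∧
        ∫⁻ u₁, ∫⁻ u₂, F (z - ray s₁ u₁ - ray s₂ u₂) ∂weightMeasure E c B
          ∂weightMeasure E c B ≤ A := by
  set ρ := weightMeasure E c B with hρ
  set J := c * ∫⁻ u : E, weight u ^ B with hJ
  have hJtop : J ≠ ∞ := ENNReal.mul_ne_top hc' (lintegral_weight_pow_lt_top hB).ne
  set r' := min (r / 4) 1 with hr'
  have hr'0 : 0 < r' := by positivity
  set m := c * 2⁻¹ ^ B * volume (Metric.ball (0 : E) r') with hm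
  set l := q₀ * m * m with hl
  have hm0 : m ≠ 0 := by
    refine mul_ne_zero (mul_ne_zero hc (by simp)) (Metric.measure_ball_pos _ _ hr'0).ne'
  have hmtop : m ≠ ∞ := by
    refine ENNReal.mul_ne_top (ENNReal.mul_ne_top hc' ?_) measure_ball_lt_top.ne
    exact ENNReal.pow_ne_top (by simp)
  have hl0 : l ≠ 0 := mul_ne_zero (mul_ne_zero hq₀ hm0) hm0
  have hltop : l ≠ ∞ := ENNReal.mul_ne_top (ENNReal.mul_ne_top hq₀' hmtop) hmtop
  set K' := K * ENNReal.ofReal 6 ^ (4 * B) with hK'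
  have hK'top : K' ≠ ∞ := ENNReal.mul_ne_top hK (ENNReal.pow_ne_top ENNReal.ofReal_ne_top)
  refine ⟨K' * (1 + J) ^ 2 * l⁻¹, ?_, ?_⟩
  · refine ENNReal.mul_ne_top (ENNReal.mul_ne_top hK'top (ENNReal.pow_ne_top ?_)) ?_
    · exact ENNReal.add_ne_top.2 ⟨by simp, hJtop⟩
    · exact ENNReal.inv_ne_top.2 hl0
  intro s₁ h₁ s₂ h₂ z
  obtain ⟨a, b, rfl⟩ := exists_ray_add_ray (by linarith [h₁.2, h₂.1] : s₁ < s₂).ne z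
  have h₁' : s₁ ∈ Set.Icc (0 : ℝ) 1 := ⟨h₁.1, by linarith [h₁.2]⟩
  have h₂' : s₂ ∈ Set.Icc (0 : ℝ) 1 := ⟨by linarith [h₂.1], h₂.2⟩
  have key : ∀ u₁ u₂ : E, ray s₁ a + ray s₂ b - ray s₁ u₁ - ray s₂ u₂ =
      ray s₁ (a - u₁) + ray s₂ (b - u₂) := by
    intro u₁ u₂
    refine (WithLp.ofLp_injective 2) (Prod.ext ?_ ?_) <;> simp [ray, smul_sub] <;> abel
  have key1 : ∀ u : E, ray s₁ a + ray s₂ b - ray s₁ u = ray s₁ (a - u) + ray s₂ b := by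
    intro u
    refine (WithLp.ofLp_injective 2) (Prod.ext ?_ ?_) <;> simp [ray, smul_sub] <;> abel
  have key2 : ∀ u : E, ray s₁ a + ray s₂ b - ray s₂ u = ray s₁ a + ray s₂ (b - u) := by
    intro u
    refine (WithLp.ofLp_injective 2) (Prod.ext ?_ ?_) <;> simp [ray, smul_sub] <;> abel
  simp only [key]
  simp only [key1, key2]
  have upper : ∀ y₁ y₂ : E, F (ray s₁ y₁ + ray s₂ y₂) ≤
      K' * (weight y₁ ^ (2 * B) * weight y₂ ^ (2 * B)) := by
    intro y₁ y₂
    obtain ⟨n1, n2⟩ := norm_le_of_ray_add_ray h₁ h₂ y₁ y₂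
    have w1 := weight_le_mul (by norm_num) n1
    have w2 := weight_le_mul (by norm_num) n2
    calc _ ≤ K * weight (ray s₁ y₁ + ray s₂ y₂) ^ (4 * B) := hFK _
      _ = K * (weight (ray s₁ y₁ + ray s₂ y₂) ^ (2 * B) *
          weight (ray s₁ y₁ + ray s₂ y₂) ^ (2 * B)) := by ring
      _ ≤ K * ((ENNReal.ofReal 6 * weight y₁) ^ (2 * B) *
          (ENNReal.ofReal 6 * weight y₂) ^ (2 * B)) := by gcongr
      _ = _ := by rw [hK']; ring
  have lower : l * (weight a ^ B * weight b ^ B) ≤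
      ∫⁻ u₁, ∫⁻ u₂, q (ray s₁ (a - u₁) + ray s₂ (b - u₂)) ∂ρ ∂ρ := by
    calc l * (weight a ^ B * weight b ^ B) = q₀ * (m * weight a ^ B) * (m * weight b ^ B) := by ring
      _ ≤ q₀ * ρ (Metric.ball a r') * ρ (Metric.ball b r') := by
          gcongr
          · exact weightMeasure_ball_ge c B a (min_le_right _ _)
          · exact weightMeasure_ball_ge c B b (min_le_right _ _)
      _ = ∫⁻ _ in Metric.ball a r', ∫⁻ _ in Metric.ball b r', q₀ ∂ρ ∂ρ := by
          simp only [setLIntegral_const]; ring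
      _ ≤ ∫⁻ u₁ in Metric.ball a r', ∫⁻ u₂ in Metric.ball b r',
            q (ray s₁ (a - u₁) + ray s₂ (b - u₂)) ∂ρ ∂ρ := by
          refine setLIntegral_mono' Metric.isOpen_ball.measurableSet fun u₁ hu₁ => ?_
          refine setLIntegral_mono' Metric.isOpen_ball.measurableSet fun u₂ hu₂ => hq _ ?_
          have e1 : ‖a - u₁‖ < r / 4 := by
            rw [← dist_eq_norm, dist_comm]; exact lt_of_lt_of_le hu₁ (min_le_left _ _)
          have e2 : ‖b - u₂‖ < r / 4 := by
            rw [← dist_eq_norm, dist_comm]; exact lt_of_lt_of_le hu₂ (min_le_left _ _)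
          linarith [norm_add_le (ray s₁ (a - u₁)) (ray s₂ (b - u₂)), norm_ray_le h₁' (a - u₁),
            norm_ray_le h₂' (b - u₂)]
      _ ≤ ∫⁻ u₁ in Metric.ball a r', ∫⁻ u₂, q (ray s₁ (a - u₁) + ray s₂ (b - u₂)) ∂ρ ∂ρ :=
          lintegral_mono fun u₁ => setLIntegral_le_lintegral _ _
      _ ≤ _ := setLIntegral_le_lintegral _ _
  have finish : ∀ {X : ℝ≥0∞}, X ≤ K' * (1 + J) ^ 2 * (weight a ^ B * weight b ^ B) →
      X ≤ K' * (1 + J) ^ 2 * l⁻¹ *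
        ∫⁻ u₁, ∫⁻ u₂, q (ray s₁ (a - u₁) + ray s₂ (b - u₂)) ∂ρ ∂ρ := by
    intro X hX
    refine hX.trans ?_
    rw [mul_assoc _ l⁻¹]
    refine mul_le_mul_right ?_ _
    calc weight a ^ B * weight b ^ B = l⁻¹ * (l * (weight a ^ B * weight b ^ B)) := by
          rw [← mul_assoc, ENNReal.inv_mul_cancel hl0 hltop, one_mul]
      _ ≤ _ := by gcongr
  have pw : ∀ y : E, weight y ^ (2 * B) ≤ weight y ^ B := fun y =>
    pow_le_pow_right_of_le_one' (weight_le_one y) (by omega)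
  have ave : ∀ y : E, ∫⁻ u, weight (y - u) ^ (2 * B) ∂ρ ≤ (1 + J) * weight y ^ B := fun y =>
    (lintegral_weight_sub_le c B y).trans (by gcongr; exact le_add_self)
  have one_le : (1 : ℝ≥0∞) ≤ 1 + J := le_self_add
  refine ⟨finish ?_, finish ?_, finish ?_, finish ?_⟩
  · calc _ ≤ K' * (weight a ^ (2 * B) * weight b ^ (2 * B)) := upper a b
      _ ≤ K' * 1 * (weight a ^ B * weight b ^ B) := by
          rw [mul_one]
          exact mul_le_mul_right (mul_le_mul' (pw a) (pw b)) K'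
      _ ≤ _ := by gcongr; exact one_le_pow₀ one_le
  · calc _ ≤ ∫⁻ u, K' * (weight (a - u) ^ (2 * B) * weight b ^ (2 * B)) ∂ρ :=
          lintegral_mono fun u => upper _ _
      _ = K' * ((∫⁻ u, weight (a - u) ^ (2 * B) ∂ρ) * weight b ^ (2 * B)) := by
          rw [lintegral_const_mul _ (by fun_prop), lintegral_mul_const _ (by fun_prop)]
      _ ≤ K' * (((1 + J) * weight a ^ B) * weight b ^ B) := by
          exact mul_le_mul_right (mul_le_mul' (ave a) (pw b)) K'
      _ = K' * (1 + J) * (weight a ^ B * weight b ^ B) := by ring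
      _ ≤ _ := by gcongr; exact le_self_pow₀ one_le two_ne_zero
  · calc _ ≤ ∫⁻ u, K' * (weight a ^ (2 * B) * weight (b - u) ^ (2 * B)) ∂ρ :=
          lintegral_mono fun u => upper _ _
      _ = K' * (weight a ^ (2 * B) * ∫⁻ u, weight (b - u) ^ (2 * B) ∂ρ) := by
          rw [lintegral_const_mul _ (by fun_prop), lintegral_const_mul _ (by fun_prop)]
      _ ≤ K' * (weight a ^ B * ((1 + J) * weight b ^ B)) := by
          exact mul_le_mul_right (mul_le_mul' (pw a) (ave b)) K'
      _ = K' * (1 + J) * (weight a ^ B * weight b ^ B) := by ring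
      _ ≤ _ := by gcongr; exact le_self_pow₀ one_le two_ne_zero
  · calc _ ≤ ∫⁻ u₁, ∫⁻ u₂, K' * (weight (a - u₁) ^ (2 * B) * weight (b - u₂) ^ (2 * B)) ∂ρ ∂ρ :=
          lintegral_mono fun u => lintegral_mono fun u' => upper _ _
      _ = K' * ((∫⁻ u, weight (a - u) ^ (2 * B) ∂ρ) * ∫⁻ u, weight (b - u) ^ (2 * B) ∂ρ) := by
          have : ∀ u₁ : E, ∫⁻ u₂, K' * (weight (a - u₁) ^ (2 * B) * weight (b - u₂) ^ (2 * B)) ∂ρ =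
              K' * (weight (a - u₁) ^ (2 * B) * ∫⁻ u, weight (b - u) ^ (2 * B) ∂ρ) := by
            intro u₁
            rw [lintegral_const_mul _ (by fun_prop), lintegral_const_mul _ (by fun_prop)]
          simp_rw [this]
          rw [lintegral_const_mul _ (by fun_prop), lintegral_mul_const _ (by fun_prop)]
      _ ≤ K' * (((1 + J) * weight a ^ B) * ((1 + J) * weight b ^ B)) := by
          exact mul_le_mul_right (mul_le_mul' (ave a) (ave b)) K'
      _ = _ := by ring

end Rays

section RayConvolution

variable {E : Type*} [NormedAddCommGroup E] [InnerProductSpace ℝ E] [FiniteDimensional ℝ E]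
  [MeasurableSpace E] [BorelSpace E]

lemma convFun_rayMeasure_rayMeasure (I₁ I₂ : Set ℝ) (ρ : Measure E) [SFinite ρ]
    {f : WithLp 2 (E × E) → ℝ≥0∞} (hf : Measurable f) (z : WithLp 2 (E × E)) :
    convFun (rayMeasure I₁ ρ) (convFun (rayMeasure I₂ ρ) f) z =
      ∫⁻ s₁ in I₁, ∫⁻ s₂ in I₂, ∫⁻ u₁, ∫⁻ u₂, f (z - ray s₁ u₁ - ray s₂ u₂) ∂ρ ∂ρ := by
  have : SFinite (rayMeasure I₂ ρ) := by unfold rayMeasure; infer_instance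
  rw [convFun_rayMeasure _ _ (measurable_convFun _ hf)]
  refine lintegral_congr fun s₁ => ?_
  simp_rw [convFun_rayMeasure I₂ ρ hf]
  refine lintegral_lintegral_swap (Measurable.aemeasurable ?_)
  exact Measurable.lintegral_prod_right'
    (f := fun p : (E × ℝ) × E => f (z - ray s₁ p.1.1 - ray p.1.2 p.2)) (by fun_prop)

lemma exists_convFun_rayMeasure_bound (c : ℝ≥0∞) (hc : c ≠ 0) (hc' : c ≠ ∞) {B : ℕ}
    (hB : Module.finrank ℝ E < B) {K q₀ : ℝ≥0∞} (hK : K ≠ ∞) (hq₀ : q₀ ≠ 0) (hq₀' : q₀ ≠ ∞)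
    {r : ℝ} (hr : 0 < r) {F q : WithLp 2 (E × E) → ℝ≥0∞} (hF : Measurable F) (hqm : Measurable q)
    (hFK : ∀ z, F z ≤ K * weight z ^ (4 * B)) (hq : ∀ z, ‖z‖ < r → q₀ ≤ q z)
    {σ₁ σ₂ : Measure (WithLp 2 (E × E))}
    (hσ₁ : σ₁ = rayMeasure (Set.Ioc 0 (1 / 3)) (weightMeasure E c B))
    (hσ₂ : σ₂ = rayMeasure (Set.Ioc (2 / 3) 1) (weightMeasure E c B)) :
    ∃ C : ℝ≥0∞, C ≠ ∞ ∧ ∀ z,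
      F z ≤ C * convFun σ₁ (convFun σ₂ q) z ∧
      convFun σ₁ F z ≤ C * convFun σ₁ (convFun σ₂ q) z ∧
      convFun σ₂ F z ≤ C * convFun σ₁ (convFun σ₂ q) z ∧
      convFun σ₁ (convFun σ₂ F) z ≤ C * convFun σ₁ (convFun σ₂ q) z := by
  obtain ⟨C, hC, h⟩ := exists_ray_average_bound c hc hc' hB hK hq₀ hq₀' hr hFK hq
  refine ⟨9 * C, ENNReal.mul_ne_top (by simp) hC, fun z => ?_⟩
  subst hσ₁ hσ₂
  set ρ := weightMeasure E c B
  set κ := ENNReal.ofReal (1 / 3) with hκ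
  have κ9 : 9 * (κ * κ) = 1 := by
    rw [hκ, ← ENNReal.ofReal_mul (by norm_num), show (9 : ℝ≥0∞) = ENNReal.ofReal 9 by simp,
      ← ENNReal.ofReal_mul (by norm_num)]
    norm_num
  have κ1 : κ ≤ 1 := by rw [hκ]; exact ENNReal.ofReal_le_one.2 (by norm_num)
  have v1 : (volume : Measure ℝ) (Set.Ioc 0 (1 / 3)) = κ := by rw [Real.volume_Ioc, sub_zero]
  have v2 : (volume : Measure ℝ) (Set.Ioc (2 / 3) 1) = κ := by
    rw [Real.volume_Ioc]; norm_num [hκ]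
  set H := convFun (rayMeasure (Set.Ioc 0 (1 / 3)) ρ)
    (convFun (rayMeasure (Set.Ioc (2 / 3) 1) ρ) q) z with hH
  have bound : ∀ X : ℝ → ℝ → ℝ≥0∞,
      (∀ s₁ ∈ Set.Icc (0 : ℝ) (1 / 3), ∀ s₂ ∈ Set.Icc (2 / 3 : ℝ) 1,
        X s₁ s₂ ≤ C * ∫⁻ u₁, ∫⁻ u₂, q (z - ray s₁ u₁ - ray s₂ u₂) ∂ρ ∂ρ) →
      ∫⁻ s₁ in Set.Ioc 0 (1 / 3), ∫⁻ s₂ in Set.Ioc (2 / 3) 1, X s₁ s₂ ≤ C * H := by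
    intro X hX
    rw [hH, convFun_rayMeasure_rayMeasure _ _ _ hqm, ← lintegral_const_mul' _ _ hC]
    refine setLIntegral_mono' measurableSet_Ioc fun s₁ h₁ => ?_
    rw [← lintegral_const_mul' _ _ hC]
    exact setLIntegral_mono' measurableSet_Ioc fun s₂ h₂ => hX s₁ ⟨h₁.1.le, h₁.2⟩ s₂ ⟨h₂.1.le, h₂.2⟩
  have finish : ∀ {X : ℝ≥0∞}, κ * κ * X ≤ C * H → X ≤ 9 * C * H := by
    intro X hX
    calc X = 9 * (κ * κ * X) := by rw [← mul_assoc, κ9, one_mul]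
      _ ≤ 9 * (C * H) := by gcongr
      _ = _ := by ring
  have finish' : ∀ {X : ℝ≥0∞}, κ * X ≤ C * H → X ≤ 9 * C * H := by
    refine fun {X} hX => finish (le_trans ?_ hX)
    rw [mul_assoc]
    exact mul_le_of_le_one_left' κ1
  have finish'' : ∀ {X : ℝ≥0∞}, X ≤ C * H → X ≤ 9 * C * H := by
    exact fun {X} hX => finish' ((mul_le_of_le_one_left' κ1).trans hX)
  refine ⟨finish ?_, finish' ?_, finish' ?_, finish'' ?_⟩
  · refine le_trans (le_of_eq ?_) (bound (fun _ _ => F z) fun s₁ h₁ s₂ h₂ => (h s₁ h₁ s₂ h₂ z).1)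
    simp only [setLIntegral_const, v1, v2]; ring
  · refine le_trans (le_of_eq ?_) (bound (fun s₁ _ => ∫⁻ u, F (z - ray s₁ u) ∂ρ)
      fun s₁ h₁ s₂ h₂ => (h s₁ h₁ s₂ h₂ z).2.1)
    simp only [setLIntegral_const, v2]
    rw [lintegral_mul_const' _ _ ENNReal.ofReal_ne_top, convFun_rayMeasure _ _ hF, mul_comm]
  · refine le_trans (le_of_eq ?_) (bound (fun _ s₂ => ∫⁻ u, F (z - ray s₂ u) ∂ρ)
      fun s₁ h₁ s₂ h₂ => (h s₁ h₁ s₂ h₂ z).2.2.1)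
    simp only [setLIntegral_const, v1]
    rw [convFun_rayMeasure _ _ hF, mul_comm]
  · rw [convFun_rayMeasure_rayMeasure _ _ _ hF]
    exact bound _ fun s₁ h₁ s₂ h₂ => (h s₁ h₁ s₂ h₂ z).2.2.2

end RayConvolution

section RpowIntegral

lemma one_sub_exp_neg_mem {x : ℝ} (hx : 0 ≤ x) : 1 - Real.exp (-x) ∈ Set.Icc 0 (min x 1) := by
  have h1 := Real.add_one_le_exp (-x)
  have h2 : Real.exp (-x) ≤ 1 := Real.exp_le_one_iff.2 (by linarith)
  have h3 := Real.exp_pos (-x)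
  exact ⟨by linarith, le_min (by linarith) (by linarith)⟩

lemma integrableOn_one_sub_exp_mul_rpow {β : ℝ} (h0 : 0 < β) (h1 : β < 1) {l : ℝ} (hl : 0 ≤ l) :
    IntegrableOn (fun r : ℝ => (1 - Real.exp (-(l * r))) * r ^ (-1 - β)) (Set.Ioi 0) := by
  have meas : Measurable fun r : ℝ => (1 - Real.exp (-(l * r))) * r ^ (-1 - β) := by fun_prop
  rw [← Set.Ioc_union_Ioi_eq_Ioi zero_le_one]
  refine IntegrableOn.union ?_ ?_
  · have hi : IntegrableOn (fun r : ℝ => l * r ^ (-β)) (Set.Ioc 0 1) :=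
      ((intervalIntegrable_iff_integrableOn_Ioc_of_le zero_le_one).1
        (intervalIntegral.intervalIntegrable_rpow' (by linarith))).const_mul l
    refine hi.mono' meas.aestronglyMeasurable ?_
    filter_upwards [ae_restrict_mem measurableSet_Ioc] with r hr
    have h := one_sub_exp_neg_mem (mul_nonneg hl hr.1.le)
    have hp : 0 ≤ r ^ (-1 - β) := Real.rpow_nonneg hr.1.le _
    rw [Real.norm_of_nonneg (mul_nonneg h.1 hp), show -β = 1 + (-1 - β) by ring,
      Real.rpow_add hr.1, Real.rpow_one, ← mul_assoc]
    exact mul_le_mul_of_nonneg_right (h.2.trans (min_le_left _ _)) hp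
  · refine (integrableOn_Ioi_rpow_of_lt (by linarith : -1 - β < -1) one_pos).mono'
      meas.aestronglyMeasurable ?_
    filter_upwards [ae_restrict_mem measurableSet_Ioi] with r hr
    have hr0 : (0 : ℝ) ≤ r := zero_le_one.trans (le_of_lt hr)
    have h := one_sub_exp_neg_mem (mul_nonneg hl hr0)
    have hp : 0 ≤ r ^ (-1 - β) := Real.rpow_nonneg hr0 _
    rw [Real.norm_of_nonneg (mul_nonneg h.1 hp)]
    exact mul_le_of_le_one_left hp (h.2.trans (min_le_right _ _))

/-- The normalizing constant in the integral representation of `l ↦ l ^ β`. -/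
noncomputable def rpowConst (β : ℝ) : ℝ :=
  ∫ r in Set.Ioi (0 : ℝ), (1 - Real.exp (-r)) * r ^ (-1 - β)

lemma rpowConst_pos {β : ℝ} (h0 : 0 < β) (h1 : β < 1) : 0 < rpowConst β := by
  have hi := integrableOn_one_sub_exp_mul_rpow h0 h1 zero_le_one
  simp only [one_mul] at hi
  rw [rpowConst, setIntegral_pos_iff_support_of_nonneg_ae _ hi]
  · have : Set.Ioi (0 : ℝ) ⊆
        (Function.support fun r : ℝ => (1 - Real.exp (-r)) * r ^ (-1 - β)) ∩ Set.Ioi 0 := by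
      intro r hr
      have hr' : (0 : ℝ) < r := hr
      have : Real.exp (-r) < 1 := by simpa using hr'
      exact ⟨(mul_pos (by linarith) (Real.rpow_pos_of_pos hr' _)).ne', hr⟩
    exact lt_of_lt_of_le (by simp) (measure_mono this)
  · filter_upwards [ae_restrict_mem measurableSet_Ioi] with r hr
    exact mul_nonneg (one_sub_exp_neg_mem (le_of_lt hr)).1 (Real.rpow_nonneg (le_of_lt hr) _)

lemma integral_one_sub_exp_mul_rpow {β : ℝ} (h0 : 0 < β) {l : ℝ} (hl : 0 ≤ l) :
    ∫ r in Set.Ioi (0 : ℝ), (1 - Real.exp (-(l * r))) * r ^ (-1 - β) = rpowConst β * l ^ β := by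
  rcases hl.eq_or_lt with rfl | hl
  · simp [Real.zero_rpow h0.ne']
  have key := integral_comp_mul_left_Ioi
    (fun r : ℝ => (1 - Real.exp (-r)) * r ^ (-1 - β)) 0 hl
  rw [mul_zero, smul_eq_mul] at key
  have e : ∫ r in Set.Ioi (0 : ℝ), (1 - Real.exp (-(l * r))) * (l * r) ^ (-1 - β) =
      l ^ (-1 - β) * ∫ r in Set.Ioi (0 : ℝ), (1 - Real.exp (-(l * r))) * r ^ (-1 - β) := by
    rw [← integral_const_mul]
    refine setIntegral_congr_fun measurableSet_Ioi fun r hr => ?_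
    rw [Real.mul_rpow hl.le (le_of_lt hr)]; ring
  rw [e] at key
  have hpos : (0 : ℝ) < l ^ (-1 - β) := Real.rpow_pos_of_pos hl _
  refine mul_left_cancel₀ hpos.ne' (key.trans ?_)
  have : l ^ (-1 - β) * l ^ β = l⁻¹ := by
    rw [← Real.rpow_add hl, show -1 - β + β = -1 by ring, Real.rpow_neg_one]
  rw [mul_left_comm, this, rpowConst, mul_comm]

end RpowIntegral

section GaussianMixture

open ProbabilityTheory

variable {E : Type*} [NormedAddCommGroup E] [InnerProductSpace ℝ E] [FiniteDimensional ℝ E]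
  [MeasurableSpace E] [BorelSpace E]

lemma integral_cexp_neg_mul_sq_norm_add_inner {b : ℝ} (hb : 0 < b) (t : E) :
    ∫ v : E, Complex.exp (-b * ‖v‖ ^ 2 + I * (⟪t, v⟫ : ℝ)) =
      (∫ v : E, Real.exp (-b * ‖v‖ ^ 2) : ℝ) * (Real.exp (-‖t‖ ^ 2 / (4 * b)) : ℝ) := by
  have hb' : 0 < (b : ℂ).re := by simpa
  have h2 : ((∫ v : E, Real.exp (-b * ‖v‖ ^ 2) : ℝ) : ℂ) =
      (π / b : ℂ) ^ (Module.finrank ℝ E / 2 : ℂ) := by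
    rw [← GaussianFourier.integral_cexp_neg_mul_sq_norm hb', ← integral_complex_ofReal]
    simp
  rw [GaussianFourier.integral_cexp_neg_mul_sq_norm_add hb', h2]
  simp

lemma integrable_exp_neg_mul_sq_norm {b : ℝ} (hb : 0 < b) :
    Integrable fun v : E => Real.exp (-b * ‖v‖ ^ 2) := by
  have := (GaussianFourier.integrable_cexp_neg_mul_sq_norm_add (V := E) (b := b) (by simpa) 0 0).re
  refine this.congr (ae_of_all _ fun v => ?_)
  simp only [inner_zero_left, Complex.ofReal_zero, mul_zero, add_zero]
  rw [← Complex.ofReal_neg, ← Complex.ofReal_pow, ← Complex.ofReal_mul, ← Complex.ofReal_exp]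
  exact Complex.ofReal_re _

lemma exists_smul_volume_ball_le_stdGaussian :
    ∃ κ > (0 : ℝ), ∀ s : Set E, MeasurableSet s →
      ENNReal.ofReal κ * volume (s ∩ Metric.ball 0 1) ≤ stdGaussian E s := by
  set c₀ := ∫ v : E, Real.exp (-(1 / 2) * ‖v‖ ^ 2) with hc₀
  have hi : Integrable fun v : E => Real.exp (-(1 / 2) * ‖v‖ ^ 2) :=
    integrable_exp_neg_mul_sq_norm (by norm_num)
  have pos : 0 < c₀ := integral_exp_pos hi
  set ν : Measure E := volume.withDensity fun v => ENNReal.ofReal (Real.exp (-(1 / 2) * ‖v‖ ^ 2))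
    with hν
  have : IsFiniteMeasure ν := isFiniteMeasure_withDensity_ofReal hi.2
  have : IsFiniteMeasure (ENNReal.ofReal c₀ • stdGaussian E) :=
    Measure.smul_finite _ ENNReal.ofReal_ne_top
  have eq : ν = ENNReal.ofReal c₀ • stdGaussian E := by
    refine Measure.ext_of_charFun (funext fun t => ?_)
    have e2 : charFun (ENNReal.ofReal c₀ • stdGaussian E) t =
        c₀ * charFun (stdGaussian E) t := by
      rw [charFun_apply, integral_smul_measure, ← charFun_apply]
      simp [pos.le]
    rw [e2, charFun_stdGaussian, charFun_apply, hν,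
      integral_withDensity_eq_integral_toReal_smul (by fun_prop) (by simp)]
    have := integral_cexp_neg_mul_sq_norm_add_inner (E := E) (b := 1 / 2) (by norm_num) t
    rw [← hc₀] at this
    convert this using 1
    · refine integral_congr_ae (ae_of_all _ fun v => ?_)
      simp only
      rw [ENNReal.toReal_ofReal (by positivity), Complex.exp_add, real_inner_comm, mul_comm I]
      simp
    · push_cast
      congr 3
      ring
  refine ⟨c₀⁻¹ * Real.exp (-(1 / 2)), by positivity, fun s hs => ?_⟩
  have h1 : ENNReal.ofReal (Real.exp (-(1 / 2))) * volume (s ∩ Metric.ball 0 1) ≤ ν s := by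
    refine le_trans ?_ (measure_mono (Set.inter_subset_left (t := Metric.ball 0 1)))
    rw [hν, withDensity_apply _ (hs.inter Metric.isOpen_ball.measurableSet), ← setLIntegral_const]
    refine setLIntegral_mono' (hs.inter Metric.isOpen_ball.measurableSet) fun v hv => ?_
    have : ‖v‖ < 1 := by simpa using hv.2
    refine ENNReal.ofReal_le_ofReal (Real.exp_le_exp.2 ?_)
    nlinarith [norm_nonneg v]
  rw [eq, Measure.smul_apply, smul_eq_mul] at h1
  rw [ENNReal.ofReal_mul (by positivity), ENNReal.ofReal_inv_of_pos pos, mul_assoc]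
  refine (mul_le_mul_right h1 _).trans_eq ?_
  rw [← mul_assoc, ENNReal.inv_mul_cancel (by simpa using pos) ENNReal.ofReal_ne_top, one_mul]

/-- The mixture of the centred Gaussians with covariance `2 r`, where `r` is chosen
according to `m`. -/
noncomputable def gaussMix (E : Type*) [NormedAddCommGroup E] [InnerProductSpace ℝ E]
    [FiniteDimensional ℝ E] [MeasurableSpace E] [BorelSpace E] (m : Measure ℝ) : Measure E :=
  (m.prod (stdGaussian E)).map fun p => √(2 * p.1) • p.2

instance (m : Measure ℝ) [IsFiniteMeasure m] : IsFiniteMeasure (gaussMix E m) := by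
  unfold gaussMix; infer_instance

lemma charFun_gaussMix (m : Measure ℝ) [IsFiniteMeasure m] (hm : ∀ᵐ r ∂m, 0 ≤ r) (η : E) :
    charFun (gaussMix E m) η = (∫ r, Real.exp (-(‖η‖ ^ 2 * r)) ∂m : ℝ) := by
  rw [charFun_apply, gaussMix, integral_map (by fun_prop) (by fun_prop), integral_prod]
  · rw [← integral_complex_ofReal]
    refine integral_congr_ae ?_
    filter_upwards [hm] with r hr
    have := charFun_stdGaussian (√(2 * r) • η)
    rw [charFun_apply] at this
    simp_rw [inner_smul_left, inner_smul_right] at this ⊢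
    rw [RCLike.conj_to_real]
    rw [this, norm_smul, Real.norm_of_nonneg (by positivity)]
    push_cast
    congr 1
    rw [mul_pow, ← Complex.ofReal_pow, Real.sq_sqrt (by positivity)]
    push_cast
    ring
  · exact (integrable_const (1 : ℝ)).mono (by fun_prop) (by simp)

lemma exists_weightMeasure_le_gaussMix {k : ℝ → ℝ} (hk : Measurable k) {c : ℝ} (hc : 0 < c)
    (h : ∀ r, 1 ≤ r → c * (r ^ 2)⁻¹ ≤ k r) {m : Measure ℝ}
    (hm : m = (volume.restrict (Set.Ioi 0)).withDensity fun r => ENNReal.ofReal (k r)) :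
    ∃ c' : ℝ≥0∞, c' ≠ 0 ∧ c' ≠ ∞ ∧
      weightMeasure E c' (Module.finrank ℝ E + 2) ≤ gaussMix E m := by
  obtain ⟨κ, hκ, hle⟩ := exists_smul_volume_ball_le_stdGaussian (E := E)
  set n := Module.finrank ℝ E with hn
  have : SFinite m := by rw [hm]; infer_instance
  refine ⟨ENNReal.ofReal (c * κ * 2⁻¹ ^ n / 4), by simp; positivity, ENNReal.ofReal_ne_top,
    Measure.le_iff.2 fun A hA => ?_⟩
  have dil : ∀ r, 0 < r → ∫⁻ u in A, ENNReal.ofReal (κ * (√(2 * r) ^ n)⁻¹) *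
      (Metric.ball (0 : E) (√(2 * r))).indicator 1 u ≤
      stdGaussian E ((fun x => √(2 * r) • x) ⁻¹' A) := by
    intro r hr
    have ha : 0 < √(2 * r) := by positivity
    refine le_trans (le_of_eq ?_) (hle _ (hA.preimage (by fun_prop)))
    have e : (fun x : E => √(2 * r) • x) ⁻¹' A ∩ Metric.ball 0 1 =
        (fun x : E => √(2 * r) • x) ⁻¹' (A ∩ Metric.ball 0 (√(2 * r))) := by
      ext x
      simp only [Set.mem_inter_iff, Set.mem_preimage, mem_ball_zero_iff, norm_smul,
        Real.norm_of_nonneg ha.le]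
      rw [mul_lt_iff_lt_one_right ha]
    rw [e, Measure.addHaar_preimage_smul _ ha.ne', abs_of_pos (by positivity),
      lintegral_const_mul' _ _ ENNReal.ofReal_ne_top,
      lintegral_indicator_one Metric.isOpen_ball.measurableSet,
      Measure.restrict_apply Metric.isOpen_ball.measurableSet, Set.inter_comm,
      ENNReal.ofReal_mul hκ.le, mul_assoc]
  have low : ∀ u : E, ENNReal.ofReal (c * κ * 2⁻¹ ^ n / 4) * weight u ^ (n + 2) ≤
      ∫⁻ r in Set.Ioi (0 : ℝ), ENNReal.ofReal (k r) * (ENNReal.ofReal (κ * (√(2 * r) ^ n)⁻¹) *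
        (Metric.ball (0 : E) (√(2 * r))).indicator 1 u) := by
    intro u
    set ω := 1 + ‖u‖ with hω
    have hω1 : 1 ≤ ω := by linarith [norm_nonneg u]
    have hω0 : 0 < ω := by linarith
    have sub : Set.Ioc (ω ^ 2) (2 * ω ^ 2) ⊆ Set.Ioi 0 := fun r hr =>
      lt_trans (by positivity : 0 < ω ^ 2) hr.1
    refine le_trans ?_ (lintegral_mono_set sub)
    calc _ = ENNReal.ofReal (c * ((2 * ω ^ 2) ^ 2)⁻¹ * (κ * ((2 * ω) ^ n)⁻¹)) *
          volume (Set.Ioc (ω ^ 2) (2 * ω ^ 2)) := by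
          rw [Real.volume_Ioc, weight_eq_ofReal, ← ENNReal.ofReal_pow (by positivity),
            ← ENNReal.ofReal_mul (by positivity), ← ENNReal.ofReal_mul (by positivity), ← hω]
          congr 1
          rw [mul_pow, inv_pow, inv_pow, mul_inv, pow_add]
          field_simp
          ring_nf
      _ = ∫⁻ _ in Set.Ioc (ω ^ 2) (2 * ω ^ 2),
          ENNReal.ofReal (c * ((2 * ω ^ 2) ^ 2)⁻¹ * (κ * ((2 * ω) ^ n)⁻¹)) := by
          rw [setLIntegral_const]
      _ ≤ _ := by
          refine setLIntegral_mono' measurableSet_Ioc fun r hr => ?_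
          have hr1 : 1 ≤ r := by nlinarith [hr.1]
          have s1 : √(2 * r) ≤ 2 * ω := Real.sqrt_le_iff.2 ⟨by positivity, by nlinarith [hr.2]⟩
          have s2 : ‖u‖ < √(2 * r) := Real.lt_sqrt_of_sq_lt (by nlinarith [hr.1, norm_nonneg u])
          rw [Set.indicator_of_mem (by simpa using s2), Pi.one_apply, mul_one,
            ENNReal.ofReal_mul (by positivity)]
          gcongr
          · exact le_trans (by gcongr; exact hr.2) (h r hr1)
  calc weightMeasure E _ (n + 2) A
      = ∫⁻ u in A, ENNReal.ofReal (c * κ * 2⁻¹ ^ n / 4) * weight u ^ (n + 2) := by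
        rw [weightMeasure, withDensity_apply _ hA]
    _ ≤ ∫⁻ u in A, ∫⁻ r in Set.Ioi (0 : ℝ), ENNReal.ofReal (k r) *
          (ENNReal.ofReal (κ * (√(2 * r) ^ n)⁻¹) *
            (Metric.ball (0 : E) (√(2 * r))).indicator 1 u) := lintegral_mono fun u => low u
    _ = ∫⁻ r in Set.Ioi (0 : ℝ), ENNReal.ofReal (k r) * ∫⁻ u in A,
          (ENNReal.ofReal (κ * (√(2 * r) ^ n)⁻¹) *
            (Metric.ball (0 : E) (√(2 * r))).indicator 1 u) := by
        rw [lintegral_lintegral_swap]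
        · exact lintegral_congr fun r => lintegral_const_mul' _ _ ENNReal.ofReal_ne_top
        · have ms : MeasurableSet {p : E × ℝ | ‖p.1‖ < √(2 * p.2)} :=
            measurableSet_lt (by fun_prop) (by fun_prop)
          have : (fun p : E × ℝ => (Metric.ball (0 : E) (√(2 * p.2))).indicator
              (1 : E → ℝ≥0∞) p.1) = {p : E × ℝ | ‖p.1‖ < √(2 * p.2)}.indicator 1 := by
            ext p
            by_cases hp : ‖p.1‖ < √(2 * p.2)
            · rw [Set.indicator_of_mem (by simpa using hp), Set.indicator_of_mem (by exact hp)]; rfl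
            · rw [Set.indicator_of_notMem (by simpa using hp),
                Set.indicator_of_notMem (by exact hp)]
          have mi : Measurable fun p : E × ℝ => (Metric.ball (0 : E) (√(2 * p.2))).indicator
              (1 : E → ℝ≥0∞) p.1 := by
            rw [this]; exact measurable_one.indicator ms
          refine Measurable.aemeasurable (Measurable.mul (by fun_prop) (Measurable.mul ?_ mi))
          fun_prop
    _ ≤ ∫⁻ r in Set.Ioi (0 : ℝ), ENNReal.ofReal (k r) *
          stdGaussian E ((fun x => √(2 * r) • x) ⁻¹' A) :=
        setLIntegral_mono' measurableSet_Ioi fun r hr => by gcongr; exact dil r hr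
    _ = gaussMix E m A := by
        have mA : MeasurableSet ((fun p : ℝ × E => √(2 * p.1) • p.2) ⁻¹' A) :=
          hA.preimage (by fun_prop)
        rw [gaussMix, Measure.map_apply (by fun_prop) hA, Measure.prod_apply mA, hm,
          lintegral_withDensity_eq_lintegral_mul _ (by fun_prop)
            (measurable_measure_prodMk_left mA)]
        rfl

end GaussianMixture

section Symbol

variable {E : Type*} [NormedAddCommGroup E] [InnerProductSpace ℝ E] [FiniteDimensional ℝ E]
  [MeasurableSpace E] [BorelSpace E]

lemma charFun_gaussMix_withDensity {S : Set ℝ} (hS : MeasurableSet S) (hS0 : S ⊆ Set.Ioi 0)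
    {k : ℝ → ℝ} (hk : Measurable k) (hk0 : ∀ r ∈ S, 0 ≤ k r) (hi : IntegrableOn k S) (η : E) :
    charFun (gaussMix E ((volume.restrict S).withDensity fun r => ENNReal.ofReal (k r))) η =
      (∫ r in S, k r * Real.exp (-(‖η‖ ^ 2 * r)) : ℝ) := by
  have := isFiniteMeasure_withDensity_ofReal hi.2
  rw [charFun_gaussMix]
  · congr 1
    rw [integral_withDensity_eq_integral_toReal_smul (by fun_prop) (by simp)]
    refine setIntegral_congr_fun hS fun r hr => ?_
    rw [ENNReal.toReal_ofReal (hk0 r hr), smul_eq_mul]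
  · refine (withDensity_absolutelyContinuous _ _).ae_le ?_
    filter_upwards [ae_restrict_mem hS] with r hr
    exact le_of_lt (hS0 hr)

/-- The density of the mixing measure of `jumpMeasure`. -/
noncomputable def jumpDensity (β r : ℝ) : ℝ :=
  (rpowConst β)⁻¹ * ((1 - Real.exp (-r)) * r ^ (-1 - β))

/-- The finite measure with characteristic function `(1 + ‖η‖ ^ 2) ^ β - (‖η‖ ^ 2) ^ β`. -/
noncomputable def jumpMeasure (E : Type*) [NormedAddCommGroup E] [InnerProductSpace ℝ E]
    [FiniteDimensional ℝ E] [MeasurableSpace E] [BorelSpace E] (β : ℝ) : Measure E :=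
  gaussMix E ((volume.restrict (Set.Ioi 0)).withDensity fun r => ENNReal.ofReal (jumpDensity β r))

lemma measurable_jumpDensity (β : ℝ) : Measurable (jumpDensity β) := by
  unfold jumpDensity; fun_prop

variable {β : ℝ}

lemma integrableOn_jumpDensity (h0 : 0 < β) (h1 : β < 1) :
    IntegrableOn (jumpDensity β) (Set.Ioi 0) := by
  have := (integrableOn_one_sub_exp_mul_rpow h0 h1 zero_le_one).const_mul (rpowConst β)⁻¹
  simp only [one_mul] at this
  exact this

lemma isFiniteMeasure_jumpMeasure (h0 : 0 < β) (h1 : β < 1) :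
    IsFiniteMeasure (jumpMeasure E β) := by
  have := isFiniteMeasure_withDensity_ofReal (integrableOn_jumpDensity h0 h1).2
  unfold jumpMeasure; infer_instance

lemma charFun_jumpMeasure (h0 : 0 < β) (h1 : β < 1) (η : E) :
    charFun (jumpMeasure E β) η = ((1 + ‖η‖ ^ 2) ^ β - (‖η‖ ^ 2) ^ β : ℝ) := by
  have hI := rpowConst_pos h0 h1
  rw [jumpMeasure, charFun_gaussMix_withDensity measurableSet_Ioi le_rfl
    (measurable_jumpDensity β) _ (integrableOn_jumpDensity h0 h1)]
  · congr 1
    have hl : 0 ≤ ‖η‖ ^ 2 := by positivity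
    have e : ∀ r : ℝ, jumpDensity β r * Real.exp (-(‖η‖ ^ 2 * r)) = (rpowConst β)⁻¹ *
        ((1 - Real.exp (-((1 + ‖η‖ ^ 2) * r))) * r ^ (-1 - β) -
          (1 - Real.exp (-(‖η‖ ^ 2 * r))) * r ^ (-1 - β)) := by
      intro r
      rw [jumpDensity, show -((1 + ‖η‖ ^ 2) * r) = -r + -(‖η‖ ^ 2 * r) by ring, Real.exp_add]
      ring
    simp_rw [e]
    rw [integral_const_mul, integral_sub (integrableOn_one_sub_exp_mul_rpow h0 h1 (by positivity))
      (integrableOn_one_sub_exp_mul_rpow h0 h1 hl),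
      integral_one_sub_exp_mul_rpow h0 (by positivity),
      integral_one_sub_exp_mul_rpow h0 hl]
    field_simp
  · intro r hr
    exact mul_nonneg (by positivity) (mul_nonneg (one_sub_exp_neg_mem (le_of_lt hr)).1
      (Real.rpow_nonneg (le_of_lt hr) _))

lemma exists_weightMeasure_le_jumpMeasure (h0 : 0 < β) (h1 : β < 1) :
    ∃ c : ℝ≥0∞, c ≠ 0 ∧ c ≠ ∞ ∧
      weightMeasure E c (Module.finrank ℝ E + 2) ≤ jumpMeasure E β := by
  have hI := rpowConst_pos h0 h1
  have he : Real.exp (-1) < 1 := by simp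
  refine exists_weightMeasure_le_gaussMix (measurable_jumpDensity β)
    (c := (rpowConst β)⁻¹ * (1 - Real.exp (-1)))
    (mul_pos (by positivity) (by linarith)) (fun r hr => ?_) rfl
  rw [jumpDensity, ← mul_assoc]
  have : (r ^ 2)⁻¹ ≤ r ^ (-1 - β) := by
    rw [← Real.rpow_natCast, ← Real.rpow_neg (by linarith)]
    exact Real.rpow_le_rpow_of_exponent_le hr (by push_cast; linarith)
  have h2 : Real.exp (-r) ≤ Real.exp (-1) := Real.exp_le_exp.2 (by linarith)
  have h3 : 0 ≤ 1 - Real.exp (-r) := by linarith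
  gcongr

/-- The density `e⁻ʳ r ^ (-1 - β)`, normalized. -/
noncomputable def temperedDensity (β r : ℝ) : ℝ :=
  (rpowConst β)⁻¹ * (Real.exp (-r) * r ^ (-1 - β))

/-- The compound Poisson approximation of the jump measure of the symbol
`(1 + ‖η‖ ^ 2) ^ β - 1`. -/
noncomputable def temperedMeasure (E : Type*) [NormedAddCommGroup E] [InnerProductSpace ℝ E]
    [FiniteDimensional ℝ E] [MeasurableSpace E] [BorelSpace E] (β : ℝ) (n : ℕ) : Measure E :=
  gaussMix E ((volume.restrict (Set.Ioi (1 / ((n : ℝ) + 1)))).withDensity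
    fun r => ENNReal.ofReal (temperedDensity β r))

/-- The symbol of the compound Poisson process with jump measure `temperedMeasure`, as a function
of the squared norm. -/
noncomputable def temperedSymbol (β : ℝ) (n : ℕ) (l : ℝ) : ℝ :=
  ∫ r in Set.Ioi (1 / ((n : ℝ) + 1)), temperedDensity β r * (1 - Real.exp (-(l * r)))

lemma measurable_temperedDensity (β : ℝ) : Measurable (temperedDensity β) := by
  unfold temperedDensity; fun_prop

lemma temperedDensity_nonneg (h0 : 0 < β) (h1 : β < 1) {r : ℝ} (hr : 0 < r) :
    0 ≤ temperedDensity β r := by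
  have := rpowConst_pos h0 h1
  unfold temperedDensity; positivity

lemma Ioi_one_div_subset (n : ℕ) : Set.Ioi (1 / ((n : ℝ) + 1)) ⊆ Set.Ioi 0 :=
  Set.Ioi_subset_Ioi (by positivity)

lemma integrableOn_temperedDensity (h0 : 0 < β) (n : ℕ) :
    IntegrableOn (temperedDensity β) (Set.Ioi (1 / ((n : ℝ) + 1))) := by
  refine Integrable.const_mul (Integrable.mono'
    (integrableOn_Ioi_rpow_of_lt (by linarith : -1 - β < -1) (by positivity))
    (Measurable.aestronglyMeasurable (by fun_prop)) ?_) _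
  filter_upwards [ae_restrict_mem measurableSet_Ioi] with r hr
  have hr0 : 0 < r := Ioi_one_div_subset n hr
  rw [Real.norm_of_nonneg (by positivity)]
  exact mul_le_of_le_one_left (by positivity) (by simpa using hr0.le)

lemma isFiniteMeasure_temperedMeasure (h0 : 0 < β) (n : ℕ) :
    IsFiniteMeasure (temperedMeasure E β n) := by
  have := isFiniteMeasure_withDensity_ofReal (integrableOn_temperedDensity h0 n).2
  unfold temperedMeasure; infer_instance

lemma charFun_temperedMeasure (h0 : 0 < β) (h1 : β < 1) (n : ℕ) (η : E) :
    charFun (temperedMeasure E β n) η =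
      ((∫ r in Set.Ioi (1 / ((n : ℝ) + 1)), temperedDensity β r) -
        temperedSymbol β n (‖η‖ ^ 2) : ℝ) := by
  have hi := integrableOn_temperedDensity h0 n
  rw [temperedMeasure, charFun_gaussMix_withDensity measurableSet_Ioi (Ioi_one_div_subset n)
    (measurable_temperedDensity β)
    (fun r hr => temperedDensity_nonneg h0 h1 (Ioi_one_div_subset n hr)) hi, temperedSymbol,
    ← integral_sub hi]
  · congr 2
    ext r
    ring
  · refine hi.mono' (Measurable.aestronglyMeasurable
      ((measurable_temperedDensity β).mul (by fun_prop))) ?_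
    filter_upwards [ae_restrict_mem measurableSet_Ioi] with r hr
    have hr0 : 0 < r := Ioi_one_div_subset n hr
    have h := one_sub_exp_neg_mem (mul_nonneg (sq_nonneg ‖η‖) hr0.le)
    have hp := temperedDensity_nonneg h0 h1 hr0
    rw [Real.norm_of_nonneg (mul_nonneg hp h.1)]
    exact mul_le_of_le_one_right hp (h.2.trans (min_le_right _ _))

lemma temperedDensity_mul_eq (l r : ℝ) : temperedDensity β r * (1 - Real.exp (-(l * r))) =
    (rpowConst β)⁻¹ * ((1 - Real.exp (-((1 + l) * r))) * r ^ (-1 - β) -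
      (1 - Real.exp (-(1 * r))) * r ^ (-1 - β)) := by
  rw [temperedDensity, show -((1 + l) * r) = -r + -(l * r) by ring, Real.exp_add, one_mul]
  ring

lemma integrableOn_temperedDensity_mul (h0 : 0 < β) (h1 : β < 1) {l : ℝ} (hl : 0 ≤ l) :
    IntegrableOn (fun r => temperedDensity β r * (1 - Real.exp (-(l * r)))) (Set.Ioi 0) := by
  simp_rw [temperedDensity_mul_eq]
  exact ((integrableOn_one_sub_exp_mul_rpow h0 h1 (by positivity)).sub
    (integrableOn_one_sub_exp_mul_rpow h0 h1 zero_le_one)).const_mul _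

lemma integral_temperedDensity_mul (h0 : 0 < β) (h1 : β < 1) {l : ℝ} (hl : 0 ≤ l) :
    ∫ r in Set.Ioi 0, temperedDensity β r * (1 - Real.exp (-(l * r))) = (1 + l) ^ β - 1 := by
  have hI := rpowConst_pos h0 h1
  simp_rw [temperedDensity_mul_eq]
  rw [integral_const_mul, integral_sub (integrableOn_one_sub_exp_mul_rpow h0 h1 (by positivity))
      (integrableOn_one_sub_exp_mul_rpow h0 h1 zero_le_one),
      integral_one_sub_exp_mul_rpow h0 (by positivity),
      integral_one_sub_exp_mul_rpow h0 zero_le_one]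
  field_simp
  simp

lemma temperedDensity_mul_nonneg (h0 : 0 < β) (h1 : β < 1) {l : ℝ} (hl : 0 ≤ l) :
    ∀ r ∈ Set.Ioi (0 : ℝ), 0 ≤ temperedDensity β r * (1 - Real.exp (-(l * r))) := fun _ hr =>
  mul_nonneg (temperedDensity_nonneg h0 h1 hr) (one_sub_exp_neg_mem (mul_nonneg hl (le_of_lt hr))).1

lemma temperedSymbol_nonneg (h0 : 0 < β) (h1 : β < 1) (n : ℕ) {l : ℝ} (hl : 0 ≤ l) :
    0 ≤ temperedSymbol β n l :=
  setIntegral_nonneg measurableSet_Ioi fun r hr =>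
    temperedDensity_mul_nonneg h0 h1 hl r (Ioi_one_div_subset n hr)

lemma temperedSymbol_le (h0 : 0 < β) (h1 : β < 1) (n : ℕ) {l : ℝ} (hl : 0 ≤ l) :
    temperedSymbol β n l ≤ (1 + l) ^ β - 1 := by
  rw [← integral_temperedDensity_mul h0 h1 hl]
  refine setIntegral_mono_set (integrableOn_temperedDensity_mul h0 h1 hl) ?_
    (Ioi_one_div_subset n).eventuallyLE
  filter_upwards [ae_restrict_mem measurableSet_Ioi] with r hr
  exact temperedDensity_mul_nonneg h0 h1 hl r hr

lemma tendsto_temperedSymbol (h0 : 0 < β) (h1 : β < 1) {l : ℝ} (hl : 0 ≤ l) :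
    Tendsto (fun n => temperedSymbol β n l) atTop (𝓝 ((1 + l) ^ β - 1)) := by
  have hU : ⋃ n : ℕ, Set.Ioi (1 / ((n : ℝ) + 1)) = Set.Ioi 0 := by
    refine subset_antisymm (Set.iUnion_subset Ioi_one_div_subset) fun r hr => ?_
    obtain ⟨n, hn⟩ := exists_nat_one_div_lt (show (0 : ℝ) < r from hr)
    exact Set.mem_iUnion.2 ⟨n, hn⟩
  rw [← integral_temperedDensity_mul h0 h1 hl, ← hU]
  refine tendsto_setIntegral_of_monotone (fun n => measurableSet_Ioi) ?_ ?_
  · exact fun m n hmn => Set.Ioi_subset_Ioi (one_div_le_one_div_of_le (by positivity) (by gcongr))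
  · rw [hU]; exact integrableOn_temperedDensity_mul h0 h1 hl

end Symbol

section RayCharFun

variable {E : Type*} [NormedAddCommGroup E] [InnerProductSpace ℝ E] [FiniteDimensional ℝ E]
  [MeasurableSpace E] [BorelSpace E]

lemma integrable_cexp_ofReal_mul_I {X : Type*} [MeasurableSpace X] {μ : Measure X}
    [IsFiniteMeasure μ] {f : X → ℝ} (hf : Measurable f) :
    Integrable (fun x => Complex.exp (f x * I)) μ :=
  (integrable_const (1 : ℝ)).mono (by fun_prop)
    (ae_of_all _ fun x => by simp [Complex.norm_exp_ofReal_mul_I])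

instance (a b : ℝ) (ρ : Measure E) [IsFiniteMeasure ρ] :
    IsFiniteMeasure (rayMeasure (Set.Ioc a b) ρ) := by
  unfold rayMeasure; infer_instance

lemma inner_ray (s : ℝ) (u : E) (w : WithLp 2 (E × E)) :
    (⟪ray s u, w⟫ : ℝ) = ⟪u, s • w.fst + w.snd⟫ := by
  rw [WithLp.prod_inner_apply, inner_add_right, inner_smul_right, ← real_inner_smul_left]
  rfl

lemma charFun_rayMeasure (a b : ℝ) (ρ : Measure E) [IsFiniteMeasure ρ] (w : WithLp 2 (E × E)) :
    charFun (rayMeasure (Set.Ioc a b) ρ) w =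
      ∫ s in Set.Ioc a b, charFun ρ (s • w.fst + w.snd) := by
  rw [charFun_apply, rayMeasure, integral_map (by fun_prop) (by fun_prop), integral_prod]
  · simp_rw [inner_ray, charFun_apply]
  · exact integrable_cexp_ofReal_mul_I (by fun_prop)

lemma rayMeasure_mono {I J : Set ℝ} (h : I ⊆ J) {ρ ρ' : Measure E} [SFinite ρ] [SFinite ρ']
    (hρ : ρ ≤ ρ') : rayMeasure I ρ ≤ rayMeasure J ρ' := by
  refine Measure.map_mono (Measure.prod_mono (Measure.restrict_mono h le_rfl) hρ) ?_
  fun_prop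

lemma rayMeasure_add_le {ρ ρ' : Measure E} [SFinite ρ] [SFinite ρ'] (hρ : ρ ≤ ρ') :
    rayMeasure (Set.Ioc 0 (1 / 3)) ρ + rayMeasure (Set.Ioc (2 / 3) 1) ρ ≤
      rayMeasure (Set.Ioc 0 1) ρ' := by
  have hd : Disjoint (Set.Ioc (0 : ℝ) (1 / 3)) (Set.Ioc (2 / 3) 1) :=
    Set.disjoint_left.2 fun x hx hx' => by linarith [hx.2, hx'.1]
  have e : rayMeasure (Set.Ioc 0 (1 / 3)) ρ + rayMeasure (Set.Ioc (2 / 3) 1) ρ =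
      rayMeasure (Set.Ioc 0 (1 / 3) ∪ Set.Ioc (2 / 3) 1) ρ := by
    rw [rayMeasure, rayMeasure, rayMeasure, Measure.restrict_union hd measurableSet_Ioc,
      Measure.add_prod, Measure.map_add _ _ (by fun_prop)]
  rw [e]
  refine rayMeasure_mono (Set.union_subset ?_ ?_) hρ
  · exact Set.Ioc_subset_Ioc le_rfl (by norm_num)
  · exact Set.Ioc_subset_Ioc (by norm_num) le_rfl

lemma exists_charFun_conv_eq {β : ℝ} (h0 : 0 < β) (h1 : β < 1) :
    ∃ c : ℝ≥0∞, c ≠ 0 ∧ c ≠ ∞ ∧ ∃ σ₁ σ₂ σ₃ : Measure (WithLp 2 (E × E)),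
      IsFiniteMeasure σ₁ ∧ IsFiniteMeasure σ₂ ∧ IsFiniteMeasure σ₃ ∧
      σ₁ = rayMeasure (Set.Ioc 0 (1 / 3)) (weightMeasure E c (Module.finrank ℝ E + 2)) ∧
      σ₂ = rayMeasure (Set.Ioc (2 / 3) 1) (weightMeasure E c (Module.finrank ℝ E + 2)) ∧
      ∀ w, charFun (convExp σ₁ ∗ (convExp σ₂ ∗ convExp σ₃)) w =
        (Real.exp (∫ s in Set.Ioc (0 : ℝ) 1, ((1 + ‖s • w.fst + w.snd‖ ^ 2) ^ β -
          (‖s • w.fst + w.snd‖ ^ 2) ^ β)) : ℝ) := by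
  obtain ⟨c, hc, hc', hle⟩ := exists_weightMeasure_le_jumpMeasure (E := E) h0 h1
  have := isFiniteMeasure_jumpMeasure (E := E) h0 h1
  have : IsFiniteMeasure (weightMeasure E c (Module.finrank ℝ E + 2)) := isFiniteMeasure_of_le _ hle
  set ρ := weightMeasure E c (Module.finrank ℝ E + 2)
  set σ₁ := rayMeasure (Set.Ioc 0 (1 / 3)) ρ with hσ₁
  set σ₂ := rayMeasure (Set.Ioc (2 / 3) 1) ρ with hσ₂
  set σ := rayMeasure (Set.Ioc 0 1) (jumpMeasure E β) with hσ
  have hsum : σ - (σ₁ + σ₂) + (σ₁ + σ₂) = σ := Measure.sub_add_cancel_of_le (rayMeasure_add_le hle)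
  have hfin : IsFiniteMeasure (σ - (σ₁ + σ₂)) := isFiniteMeasure_of_le σ Measure.sub_le
  refine ⟨c, hc, hc', σ₁, σ₂, σ - (σ₁ + σ₂), inferInstance, inferInstance, hfin, rfl, rfl,
    fun w => ?_⟩
  have hconv : ∀ μ ν : Measure (WithLp 2 (E × E)), IsFiniteMeasure μ → IsFiniteMeasure ν →
      charFun (μ + ν) w = charFun μ w + charFun ν w := by
    intro μ ν _ _
    rw [charFun_apply, integral_add_measure, ← charFun_apply, ← charFun_apply]
    · exact integrable_cexp_ofReal_mul_I (by fun_prop)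
    · exact integrable_cexp_ofReal_mul_I (by fun_prop)
  have key : charFun σ₁ w + (charFun σ₂ w + charFun (σ - (σ₁ + σ₂)) w) = charFun σ w := by
    rw [← hsum, hconv _ _ hfin inferInstance, hconv _ _ inferInstance inferInstance, hsum]
    ring
  rw [charFun_conv, charFun_conv, charFun_convExp, charFun_convExp, charFun_convExp,
    ← Complex.exp_add, ← Complex.exp_add, key, hσ, charFun_rayMeasure, Complex.ofReal_exp]
  simp_rw [charFun_jumpMeasure h0 h1]
  rw [integral_complex_ofReal]

end RayCharFun

section ParametricIntegral

open scoped ContDiff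

universe u

variable {V : Type u} [NormedAddCommGroup V] [NormedSpace ℝ V]

lemma contDiff_integral_and_bound (n : ℕ) : ∀ {F : Type u} [NormedAddCommGroup F]
    [NormedSpace ℝ F] {G : ℝ → V → F}, ContDiff ℝ ∞ (Function.uncurry G) →
    (∀ m, ∃ (k : ℕ) (C : ℝ), ∀ s ∈ Set.Ioc (0 : ℝ) 1, ∀ x,
      ‖iteratedFDeriv ℝ m (G s) x‖ ≤ C * (1 + ‖x‖) ^ k) →
    ContDiff ℝ n (fun x => ∫ s in Set.Ioc (0 : ℝ) 1, G s x) ∧ ∃ (k : ℕ) (C : ℝ), ∀ x,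
      ‖iteratedFDeriv ℝ n (fun x => ∫ s in Set.Ioc (0 : ℝ) 1, G s x) x‖ ≤ C * (1 + ‖x‖) ^ k := by
  have main : ∀ {F : Type u} [NormedAddCommGroup F]
      [NormedSpace ℝ F] {G : ℝ → V → F}, ContDiff ℝ ∞ (Function.uncurry G) →
      (∀ m, ∃ (k : ℕ) (C : ℝ), ∀ s ∈ Set.Ioc (0 : ℝ) 1, ∀ x,
        ‖iteratedFDeriv ℝ m (G s) x‖ ≤ C * (1 + ‖x‖) ^ k) → ∀ x,
      HasFDerivAt (fun x => ∫ s in Set.Ioc (0 : ℝ) 1, G s x)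
        (∫ s in Set.Ioc (0 : ℝ) 1, fderiv ℝ (G s) x) x := by
    intro F _ _ G hG hb x
    have hc : ∀ y, Continuous fun s => G s y := fun y => by
      simpa [Function.comp_def] using hG.continuous.comp (Continuous.prodMk_left y)
    have hc' : Continuous fun s => fderiv ℝ (G s) x :=
      (ContDiff.fderiv (f := G) (g := fun _ => x) hG (contDiff_const (n := 0))
        (by simp)).continuous
    obtain ⟨k, C, hC⟩ := hb 1
    refine hasFDerivAt_integral_of_dominated_of_fderiv_le
      (F := fun y s => G s y) (F' := fun y s => fderiv ℝ (G s) y)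
      (bound := fun _ => |C| * (1 + (‖x‖ + 1)) ^ k) (Metric.ball_mem_nhds x one_pos)
      (Filter.Eventually.of_forall fun y => (hc y).aestronglyMeasurable)
      (((hc x).integrableOn_Icc).mono_set Set.Ioc_subset_Icc_self)
      hc'.aestronglyMeasurable ?_ (integrable_const _) ?_
    · refine (ae_restrict_mem measurableSet_Ioc).mono fun s hs y hy => ?_
      have h := hC s hs y
      rw [norm_iteratedFDeriv_one] at h
      have hy' : ‖y‖ ≤ ‖x‖ + 1 := by
        have := norm_sub_norm_le y x
        rw [mem_ball_iff_norm] at hy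
        linarith
      exact h.trans (by gcongr; exact le_abs_self C)
    · refine ae_of_all _ fun s y _ => ?_
      have : ContDiff ℝ ∞ (G s) := hG.comp (contDiff_prodMk_right s)
      exact (this.differentiable (by simp) y).hasFDerivAt
  induction n with
  | zero =>
    intro F _ _ G hG hb
    refine ⟨contDiff_zero.2 (continuous_iff_continuousAt.2 fun x => (main hG hb x).continuousAt),
      ?_⟩
    obtain ⟨k, C, hC⟩ := hb 0
    refine ⟨k, C, fun x => ?_⟩
    simp only [norm_iteratedFDeriv_zero] at hC ⊢
    refine (norm_setIntegral_le_of_norm_le_const (by simp) fun s hs => hC s hs x).trans ?_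
    simp
  | succ n ih =>
    intro F _ _ G hG hb
    have hd : fderiv ℝ (fun x => ∫ s in Set.Ioc (0 : ℝ) 1, G s x) =
        fun x => ∫ s in Set.Ioc (0 : ℝ) 1, fderiv ℝ (G s) x :=
      funext fun x => (main hG hb x).fderiv
    obtain ⟨h₁, k, C, h₂⟩ := ih (G := fun s x => fderiv ℝ (G s) x)
      (by
        have : ContDiff ℝ ∞ (Function.uncurry fun p : ℝ × V => G p.1) :=
          hG.comp ((contDiff_fst.comp contDiff_fst).prodMk contDiff_snd)
        exact ContDiff.fderiv (f := fun p : ℝ × V => G p.1) this contDiff_snd (by simp))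
      (fun m => by
        obtain ⟨k, C, hC⟩ := hb (m + 1)
        exact ⟨k, C, fun s hs x => by rw [norm_iteratedFDeriv_fderiv]; exact hC s hs x⟩)
    rw [← hd] at h₁ h₂
    refine ⟨?_, k, C, fun x => ?_⟩
    · push_cast
      exact contDiff_succ_iff_fderiv.2
        ⟨fun x => (main hG hb x).differentiableAt, by simp, h₁⟩
    · rw [← norm_iteratedFDeriv_fderiv]
      exact h₂ x

lemma hasTemperateGrowth_integral_comp {W F : Type u} [NormedAddCommGroup W] [NormedSpace ℝ W]
    [NormedAddCommGroup F] [NormedSpace ℝ F]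
    {f : W → F} (hf : f.HasTemperateGrowth) (A B : V →L[ℝ] W) :
    (fun x => ∫ s in Set.Ioc (0 : ℝ) 1, f (s • A x + B x)).HasTemperateGrowth := by
  set L : ℝ → V →L[ℝ] W := fun s => s • A + B
  have hL : ContDiff ℝ ∞ L := (contDiff_id.smul contDiff_const).add contDiff_const
  set M := ‖A‖ + ‖B‖
  have hM : ∀ s ∈ Set.Ioc (0 : ℝ) 1, ‖L s‖ ≤ M := fun s hs => by
    refine (norm_add_le (s • A) B).trans (add_le_add_left ?_ _)
    rw [norm_smul, Real.norm_eq_abs, abs_of_pos hs.1]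
    exact mul_le_of_le_one_left (norm_nonneg _) hs.2
  have hM0 : 0 ≤ M := by positivity
  have key := fun n => contDiff_integral_and_bound n (G := fun s x => f (L s x))
    (hf.1.comp ((hL.comp contDiff_fst).clm_apply contDiff_snd))
    (fun m => by
      obtain ⟨k, C, hC⟩ := hf.2 m
      refine ⟨k, |C| * (1 + M) ^ k * M ^ m, fun s hs x => ?_⟩
      have h := (L s).iteratedFDeriv_comp_right hf.1 x (i := m) (by exact_mod_cast le_top)
      change ‖iteratedFDeriv ℝ m (f ∘ L s) x‖ ≤ _
      rw [h]
      refine (ContinuousMultilinearMap.norm_compContinuousLinearMap_le _ _).trans ?_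
      rw [Finset.prod_const, Finset.card_univ, Fintype.card_fin]
      have h1 : ‖L s x‖ ≤ M * ‖x‖ := ((L s).le_opNorm x).trans (by gcongr; exact hM s hs)
      have h2 : 1 + ‖L s x‖ ≤ (1 + M) * (1 + ‖x‖) := by nlinarith [norm_nonneg x]
      calc _ ≤ (|C| * ((1 + M) * (1 + ‖x‖)) ^ k) * M ^ m := by
            refine mul_le_mul ((hC _).trans ?_) (by gcongr; exact hM s hs) (by positivity)
              (by positivity)
            gcongr
            exact le_abs_self C
        _ = _ := by rw [mul_pow]; ring)
  exact ⟨contDiff_infty.2 fun n => (key n).1, fun n => (key n).2⟩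

end ParametricIntegral

section ExpNeg

open scoped ContDiff SchwartzMap

lemma exists_one_add_pow_mul_exp_neg_le {c a : ℝ} (hc : 0 < c) (ha : 0 < a) (m : ℕ) :
    ∃ C, ∀ t, 0 ≤ t → (1 + t) ^ m * Real.exp (-(c * t ^ a)) ≤ C := by
  obtain ⟨j, hj⟩ := exists_nat_ge (m / a)
  have hj' : (m : ℝ) ≤ a * j := by rw [div_le_iff₀ ha] at hj; linarith
  refine ⟨2 ^ m * (1 + j ! / c ^ j), fun t ht => ?_⟩
  rcases le_total t 1 with h | h
  · have h1 : Real.exp (-(c * t ^ a)) ≤ 1 := Real.exp_le_one_iff.2 (by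
      rw [neg_nonpos]; positivity)
    have h2 : (1 + t) ^ m ≤ 2 ^ m := by gcongr; linarith
    calc _ ≤ (2 : ℝ) ^ m * 1 := by gcongr
      _ ≤ _ := by
        gcongr
        rw [le_add_iff_nonneg_right]
        positivity
  · have h1 := Real.pow_div_factorial_le_exp (c * t ^ a) (by positivity) j
    have h2 : t ^ m ≤ (t ^ a) ^ j := by
      rw [← Real.rpow_natCast, ← Real.rpow_natCast, ← Real.rpow_mul ht]
      exact Real.rpow_le_rpow_of_exponent_le h hj'
    have h3 : (1 + t) ^ m ≤ 2 ^ m * t ^ m := by rw [← mul_pow]; gcongr; linarith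
    rw [mul_pow, div_le_iff₀ (by positivity)] at h1
    have h4 : t ^ m ≤ j ! / c ^ j * Real.exp (c * t ^ a) := by
      rw [div_mul_eq_mul_div, le_div_iff₀ (by positivity)]
      calc t ^ m * c ^ j ≤ (t ^ a) ^ j * c ^ j := by gcongr
        _ ≤ _ := by linarith
    calc (1 + t) ^ m * Real.exp (-(c * t ^ a))
        ≤ (2 ^ m * (j ! / c ^ j * Real.exp (c * t ^ a))) * Real.exp (-(c * t ^ a)) := by
          gcongr
          exact h3.trans (by gcongr)
      _ = 2 ^ m * (j ! / c ^ j) * (Real.exp (c * t ^ a) * Real.exp (-(c * t ^ a))) := by ring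
      _ = 2 ^ m * (j ! / c ^ j) := by rw [← Real.exp_add]; simp
      _ ≤ _ := by gcongr; linarith

lemma exists_schwartzMap_exp_neg {V : Type*} [NormedAddCommGroup V] [NormedSpace ℝ V]
    {Φ : V → ℝ} (hΦ : Φ.HasTemperateGrowth) {c a : ℝ} (hc : 0 < c) (ha : 0 < a)
    (hlow : ∀ x, c * ‖x‖ ^ a ≤ Φ x) :
    ∃ f : 𝓢(V, ℂ), ∀ x, f x = (Real.exp (-Φ x) : ℝ) := by
  have hsm : ContDiff ℝ ∞ (fun x => Real.exp (-Φ x)) := hΦ.1.neg.exp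
  refine ⟨⟨fun x => (Real.exp (-Φ x) : ℝ), Complex.ofRealCLM.contDiff.comp hsm, fun k n => ?_⟩,
    fun x => rfl⟩
  obtain ⟨l, D, hD0, hD⟩ := hΦ.norm_iteratedFDeriv_le_uniform n
  obtain ⟨C, hC⟩ := exists_one_add_pow_mul_exp_neg_le hc ha (k + l * n)
  refine ⟨n ! * (1 + D) ^ n * C, fun x => ?_⟩
  have h1 : ‖iteratedFDeriv ℝ n (fun x => ((Real.exp (-Φ x) : ℝ) : ℂ)) x‖ =
      ‖iteratedFDeriv ℝ n (Real.exp ∘ (fun x => -Φ x)) x‖ :=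
    Complex.ofRealLI.norm_iteratedFDeriv_comp_left (hsm.contDiffAt) (by exact_mod_cast le_top)
  have hx1 : 1 ≤ (1 + ‖x‖) ^ l := one_le_pow₀ (by linarith [norm_nonneg x])
  have hone : 1 ≤ (1 + D) * (1 + ‖x‖) ^ l := by nlinarith
  have h2 := norm_iteratedFDeriv_comp_le (g := Real.exp) (f := fun x => -Φ x) (N := ∞) (n := n)
    Real.contDiff_exp hΦ.1.neg (by exact_mod_cast le_top) x (C := Real.exp (-Φ x))
    (D := (1 + D) * (1 + ‖x‖) ^ l)
    (fun i _ => by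
      rw [norm_iteratedFDeriv_eq_norm_iteratedDeriv, iteratedDeriv_eq_iterate,
        Real.iter_deriv_exp, Real.norm_eq_abs, Real.abs_exp])
    (fun i hi hin => by
      have e : iteratedFDeriv ℝ i (fun x => -Φ x) x = -iteratedFDeriv ℝ i Φ x :=
        iteratedFDeriv_neg_apply
      rw [e, norm_neg]
      calc _ ≤ D * (1 + ‖x‖) ^ l := hD i hin x
        _ ≤ (1 + D) * (1 + ‖x‖) ^ l := by gcongr; linarith
        _ ≤ _ := le_self_pow₀ hone (by lia))
  have h3 : Real.exp (-Φ x) ≤ Real.exp (-(c * ‖x‖ ^ a)) :=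
    Real.exp_le_exp.2 (neg_le_neg (hlow x))
  rw [h1]
  calc _ ≤ (1 + ‖x‖) ^ k *
        (n ! * Real.exp (-(c * ‖x‖ ^ a)) * ((1 + D) * (1 + ‖x‖) ^ l) ^ n) := by
        gcongr
        · linarith
        · exact h2.trans (by gcongr)
    _ = n ! * (1 + D) ^ n * ((1 + ‖x‖) ^ (k + l * n) * Real.exp (-(c * ‖x‖ ^ a))) := by
        rw [mul_pow, pow_add, pow_mul]; ring
    _ ≤ _ := by gcongr; exact hC _ (norm_nonneg x)

end ExpNeg

section TemperedKernel

open scoped ContDiff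

variable {E : Type} [NormedAddCommGroup E] [InnerProductSpace ℝ E]

/-- The symbol `∫₀¹ (1 + |sξ + η|²) ^ β ds` of the kinetic semigroup of a tempered process. -/
noncomputable def kinSymbol (β : ℝ) (w : WithLp 2 (E × E)) : ℝ :=
  ∫ s in Set.Ioc (0 : ℝ) 1, (1 + ‖s • w.fst + w.snd‖ ^ 2) ^ β

lemma hasTemperateGrowth_kinSymbol (β : ℝ) :
    (kinSymbol β : WithLp 2 (E × E) → ℝ).HasTemperateGrowth :=
  hasTemperateGrowth_integral_comp (Function.hasTemperateGrowth_one_add_norm_sq_rpow E β)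
    (WithLp.fstL 2 ℝ E E) (WithLp.sndL 2 ℝ E E)

lemma continuous_kinSymbol_integrand (β : ℝ) (w : WithLp 2 (E × E)) :
    Continuous fun s : ℝ => (1 + ‖s • w.fst + w.snd‖ ^ 2) ^ β :=
  Continuous.rpow_const (by fun_prop) fun s => Or.inl (by positivity)

lemma le_kinSymbol {β : ℝ} (hβ : 0 ≤ β) (w : WithLp 2 (E × E)) :
    1 / 3 * (1 / 5) ^ (2 * β) * ‖w‖ ^ (2 * β) ≤ kinSymbol β w := by
  set f : ℝ → ℝ := fun s => (1 + ‖s • w.fst + w.snd‖ ^ 2) ^ β with hf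
  have hfc : Continuous f := continuous_kinSymbol_integrand β w
  have hi : ∀ a b, IntervalIntegrable f volume a b := fun a b => hfc.intervalIntegrable a b
  have hf0 : ∀ s, 0 ≤ f s := fun s => by positivity
  have hlow : ∀ s N, 0 ≤ N → N ≤ ‖s • w.fst + w.snd‖ → N ^ (2 * β) ≤ f s := fun s N hN h => by
    rw [Real.rpow_mul hN]
    refine Real.rpow_le_rpow (by positivity) ?_ hβ
    rw [Real.rpow_two]
    nlinarith
  have hpair : ∀ s ∈ Set.Icc (0 : ℝ) (1 / 3), (‖w‖ / 5) ^ (2 * β) ≤ f s + f (s + 2 / 3) := by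
    intro s hs
    have hw : ‖w‖ ≤ ‖w.fst‖ + ‖w.snd‖ := by
      rw [WithLp.prod_norm_eq_of_L2]
      refine Real.sqrt_le_iff.2 ⟨by positivity, ?_⟩
      nlinarith [norm_nonneg w.fst, norm_nonneg w.snd]
    have h1 : ‖w.fst‖ ≤ 3 / 2 * (‖(s + 2 / 3) • w.fst + w.snd‖ + ‖s • w.fst + w.snd‖) := by
      have e : w.fst = (3 / 2 : ℝ) • (((s + 2 / 3) • w.fst + w.snd) - (s • w.fst + w.snd)) := by
        module
      calc ‖w.fst‖ = _ := congrArg norm e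
        _ = 3 / 2 * ‖((s + 2 / 3) • w.fst + w.snd) - (s • w.fst + w.snd)‖ := by
          rw [norm_smul]; norm_num
        _ ≤ _ := by gcongr; exact norm_sub_le _ _
    have h2 : ‖w.snd‖ ≤ ‖s • w.fst + w.snd‖ + 1 / 3 * ‖w.fst‖ := by
      have e : w.snd = (s • w.fst + w.snd) - s • w.fst := by module
      calc ‖w.snd‖ = _ := congrArg norm e
        _ ≤ ‖s • w.fst + w.snd‖ + ‖s • w.fst‖ := norm_sub_le _ _
        _ ≤ _ := by
          rw [norm_smul, Real.norm_eq_abs, abs_of_nonneg hs.1]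
          gcongr
          exact hs.2
    rcases le_total (‖w‖ / 5) ‖s • w.fst + w.snd‖ with h | h
    · linarith [hlow s _ (by positivity) h, hf0 (s + 2 / 3)]
    · linarith [hlow (s + 2 / 3) (‖w‖ / 5) (by positivity) (by linarith), hf0 s]
  have e1 : kinSymbol β w = (∫ s in (0 : ℝ)..1 / 3, f s) + (∫ s in (1 / 3 : ℝ)..2 / 3, f s) +
      ∫ s in (2 / 3 : ℝ)..1, f s := by
    rw [intervalIntegral.integral_add_adjacent_intervals (hi _ _) (hi _ _),
      intervalIntegral.integral_add_adjacent_intervals (hi _ _) (hi _ _),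
      intervalIntegral.integral_of_le zero_le_one]
    rfl
  have e2 : ∫ s in (2 / 3 : ℝ)..1, f s = ∫ s in (0 : ℝ)..1 / 3, f (s + 2 / 3) := by
    rw [intervalIntegral.integral_comp_add_right]; norm_num
  have e3 : 0 ≤ ∫ s in (1 / 3 : ℝ)..2 / 3, f s :=
    intervalIntegral.integral_nonneg (by norm_num) fun s _ => hf0 s
  have e4 : ∫ s in (0 : ℝ)..1 / 3, (‖w‖ / 5) ^ (2 * β) ≤
      ∫ s in (0 : ℝ)..1 / 3, (f s + f (s + 2 / 3)) :=
    intervalIntegral.integral_mono_on (by norm_num) (by simp)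
      ((hfc.add (hfc.comp (by fun_prop))).intervalIntegrable _ _) hpair
  rw [intervalIntegral.integral_add (hi _ _)
      ((show Continuous fun s => f (s + 2 / 3) from hfc.comp (by fun_prop)).intervalIntegrable _ _),
    intervalIntegral.integral_const, smul_eq_mul, sub_zero, div_eq_mul_one_div ‖w‖,
    Real.mul_rpow (by positivity) (by positivity)] at e4
  rw [e1, e2]
  linarith

end TemperedKernel

section SchwartzKernel

open scoped SchwartzMap FourierTransform

lemma SchwartzMap.exists_norm_sub_le {V F : Type*} [NormedAddCommGroup V] [NormedSpace ℝ V]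
    [NormedAddCommGroup F] [NormedSpace ℝ F] (g : 𝓢(V, F)) (m : ℕ) :
    ∃ C, 0 ≤ C ∧ ∀ z h, ‖h‖ ≤ 1 → ‖g (z + h) - g z‖ ≤ C * (1 + ‖z‖)⁻¹ ^ m * ‖h‖ := by
  obtain ⟨C, hC⟩ : ∃ C, ∀ y, (1 + ‖y‖) ^ m * ‖fderiv ℝ g y‖ ≤ C :=
    ⟨_, fun y => by
      have := SchwartzMap.one_add_le_sup_seminorm_apply (𝕜 := ℝ) (m := (m, 1)) le_rfl le_rfl g y
      rwa [norm_iteratedFDeriv_one] at this⟩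
  have hC0 : 0 ≤ C := (by positivity : (0 : ℝ) ≤ _).trans (hC 0)
  refine ⟨C * 2 ^ m, by positivity, fun z h hh => ?_⟩
  have key := (convex_closedBall z 1).norm_image_sub_le_of_norm_fderiv_le (𝕜 := ℝ) (f := g)
    (C := C * 2 ^ m * (1 + ‖z‖)⁻¹ ^ m) (x := z) (y := z + h)
    (fun y _ => g.differentiableAt) (fun y hy => by
      rw [mem_closedBall_iff_norm] at hy
      have h1 : ‖z‖ ≤ ‖y‖ + 1 := by
        have := norm_sub_norm_le z y
        rw [norm_sub_rev] at this
        linarith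
      have h2 : 1 + ‖z‖ ≤ 2 * (1 + ‖y‖) := by linarith [norm_nonneg y]
      have h3 : (1 + ‖z‖) ^ m ≤ 2 ^ m * (1 + ‖y‖) ^ m := by
        rw [← mul_pow]
        gcongr
      rw [inv_pow, ← div_eq_mul_inv, le_div_iff₀ (by positivity)]
      calc _ ≤ ‖fderiv ℝ g y‖ * (2 ^ m * (1 + ‖y‖) ^ m) := by gcongr
        _ = 2 ^ m * ((1 + ‖y‖) ^ m * ‖fderiv ℝ g y‖) := by ring
        _ ≤ 2 ^ m * C := by gcongr; exact hC y
        _ = _ := mul_comm _ _)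
    (by simp) (by simpa [mem_closedBall_iff_norm] using hh)
  simpa using key

variable {V : Type*} [NormedAddCommGroup V] [InnerProductSpace ℝ V] [FiniteDimensional ℝ V]
  [MeasurableSpace V] [BorelSpace V]

lemma SchwartzMap.exists_eq_integral_cexp (f : 𝓢(V, ℂ)) :
    ∃ g : 𝓢(V, ℂ), ∀ z, g z = ∫ w, Complex.exp ((⟪z, w⟫ : ℝ) * I) * f w := by
  have hc : (-(2 * π)⁻¹ : ℝ) ≠ 0 := by
    have := Real.pi_pos
    simp only [ne_eq, neg_eq_zero, inv_eq_zero]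
    positivity
  refine ⟨SchwartzMap.compCLMOfContinuousLinearEquiv ℂ
    (ContinuousLinearEquiv.smulLeft (Units.mk0 _ hc)) (𝓕 f), fun z => ?_⟩
  rw [SchwartzMap.compCLMOfContinuousLinearEquiv_apply, Function.comp_apply,
    SchwartzMap.fourier_coe, Real.fourier_eq']
  refine integral_congr_ae (ae_of_all _ fun w => ?_)
  have e : (-2 * π * ⟪w, (ContinuousLinearEquiv.smulLeft (Units.mk0 _ hc) : V ≃L[ℝ] V) z⟫) =
      ⟪z, w⟫ := by
    change -2 * π * ⟪w, (-(2 * π)⁻¹ : ℝ) • z⟫ = _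
    rw [inner_smul_right, real_inner_comm]
    have := Real.pi_pos
    field_simp
  simp only [smul_eq_mul]
  rw [e]

end SchwartzKernel

section TemperedKernel

open scoped SchwartzMap

variable {E : Type} [NormedAddCommGroup E] [InnerProductSpace ℝ E] [FiniteDimensional ℝ E]
  [MeasurableSpace E] [BorelSpace E]

/-- The inverse Fourier transform of `exp (-kinSymbol β)`, up to a constant factor. -/
noncomputable def temperedKernel (β : ℝ) (z : WithLp 2 (E × E)) : ℝ :=
  ∫ w, Real.cos ⟪z, w⟫ * Real.exp (-kinSymbol β w)

lemma exists_schwartzMap_exp_neg_kinSymbol {β : ℝ} (hβ : 0 < β) :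
    ∃ f : 𝓢(WithLp 2 (E × E), ℂ), ∀ w, f w = (Real.exp (-kinSymbol β w) : ℝ) :=
  exists_schwartzMap_exp_neg (hasTemperateGrowth_kinSymbol β) (by positivity) (by positivity)
    (le_kinSymbol hβ.le)

lemma integrable_exp_neg_kinSymbol {β : ℝ} (hβ : 0 < β) :
    Integrable fun w : WithLp 2 (E × E) => Real.exp (-kinSymbol β w) := by
  obtain ⟨f, hf⟩ := exists_schwartzMap_exp_neg_kinSymbol (E := E) hβ
  refine f.integrable.re.congr (ae_of_all _ fun w => ?_)
  simp only [hf]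
  exact Complex.ofReal_re _

lemma continuous_kinSymbol (β : ℝ) : Continuous (kinSymbol β : WithLp 2 (E × E) → ℝ) :=
  (hasTemperateGrowth_kinSymbol β).1.continuous

lemma exists_schwartzMap_temperedKernel {β : ℝ} (hβ : 0 < β) :
    ∃ g : 𝓢(WithLp 2 (E × E), ℂ), ∀ z, (g z).re = temperedKernel β z := by
  obtain ⟨f, hf⟩ := exists_schwartzMap_exp_neg_kinSymbol (E := E) hβ
  obtain ⟨g, hg⟩ := f.exists_eq_integral_cexp
  refine ⟨g, fun z => ?_⟩
  have hi : Integrable fun w => Complex.exp ((⟪z, w⟫ : ℝ) * I) * f w :=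
    f.integrable.bdd_mul (c := 1) (by fun_prop)
      (ae_of_all _ fun w => (Complex.norm_exp_ofReal_mul_I _).le)
  rw [hg, temperedKernel, ← RCLike.re_eq_complex_re, ← integral_re hi]
  refine integral_congr_ae (ae_of_all _ fun w => ?_)
  simp only [hf, RCLike.re_eq_complex_re]
  rw [Complex.re_mul_ofReal, Complex.exp_ofReal_mul_I_re]

lemma continuous_temperedKernel {β : ℝ} (hβ : 0 < β) :
    Continuous (temperedKernel β : WithLp 2 (E × E) → ℝ) := by
  obtain ⟨g, hg⟩ := exists_schwartzMap_temperedKernel (E := E) hβ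
  rw [← funext hg]
  exact Complex.continuous_re.comp g.continuous

lemma exists_temperedKernel_sub_le {β : ℝ} (hβ : 0 < β) (m : ℕ) :
    ∃ C, 0 ≤ C ∧ ∀ z h : WithLp 2 (E × E), ‖h‖ ≤ 1 →
      |temperedKernel β (z + h) - temperedKernel β z| ≤ C * (1 + ‖z‖)⁻¹ ^ m * ‖h‖ := by
  obtain ⟨g, hg⟩ := exists_schwartzMap_temperedKernel (E := E) hβ
  obtain ⟨C, hC, h⟩ := g.exists_norm_sub_le m
  refine ⟨C, hC, fun z k hk => ?_⟩
  rw [← hg, ← hg, ← Complex.sub_re]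
  exact (Complex.abs_re_le_norm _).trans (h z k hk)

lemma exists_le_temperedKernel {β : ℝ} (hβ : 0 < β) :
    ∃ r > 0, ∃ q₀ > 0, ∀ z : WithLp 2 (E × E), ‖z‖ < r → q₀ ≤ temperedKernel β z := by
  have h0 : 0 < temperedKernel β (0 : WithLp 2 (E × E)) := by
    have := integral_exp_pos (μ := volume) (integrable_exp_neg_kinSymbol (E := E) hβ)
    simpa [temperedKernel] using this
  obtain ⟨r, hr, h⟩ := Metric.eventually_nhds_iff_ball.1
    ((continuous_temperedKernel hβ).continuousAt.eventually (lt_mem_nhds (half_lt_self h0)))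
  exact ⟨r, hr, _, half_pos h0, fun z hz => (h z (by simpa using hz)).le⟩

end TemperedKernel

section Positivity

lemma integral_cos_mul_charFun_nonneg {V : Type*} [NormedAddCommGroup V] [InnerProductSpace ℝ V]
    [FiniteDimensional ℝ V] [MeasurableSpace V] [BorelSpace V] {μ : Measure V} [IsFiniteMeasure μ]
    {χ : V → ℝ} (hχ : ∀ w, charFun μ w = (χ w : ℂ)) {δ : ℝ} (hδ : 0 < δ) (z : V) :
    0 ≤ ∫ w, Real.cos ⟪z, w⟫ * χ w * Real.exp (-δ * ‖w‖ ^ 2) := by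
  have hg := integrable_exp_neg_mul_sq_norm (E := V) hδ
  have hgc : Integrable fun w : V => ((Real.exp (-δ * ‖w‖ ^ 2) : ℝ) : ℂ) := hg.ofReal
  have hF : Integrable (Function.uncurry fun (w y : V) =>
      Complex.exp ((⟪z + y, w⟫ : ℝ) * I) * (Real.exp (-δ * ‖w‖ ^ 2) : ℝ)) (volume.prod μ) := by
    refine Integrable.bdd_mul (c := 1) (hgc.comp_fst μ) (by fun_prop)
      (ae_of_all _ fun p => (Complex.norm_exp_ofReal_mul_I _).le)
  have e1 : ∀ w, ∫ y, Complex.exp ((⟪z + y, w⟫ : ℝ) * I) * (Real.exp (-δ * ‖w‖ ^ 2) : ℝ) ∂μ =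
      Complex.exp ((⟪z, w⟫ : ℝ) * I) * ((χ w * Real.exp (-δ * ‖w‖ ^ 2) : ℝ) : ℂ) := fun w => by
    rw [integral_mul_const, Complex.ofReal_mul, ← hχ, charFun_apply, ← mul_assoc,
      ← integral_const_mul]
    congr 2
    ext y
    rw [← Complex.exp_add, inner_add_left]
    push_cast
    ring_nf
  have e2 : ∀ y, ∫ w, Complex.exp ((⟪z + y, w⟫ : ℝ) * I) * (Real.exp (-δ * ‖w‖ ^ 2) : ℝ) =
      (((∫ v : V, Real.exp (-δ * ‖v‖ ^ 2)) * Real.exp (-‖z + y‖ ^ 2 / (4 * δ)) : ℝ) : ℂ) :=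
    fun y => by
      rw [Complex.ofReal_mul, ← integral_cexp_neg_mul_sq_norm_add_inner hδ]
      congr 1
      ext w
      rw [Complex.ofReal_exp, ← Complex.exp_add]
      push_cast
      ring_nf
  have key := integral_integral_swap hF
  simp_rw [e1, e2, integral_complex_ofReal] at key
  have hi : Integrable fun w : V => Complex.exp ((⟪z, w⟫ : ℝ) * I) *
      ((χ w * Real.exp (-δ * ‖w‖ ^ 2) : ℝ) : ℂ) := by
    have := hF.integral_prod_left
    simpa only [Function.uncurry_apply_pair, e1] using this
  have e3 : ∫ w, Real.cos ⟪z, w⟫ * χ w * Real.exp (-δ * ‖w‖ ^ 2) =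
      (∫ w, Complex.exp ((⟪z, w⟫ : ℝ) * I) * ((χ w * Real.exp (-δ * ‖w‖ ^ 2) : ℝ) : ℂ)).re := by
    rw [← RCLike.re_eq_complex_re, ← integral_re hi]
    refine integral_congr_ae (ae_of_all _ fun w => ?_)
    simp only [RCLike.re_eq_complex_re]
    rw [Complex.re_mul_ofReal, Complex.exp_ofReal_mul_I_re, mul_assoc]
  rw [e3, key, Complex.ofReal_re]
  exact integral_nonneg fun y => mul_nonneg (integral_nonneg fun v => (Real.exp_pos _).le)
    (Real.exp_pos _).le

variable {E : Type} [NormedAddCommGroup E] [InnerProductSpace ℝ E] [FiniteDimensional ℝ E]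
  [MeasurableSpace E] [BorelSpace E]

/-- The kinetic symbol of the compound Poisson approximation. -/
noncomputable def kinTemperedSymbol (β : ℝ) (n : ℕ) (w : WithLp 2 (E × E)) : ℝ :=
  ∫ s in Set.Ioc (0 : ℝ) 1, temperedSymbol β n (‖s • w.fst + w.snd‖ ^ 2)

variable {β : ℝ}

lemma measurable_temperedSymbol_sq_norm (h0 : 0 < β) (h1 : β < 1) (n : ℕ) :
    Measurable fun η : E => temperedSymbol β n (‖η‖ ^ 2) := by
  have := isFiniteMeasure_temperedMeasure (E := E) h0 n
  have e : (fun η : E => temperedSymbol β n (‖η‖ ^ 2)) = fun η =>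
      (∫ r in Set.Ioi (1 / ((n : ℝ) + 1)), temperedDensity β r) -
        (charFun (temperedMeasure E β n) η).re := by
    ext η
    rw [charFun_temperedMeasure h0 h1, Complex.ofReal_re]
    ring
  rw [e]
  exact measurable_const.sub (Complex.measurable_re.comp measurable_charFun)

lemma integrableOn_one_add_sq_rpow_sub_one (β : ℝ) (w : WithLp 2 (E × E)) :
    IntegrableOn (fun s : ℝ => (1 + ‖s • w.fst + w.snd‖ ^ 2) ^ β - 1) (Set.Ioc 0 1) :=
  (((continuous_kinSymbol_integrand β w).sub continuous_const).integrableOn_Icc).mono_set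
    Set.Ioc_subset_Icc_self

lemma norm_temperedSymbol_le (h0 : 0 < β) (h1 : β < 1) (n : ℕ) (η : E) :
    ‖temperedSymbol β n (‖η‖ ^ 2)‖ ≤ (1 + ‖η‖ ^ 2) ^ β - 1 := by
  rw [Real.norm_of_nonneg (temperedSymbol_nonneg h0 h1 n (by positivity))]
  exact temperedSymbol_le h0 h1 n (by positivity)

lemma integrableOn_temperedSymbol (h0 : 0 < β) (h1 : β < 1) (n : ℕ) (w : WithLp 2 (E × E)) :
    IntegrableOn (fun s : ℝ => temperedSymbol β n (‖s • w.fst + w.snd‖ ^ 2)) (Set.Ioc 0 1) :=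
  (integrableOn_one_add_sq_rpow_sub_one β w).mono'
    ((measurable_temperedSymbol_sq_norm h0 h1 n).comp (by fun_prop)).aestronglyMeasurable
    (ae_of_all _ fun s => norm_temperedSymbol_le h0 h1 n _)

lemma tendsto_kinTemperedSymbol (h0 : 0 < β) (h1 : β < 1) (w : WithLp 2 (E × E)) :
    Tendsto (fun n => kinTemperedSymbol β n w) atTop (𝓝 (kinSymbol β w - 1)) := by
  have e : kinSymbol β w - 1 =
      ∫ s in Set.Ioc (0 : ℝ) 1, ((1 + ‖s • w.fst + w.snd‖ ^ 2) ^ β - 1) := by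
    rw [integral_sub ((continuous_kinSymbol_integrand β w).integrableOn_Icc.mono_set
      Set.Ioc_subset_Icc_self) (integrable_const _)]
    simp [kinSymbol]
  rw [e]
  exact tendsto_integral_of_dominated_convergence _
    (fun n => (integrableOn_temperedSymbol h0 h1 n w).1)
    (integrableOn_one_add_sq_rpow_sub_one β w)
    (fun n => ae_of_all _ fun s => norm_temperedSymbol_le h0 h1 n _)
    (ae_of_all _ fun s => tendsto_temperedSymbol h0 h1 (by positivity))

lemma charFun_convExp_rayMeasure_temperedMeasure (h0 : 0 < β) (h1 : β < 1) (n : ℕ)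
    (w : WithLp 2 (E × E)) :
    charFun (convExp (rayMeasure (Set.Ioc 0 1) (temperedMeasure E β n))) w =
      (Real.exp (∫ r in Set.Ioi (1 / ((n : ℝ) + 1)), temperedDensity β r) *
        Real.exp (-kinTemperedSymbol β n w) : ℝ) := by
  have := isFiniteMeasure_temperedMeasure (E := E) h0 n
  rw [charFun_convExp, charFun_rayMeasure, ← Real.exp_add, Complex.ofReal_exp]
  simp_rw [charFun_temperedMeasure h0 h1, integral_complex_ofReal]
  rw [integral_sub (integrable_const _) (integrableOn_temperedSymbol h0 h1 n w)]
  simp [kinTemperedSymbol, sub_eq_add_neg]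

lemma temperedKernel_nonneg (h0 : 0 < β) (h1 : β < 1) (z : WithLp 2 (E × E)) :
    0 ≤ temperedKernel β z := by
  have hn : ∀ n : ℕ, ∀ δ : ℝ, 0 < δ →
      0 ≤ ∫ w, Real.cos ⟪z, w⟫ * Real.exp (-kinTemperedSymbol β n w) *
        Real.exp (-δ * ‖w‖ ^ 2) := fun n δ hδ => by
    have := isFiniteMeasure_temperedMeasure (E := E) h0 n
    have h := integral_cos_mul_charFun_nonneg
      (charFun_convExp_rayMeasure_temperedMeasure h0 h1 n) hδ z
    simp_rw [mul_left_comm (Real.cos _), mul_assoc (Real.exp (∫ r in _, _)),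
      integral_const_mul] at h
    exact nonneg_of_mul_nonneg_right h (Real.exp_pos _)
  have hm : ∀ n, Measurable (kinTemperedSymbol β n : WithLp 2 (E × E) → ℝ) := fun n => by
    have := measurable_temperedSymbol_sq_norm (E := E) h0 h1 n
    refine (StronglyMeasurable.integral_prod_right (f := fun (w : WithLp 2 (E × E)) (s : ℝ) =>
      temperedSymbol β n (‖s • w.fst + w.snd‖ ^ 2)) ?_).measurable
    exact (this.comp (by fun_prop : Measurable fun p : WithLp 2 (E × E) × ℝ =>
      p.2 • p.1.fst + p.1.snd)).stronglyMeasurable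
  have hδ : ∀ δ : ℝ, 0 < δ → 0 ≤ ∫ w, Real.cos ⟪z, w⟫ * Real.exp (-(kinSymbol β w - 1)) *
      Real.exp (-δ * ‖w‖ ^ 2) := fun δ hδ => by
    refine ge_of_tendsto' (f := fun n => ∫ w, Real.cos ⟪z, w⟫ *
      Real.exp (-kinTemperedSymbol β n w) * Real.exp (-δ * ‖w‖ ^ 2)) (x := atTop) ?_
      fun n => hn n δ hδ
    refine tendsto_integral_of_dominated_convergence (fun w => Real.exp (-δ * ‖w‖ ^ 2))
      (fun n => ?_) (integrable_exp_neg_mul_sq_norm hδ) (fun n => ae_of_all _ fun w => ?_)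
      (ae_of_all _ fun w => ?_)
    · have := hm n
      exact Measurable.aestronglyMeasurable (by fun_prop)
    · rw [norm_mul, norm_mul, Real.norm_eq_abs, Real.norm_eq_abs, Real.norm_eq_abs, Real.abs_exp,
        Real.abs_exp]
      refine mul_le_of_le_one_left (Real.exp_pos _).le
        (mul_le_one₀ (Real.abs_cos_le_one _) (Real.exp_pos _).le (Real.exp_le_one_iff.2 ?_))
      rw [neg_nonpos]
      exact integral_nonneg fun s => temperedSymbol_nonneg h0 h1 n (by positivity)
    · exact (((tendsto_kinTemperedSymbol h0 h1 w).neg.rexp).const_mul _).mul_const _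
  have hδ' : ∀ δ : ℝ, 0 < δ → 0 ≤ ∫ w, Real.cos ⟪z, w⟫ * Real.exp (-kinSymbol β w) *
      Real.exp (-δ * ‖w‖ ^ 2) := fun δ h => by
    have h := hδ δ h
    simp_rw [neg_sub, sub_eq_add_neg, Real.exp_add, mul_left_comm _ (Real.exp 1),
      mul_assoc (Real.exp 1), integral_const_mul] at h
    exact nonneg_of_mul_nonneg_right h (Real.exp_pos _)
  have hpos : ∀ n : ℕ, (0 : ℝ) < 1 / ((n : ℝ) + 1) := fun n => by positivity
  have hmk : Measurable (kinSymbol β : WithLp 2 (E × E) → ℝ) := (continuous_kinSymbol β).measurable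
  refine ge_of_tendsto' (f := fun n : ℕ => ∫ w, Real.cos ⟪z, w⟫ * Real.exp (-kinSymbol β w) *
      Real.exp (-(1 / ((n : ℝ) + 1)) * ‖w‖ ^ 2)) (x := atTop) ?_ fun n => hδ' _ (hpos n)
  refine tendsto_integral_of_dominated_convergence (fun w => Real.exp (-kinSymbol β w))
    (fun n => Measurable.aestronglyMeasurable (by fun_prop)) (integrable_exp_neg_kinSymbol h0)
    (fun n => ae_of_all _ fun w => ?_) (ae_of_all _ fun w => ?_)
  · rw [norm_mul, norm_mul, Real.norm_eq_abs, Real.norm_eq_abs, Real.norm_eq_abs, Real.abs_exp,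
      Real.abs_exp]
    refine (mul_le_of_le_one_right (by positivity) (Real.exp_le_one_iff.2 ?_)).trans
      (mul_le_of_le_one_left (Real.exp_pos _).le (Real.abs_cos_le_one _))
    have := hpos n
    rw [neg_mul, neg_nonpos]
    positivity
  · have h := ((tendsto_one_div_add_atTop_nhds_zero_nat (𝕜 := ℝ)).neg.mul_const (‖w‖ ^ 2)).rexp
    simpa using h.const_mul (Real.cos ⟪z, w⟫ * Real.exp (-kinSymbol β w))

end Positivity

section Comparison

lemma integral_cos_mul_charFun {V : Type*} [NormedAddCommGroup V] [InnerProductSpace ℝ V]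
    [FiniteDimensional ℝ V] [MeasurableSpace V] [BorelSpace V] {μ : Measure V} [IsFiniteMeasure μ]
    {χ : V → ℝ} (hχ : ∀ w, charFun μ w = (χ w : ℂ)) {g : V → ℝ} (hg : Integrable g) (z : V) :
    ∫ w, Real.cos ⟪z, w⟫ * (g w * χ w) = ∫ y, (∫ w, Real.cos ⟪z - y, w⟫ * g w) ∂μ := by
  have hF : Integrable (Function.uncurry fun (w y : V) => Real.cos ⟪z - y, w⟫ * g w)
      (volume.prod μ) := by
    refine Integrable.bdd_mul (c := 1) (hg.comp_fst μ) (by fun_prop)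
      (ae_of_all _ fun p => ?_)
    exact Real.abs_cos_le_one _
  rw [← integral_integral_swap hF]
  refine integral_congr_ae (ae_of_all _ fun w => ?_)
  have hi : Integrable (fun y => Complex.exp ((⟪y - z, w⟫ : ℝ) * I)) μ :=
    integrable_cexp_ofReal_mul_I (by fun_prop)
  have e : ∫ y, Complex.exp ((⟪y - z, w⟫ : ℝ) * I) ∂μ =
      Complex.exp ((-⟪z, w⟫ : ℝ) * I) * (χ w : ℂ) := by
    rw [← hχ, charFun_apply, ← integral_const_mul]
    congr 1
    ext y
    rw [← Complex.exp_add, inner_sub_left]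
    push_cast
    ring_nf
  have e' := congrArg Complex.re e
  rw [← RCLike.re_eq_complex_re, ← integral_re hi] at e'
  simp only [RCLike.re_eq_complex_re] at e'
  rw [Complex.re_mul_ofReal, Complex.exp_ofReal_mul_I_re, Real.cos_neg] at e'
  simp only [Complex.exp_ofReal_mul_I_re] at e'
  simp only
  rw [integral_mul_const, mul_left_comm, mul_comm (g w), ← e']
  congr 2
  ext y
  rw [← Real.cos_neg, ← inner_neg_left, neg_sub]

variable {E : Type} [NormedAddCommGroup E] [InnerProductSpace ℝ E] [FiniteDimensional ℝ E]
  [MeasurableSpace E] [BorelSpace E] {β : ℝ}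

/-- The unit-time kinetic kernel, up to a constant factor. -/
noncomputable def stableKernel (β : ℝ) (z : WithLp 2 (E × E)) : ℝ :=
  ∫ w : WithLp 2 (E × E), Real.cos ⟪z, w⟫ *
    Real.exp (-∫ s in Set.Ioc (0 : ℝ) 1, (‖s • w.fst + w.snd‖ ^ 2) ^ β)

lemma abs_temperedKernel_le (h0 : 0 < β) (z : WithLp 2 (E × E)) :
    |temperedKernel β z| ≤ ∫ w : WithLp 2 (E × E), Real.exp (-kinSymbol β w) := by
  rw [← Real.norm_eq_abs, temperedKernel]
  refine norm_integral_le_of_norm_le (integrable_exp_neg_kinSymbol h0) (ae_of_all _ fun w => ?_)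
  rw [norm_mul, Real.norm_eq_abs, Real.norm_eq_abs, Real.abs_exp]
  exact mul_le_of_le_one_left (Real.exp_pos _).le (Real.abs_cos_le_one _)

lemma integrable_temperedKernel_sub (h0 : 0 < β) (μ : Measure (WithLp 2 (E × E)))
    [IsFiniteMeasure μ] (z : WithLp 2 (E × E)) :
    Integrable (fun y => temperedKernel β (z - y)) μ := by
  have := continuous_temperedKernel (E := E) h0
  exact .of_bound (by fun_prop) (∫ w, Real.exp (-kinSymbol (E := E) β w))
    (ae_of_all _ fun y => abs_temperedKernel_le h0 _)

lemma stableKernel_eq (h0 : 0 < β) {μ : Measure (WithLp 2 (E × E))} [IsFiniteMeasure μ]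
    (hμ : ∀ w, charFun μ w = (Real.exp (∫ s in Set.Ioc (0 : ℝ) 1,
      ((1 + ‖s • w.fst + w.snd‖ ^ 2) ^ β - (‖s • w.fst + w.snd‖ ^ 2) ^ β)) : ℝ))
    (z : WithLp 2 (E × E)) :
    stableKernel β z = ∫ y, temperedKernel β (z - y) ∂μ := by
  unfold temperedKernel
  rw [← integral_cos_mul_charFun hμ (integrable_exp_neg_kinSymbol h0) z, stableKernel]
  congr 1
  ext w
  have hc : Continuous fun s : ℝ => (‖s • w.fst + w.snd‖ ^ 2) ^ β :=
    (by fun_prop : Continuous fun s : ℝ => ‖s • w.fst + w.snd‖ ^ 2).rpow_const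
      fun _ => .inr h0.le
  rw [← Real.exp_add, integral_sub
    ((continuous_kinSymbol_integrand β w).integrableOn_Icc.mono_set Set.Ioc_subset_Icc_self)
    (hc.integrableOn_Icc.mono_set Set.Ioc_subset_Icc_self), kinSymbol]
  ring_nf

lemma exists_stableKernel_sub_le (h0 : 0 < β) (h1 : β < 1) :
    ∃ C, 0 ≤ C ∧ ∀ z : WithLp 2 (E × E), 0 ≤ stableKernel β z ∧ ∀ h, ‖h‖ ≤ 1 →
      |stableKernel β (z + h) - stableKernel β z| ≤ C * stableKernel β z * ‖h‖ := by
  obtain ⟨c, hc, hc', σ₁, σ₂, σ₃, _, _, _, hσ₁, hσ₂, hχ⟩ := exists_charFun_conv_eq (E := E) h0 h1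
  set P := convExp σ₁ ∗ (convExp σ₂ ∗ convExp σ₃)
  have hp : ∀ z, stableKernel β z = ∫ y, temperedKernel β (z - y) ∂P := stableKernel_eq h0 hχ
  set B := Module.finrank ℝ E + 2
  obtain ⟨K, hK, hKq⟩ := exists_temperedKernel_sub_le (E := E) h0 (4 * B)
  obtain ⟨r, hr, q₀, hq₀, hq⟩ := exists_le_temperedKernel (E := E) h0
  have hcont := continuous_temperedKernel (E := E) h0
  set F : WithLp 2 (E × E) → ℝ≥0∞ := fun z => ENNReal.ofReal K * weight z ^ (4 * B)
  have hFm : Measurable F := by fun_prop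
  have hqm : Measurable fun z : WithLp 2 (E × E) => ENNReal.ofReal (temperedKernel β z) := by
    fun_prop
  obtain ⟨C, hC, hb⟩ := exists_convFun_rayMeasure_bound c hc hc' (B := B) (by omega)
    ENNReal.ofReal_ne_top (ENNReal.ofReal_pos.2 hq₀).ne' ENNReal.ofReal_ne_top hr hFm hqm
    (fun z => le_rfl) (fun z hz => ENNReal.ofReal_le_ofReal (hq z hz)) hσ₁ hσ₂
  have hexp := convFun_convExp_convExp_le σ₁ σ₂ hFm hqm C (fun z => (hb z).1)
    (fun z => (hb z).2.1) (fun z => (hb z).2.2.1) (fun z => (hb z).2.2.2)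
  have hPi : ∀ f : WithLp 2 (E × E) → ℝ≥0∞, Measurable f → convFun P f =
      convFun (convExp σ₃) (convFun (convExp σ₁) (convFun (convExp σ₂) f)) := fun f hf => by
    rw [convFun_conv _ _ hf, convFun_conv _ _ hf, convFun_comm (convExp σ₂) _ hf,
      convFun_comm (convExp σ₁) _ (measurable_convFun _ hf)]
  have hpq : ∀ z, convFun P (fun z => ENNReal.ofReal (temperedKernel β z)) z =
      ENNReal.ofReal (stableKernel β z) := fun z => by
    rw [hp, ofReal_integral_eq_lintegral_ofReal (integrable_temperedKernel_sub h0 _ _)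
      (ae_of_all _ fun y => temperedKernel_nonneg h0 h1 _), convFun]
  have hpF : ∀ z, convFun P F z ≤ 4 * C * ENNReal.ofReal (stableKernel β z) := fun z => by
    rw [← hpq, hPi _ hFm, hPi _ hqm, ← convFun_const_mul _ _
      (measurable_convFun _ (measurable_convFun _ hqm))]
    exact convFun_mono _ hexp z
  have hpos : ∀ z, 0 ≤ stableKernel β z := fun z => by
    rw [hp]
    exact integral_nonneg fun y => temperedKernel_nonneg h0 h1 _
  refine ⟨(4 * C).toReal, ENNReal.toReal_nonneg, fun z => ⟨hpos z, fun h hh => ?_⟩⟩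
  have hG : Integrable (fun y => K * (1 + ‖z - y‖)⁻¹ ^ (4 * B)) P := by
    refine .of_bound (by fun_prop) K (ae_of_all _ fun y => ?_)
    rw [Real.norm_of_nonneg (by positivity)]
    exact mul_le_of_le_one_right hK (pow_le_one₀ (by positivity)
      (inv_le_one_of_one_le₀ (by simp)))
  have hGF : ENNReal.ofReal (∫ y, K * (1 + ‖z - y‖)⁻¹ ^ (4 * B) ∂P) = convFun P F z := by
    rw [ofReal_integral_eq_lintegral_ofReal hG (ae_of_all _ fun y => by positivity), convFun]
    refine lintegral_congr fun y => ?_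
    simp only [F]
    rw [ENNReal.ofReal_mul hK, ENNReal.ofReal_pow (by positivity), weight_eq_ofReal]
  have hle : ∫ y, K * (1 + ‖z - y‖)⁻¹ ^ (4 * B) ∂P ≤ (4 * C).toReal * stableKernel β z := by
    rw [← ENNReal.ofReal_le_ofReal_iff (mul_nonneg ENNReal.toReal_nonneg (hpos z)), hGF,
      ENNReal.ofReal_mul ENNReal.toReal_nonneg,
      ENNReal.ofReal_toReal (ENNReal.mul_ne_top (by simp) hC)]
    exact hpF z
  refine le_trans ?_ (mul_le_mul_of_nonneg_right hle (norm_nonneg h))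
  rw [hp, hp, ← integral_sub (integrable_temperedKernel_sub h0 _ _)
    (integrable_temperedKernel_sub h0 _ _), ← integral_mul_const,
    ← Real.norm_eq_abs]
  refine norm_integral_le_of_norm_le (hG.mul_const _) (ae_of_all _ fun y => ?_)
  have := hKq (z - y) h hh
  rwa [show z - y + h = z + h - y by abel] at this

end Comparison

section Scaling

lemma exists_integral_eq_mul_integral_comp {V W : Type*} [NormedAddCommGroup V] [NormedSpace ℝ V]
    [NormedAddCommGroup W] [NormedSpace ℝ W] [FiniteDimensional ℝ W] [MeasureSpace V]
    [BorelSpace V] [MeasureSpace W] [BorelSpace W] [(volume : Measure V).IsAddHaarMeasure]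
    [(volume : Measure W).IsAddHaarMeasure] (T : V ≃L[ℝ] W) :
    ∃ c : ℝ≥0, ∀ f : W → ℝ, ∫ w, f w = c * ∫ v, f (T v) := by
  obtain ⟨c, hc⟩ : ∃ c : ℝ≥0, (volume : Measure W) = c • (volume : Measure V).map T :=
    ⟨_, Measure.isAddLeftInvariant_eq_smul _ _⟩
  refine ⟨c, fun f => ?_⟩
  rw [hc, integral_smul_nnreal_measure, ← T.coe_toHomeomorph,
    T.toHomeomorph.measurableEmbedding.integral_map]
  rfl

lemma exists_integral_prod_eq {E : Type*} [NormedAddCommGroup E] [InnerProductSpace ℝ E]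
    [FiniteDimensional ℝ E] [MeasurableSpace E] [BorelSpace E] {a b : ℝ} (ha : 0 < a)
    (hb : 0 < b) :
    ∃ c : ℝ≥0, ∀ f : E × E → ℝ, ∫ w, f w =
      c * ∫ w : WithLp 2 (E × E), f (a • w.fst, b • w.snd) := by
  have : (volume : Measure (E × E)).IsAddHaarMeasure := by
    rw [Measure.volume_eq_prod]
    infer_instance
  exact exists_integral_eq_mul_integral_comp ((WithLp.prodContinuousLinearEquiv 2 ℝ E E).trans
    ((ContinuousLinearEquiv.smulLeft (Units.mk0 a ha.ne')).prodCongr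
      (ContinuousLinearEquiv.smulLeft (Units.mk0 b hb.ne'))))

lemma exists_kinHeat_eq {d : ℕ} {α t : ℝ} (hα : 0 < α) (ht : 0 < t) :
    ∃ c, 0 ≤ c ∧ ∀ x v, kinHeat d α t x v =
      c * stableKernel (α / 2) (WithLp.toLp 2 (t ^ (-α⁻¹ - 1) • x, t ^ (-α⁻¹) • v)) := by
  set a := t ^ (-α⁻¹ - 1)
  set b := t ^ (-α⁻¹)
  have ha : 0 < a := by positivity
  have hb : 0 < b := by positivity
  have hta : t * a = b := by
    simp only [a, b]
    rw [Real.rpow_sub_one ht.ne']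
    field_simp
  have htb : t * b ^ α = 1 := by
    simp only [b]
    rw [← Real.rpow_mul ht.le, neg_mul, inv_mul_cancel₀ hα.ne', Real.rpow_neg_one,
      mul_inv_cancel₀ ht.ne']
  obtain ⟨c, hc⟩ := exists_integral_prod_eq (E := EuclideanSpace ℝ (Fin d)) ha hb
  refine ⟨(2 * π) ^ (-(2 * (d : ℝ))) * c, by positivity, fun x v => ?_⟩
  rw [kinHeat, mul_assoc]
  congr 1
  rw [stableKernel]
  refine (hc _).trans ?_
  congr 2
  ext w
  congr 2
  · simp [inner_smul_left, inner_smul_right, WithLp.prod_inner_apply]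
  · rw [← intervalIntegral.integral_of_le zero_le_one, neg_inj]
    have h := intervalIntegral.smul_integral_comp_mul_left (a := 0) (b := 1)
      (fun s : ℝ => ‖s • a • w.fst + b • w.snd‖ ^ α) t
    rw [mul_zero, mul_one] at h
    rw [← h, smul_eq_mul, ← intervalIntegral.integral_const_mul]
    congr 1
    ext s
    have : (t * s) • a • w.fst + b • w.snd = b • (s • w.fst + w.snd) := by
      rw [smul_add, smul_smul, smul_smul, ← hta]
      ring_nf
    rw [this, norm_smul, Real.norm_of_nonneg hb.le, Real.mul_rpow hb.le (norm_nonneg _),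
      ← mul_assoc, htb, one_mul, ← Real.rpow_natCast_mul (norm_nonneg _)]
    ring_nf

lemma norm_fderiv_le_of_norm_sub_le {X : Type*} [NormedAddCommGroup X] [NormedSpace ℝ X]
    {f : X → ℝ} {x : X} {K a : ℝ} (ha : 0 ≤ a) (hK : 0 ≤ K)
    (h : ∀ k, a * ‖k‖ ≤ 1 → |f (x + k) - f x| ≤ K * (a * ‖k‖)) :
    ‖fderiv ℝ f x‖ ≤ K * a := by
  refine norm_fderiv_le_of_lip' ℝ (by positivity) ?_
  have hc : ContinuousAt (fun y => a * ‖y - x‖) x := by fun_prop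
  filter_upwards [hc.eventually (ge_mem_nhds (by simp : a * ‖x - x‖ < 1))] with y hy
  have := h (y - x) hy
  rwa [add_sub_cancel, ← mul_assoc] at this

end Scaling

/-- logarithmic gradient estimates for the kinetic heat kernel. -/
theorem stmt_4 (d : ℕ) (hd : 1 ≤ d) (α : ℝ) (hα : α ∈ Set.Ioo (0 : ℝ) 2) :
    ∃ C > (0 : ℝ), ∀ t > (0 : ℝ), ∀ x v : EuclideanSpace ℝ (Fin d),
      ‖fderiv ℝ (fun x' => kinHeat d α t x' v) x‖ ≤
          C * t ^ (-α⁻¹ - 1) * kinHeat d α t x v ∧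
      ‖fderiv ℝ (fun v' => kinHeat d α t x v') v‖ ≤
          C * t ^ (-α⁻¹) * kinHeat d α t x v := by
  obtain ⟨h0, h2⟩ := hα
  obtain ⟨C, hC, hp⟩ := exists_stableKernel_sub_le (E := EuclideanSpace ℝ (Fin d)) (half_pos h0)
    (by linarith)
  refine ⟨C + 1, by positivity, fun t ht x v => ?_⟩
  obtain ⟨c, hc, hk⟩ := exists_kinHeat_eq (d := d) h0 ht
  simp_rw [hk]
  set a := t ^ (-α⁻¹ - 1)
  set b := t ^ (-α⁻¹)
  have ha : 0 ≤ a := by positivity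
  have hb : 0 ≤ b := by positivity
  obtain ⟨hz, hs⟩ := hp (WithLp.toLp 2 (a • x, b • v))
  set p := stableKernel (α / 2) (WithLp.toLp 2 (a • x, b • v))
  have key : ∀ {A A' h : ℝ}, |A - A'| ≤ C * p * h → 0 ≤ h →
      |c * A - c * A'| ≤ (C + 1) * (c * p) * h := fun {A A' h} hA hh => by
    rw [← mul_sub, abs_mul, abs_of_nonneg hc]
    have : 0 ≤ c * p * h := by positivity
    nlinarith [mul_le_mul_of_nonneg_left hA hc]
  have hK : 0 ≤ (C + 1) * (c * p) := by positivity
  constructor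
  · rw [mul_right_comm]
    refine norm_fderiv_le_of_norm_sub_le ha hK fun k hk => key ?_ (by positivity)
    have hn : ‖WithLp.toLp 2 (a • k, (0 : EuclideanSpace ℝ (Fin d)))‖ = a * ‖k‖ := by
      rw [WithLp.norm_toLp_fst, norm_smul, Real.norm_of_nonneg ha]
    have := hs _ (hn.trans_le hk)
    rwa [hn, ← WithLp.toLp_add, Prod.mk_add_mk, add_zero, ← smul_add] at this
  · rw [mul_right_comm]
    refine norm_fderiv_le_of_norm_sub_le hb hK fun k hk => key ?_ (by positivity)
    have hn : ‖WithLp.toLp 2 ((0 : EuclideanSpace ℝ (Fin d)), b • k)‖ = b * ‖k‖ := by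
      rw [WithLp.norm_toLp_snd, norm_smul, Real.norm_of_nonneg hb]
    have := hs _ (hn.trans_le hk)
    rwa [hn, ← WithLp.toLp_add, Prod.mk_add_mk, add_zero, ← smul_add] at this
end

section
/- Let d ≥ 1, β > d and q ≥ 2β − d. Then for every v ∈ ℝ^d, the integral ∫_{ℝ^d} |x|^q 𝒩_β(x,v) dx diverges (equals +∞). -/
open MeasureTheory Real RealInnerProductSpace

/-- The function `𝒩_β`. -/
noncomputable def kinN (d : ℕ) (β : ℝ) (x v : EuclideanSpace ℝ (Fin d)) : ℝ :=
  (1 + Real.sqrt (‖x‖ ^ 2 + ‖v‖ ^ 2)) ^ (-(1 + β)) *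
    (1 + ⨅ s : Set.Icc (0 : ℝ) 1, ‖x - (s : ℝ) • v‖) ^ (1 - β)

theorem not_integrable_indicator_norm_rpow_neg (d : ℕ) (hd : 1 ≤ d) (R : ℝ) (hR : 0 < R) :
    ¬ Integrable (fun x : EuclideanSpace ℝ (Fin d) =>
      (Set.Ioi R).indicator (fun y : ℝ => y ^ (-(d : ℝ))) ‖x‖) := by
  have : Nonempty (Fin d) := ⟨⟨0, hd⟩⟩
  rw [integrable_fun_norm_addHaar volume 
    (f := (Set.Ioi R).indicator (fun y : ℝ => y ^ (-(d : ℝ))))]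
  intro h
  refine not_integrableOn_Ioi_inv (a := R) ?_
  refine (h.mono_set (Set.Ioi_subset_Ioi hR.le)).congr_fun ?_ measurableSet_Ioi
  intro y hy
  have hy0 : 0 < y := hR.trans hy
  simp only [Set.indicator_of_mem hy, finrank_euclideanSpace, Fintype.card_fin, smul_eq_mul]
  rw [← Real.rpow_natCast, ← Real.rpow_add hy0, Nat.cast_sub hd, ← Real.rpow_neg_one]
  congr 1
  push_cast
  ring

theorem le_kinN_of_lt_norm {d : ℕ} {β : ℝ} (hβ : 1 < β) {x v : EuclideanSpace ℝ (Fin d)}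
    (hx : 1 + ‖v‖ < ‖x‖) :
    (2 : ℝ) ^ (-(2 * β)) * ‖x‖ ^ (-(2 * β)) ≤ kinN d β x v := by
  have hv := norm_nonneg v
  have hx0 : 0 < ‖x‖ := by linarith
  have hsqrt : 1 + Real.sqrt (‖x‖ ^ 2 + ‖v‖ ^ 2) ≤ 2 * ‖x‖ := by
    have : Real.sqrt (‖x‖ ^ 2 + ‖v‖ ^ 2) ≤ ‖x‖ + ‖v‖ :=
      Real.sqrt_le_iff.mpr ⟨by positivity, by nlinarith⟩
    linarith
  have hinf : (⨅ s : Set.Icc (0 : ℝ) 1, ‖x - (s : ℝ) • v‖) ≤ ‖x‖ := by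
    have hbdd : BddBelow (Set.range fun s : Set.Icc (0 : ℝ) 1 => ‖x - (s : ℝ) • v‖) :=
      ⟨0, by rintro _ ⟨s, rfl⟩; exact norm_nonneg _⟩
    simpa using ciInf_le hbdd ⟨0, by simp⟩
  have hinf0 : 0 ≤ ⨅ s : Set.Icc (0 : ℝ) 1, ‖x - (s : ℝ) • v‖ :=
    Real.iInf_nonneg fun _ => norm_nonneg _
  calc (2 : ℝ) ^ (-(2 * β)) * ‖x‖ ^ (-(2 * β))
      = (2 * ‖x‖) ^ (-(1 + β)) * (2 * ‖x‖) ^ (1 - β) := by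
        rw [← Real.mul_rpow zero_le_two hx0.le, ← Real.rpow_add (by positivity)]
        congr 1
        ring
    _ ≤ kinN d β x v := by
        unfold kinN
        apply mul_le_mul _ _ (by positivity) (by positivity)
        · exact Real.rpow_le_rpow_of_nonpos (by positivity) hsqrt (by linarith)
        · exact Real.rpow_le_rpow_of_nonpos (by positivity) (by linarith) (by linarith)

/-- divergence of the `q`-th spatial moment of `𝒩_β` when `q ≥ 2β − d`. -/
theorem stmt_5 (d : ℕ) (hd : 1 ≤ d) (β q : ℝ) (hβ : (d : ℝ) < β)
    (hq : 2 * β - d ≤ q) :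
    ∀ v : EuclideanSpace ℝ (Fin d),
      ∫⁻ x : EuclideanSpace ℝ (Fin d), ENNReal.ofReal (‖x‖ ^ q * kinN d β x v) = ⊤ := by
  intro v
  have hd1 : (1 : ℝ) ≤ d := by exact_mod_cast hd
  have hv := norm_nonneg v
  set g : EuclideanSpace ℝ (Fin d) → ℝ := fun x =>
    (Set.Ioi (1 + ‖v‖)).indicator (fun y : ℝ => y ^ (-(d : ℝ))) ‖x‖
  have hgm : Measurable g :=
    ((measurable_id.pow_const _).indicator measurableSet_Ioi).comp measurable_norm
  have hg0 : ∀ x, 0 ≤ g x := fun x =>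
    Set.indicator_nonneg (fun y hy => Real.rpow_nonneg (by linarith [Set.mem_Ioi.mp hy]) _) _
  have hgtop : ∫⁻ x, ENNReal.ofReal (g x) = ⊤ := by
    by_contra h
    exact not_integrable_indicator_norm_rpow_neg d hd (1 + ‖v‖) (by positivity)
      ((lintegral_ofReal_ne_top_iff_integrable hgm.aestronglyMeasurable (.of_forall hg0)).mp h)
  have hle : ∀ x, ENNReal.ofReal ((2 : ℝ) ^ (-(2 * β))) * ENNReal.ofReal (g x) ≤
      ENNReal.ofReal (‖x‖ ^ q * kinN d β x v) := by
    intro x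
    by_cases hx : 1 + ‖v‖ < ‖x‖
    · rw [← ENNReal.ofReal_mul (by positivity)]
      apply ENNReal.ofReal_le_ofReal
      have hx0 : 0 < ‖x‖ := by linarith
      have hgx : g x = ‖x‖ ^ (-(d : ℝ)) := Set.indicator_of_mem (Set.mem_Ioi.mpr hx) _
      calc (2 : ℝ) ^ (-(2 * β)) * g x
          ≤ (2 : ℝ) ^ (-(2 * β)) * ‖x‖ ^ (q + -(2 * β)) := by
            rw [hgx]
            gcongr
            · linarith
            · linarith
        _ = ‖x‖ ^ q * ((2 : ℝ) ^ (-(2 * β)) * ‖x‖ ^ (-(2 * β))) := by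
            rw [Real.rpow_add hx0]
            ring
        _ ≤ ‖x‖ ^ q * kinN d β x v := by
            gcongr
            exact le_kinN_of_lt_norm (by linarith) hx
    · have hgx : g x = 0 := Set.indicator_of_notMem (by simpa using hx) _
      simp [hgx]
  refine top_unique (le_trans (le_of_eq ?_) (lintegral_mono hle))
  rw [lintegral_const_mul _ hgm.ennreal_ofReal, hgtop, ENNReal.mul_top]
  simpa using Real.rpow_pos_of_pos two_pos _
end

section
/- Let d ≥ 1, β > d and 0 ≤ q < 2β − d. Then there exists a constant C = C(q,β,d) ≥ 1 such that for all v ∈ ℝ^d, C^{-1} (1+|v|)^{q−β} ≤ ∫_{ℝ^d} |x|^q 𝒩_β(x,v) dx ≤ C (1+|v|)^{q−β}. -/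
open MeasureTheory Real RealInnerProductSpace

open scoped ENNReal

/-- The distance from `x` to the segment `[0, v]`. -/
noncomputable def segDist {d : ℕ} (x v : EuclideanSpace ℝ (Fin d)) : ℝ :=
  ⨅ s : Set.Icc (0 : ℝ) 1, ‖x - (s : ℝ) • v‖

section segDist

variable {d : ℕ} (x v : EuclideanSpace ℝ (Fin d))

lemma segDist_le {s : ℝ} (hs : s ∈ Set.Icc (0 : ℝ) 1) : segDist x v ≤ ‖x - s • v‖ :=
  ciInf_le (f := fun s : Set.Icc (0 : ℝ) 1 => ‖x - (s : ℝ) • v‖)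
    ⟨0, by rintro _ ⟨s, rfl⟩; exact norm_nonneg _⟩ ⟨s, hs⟩

lemma le_segDist {a : ℝ} (h : ∀ s ∈ Set.Icc (0 : ℝ) 1, a ≤ ‖x - s • v‖) : a ≤ segDist x v :=
  le_ciInf fun s => h s s.2

lemma segDist_nonneg : 0 ≤ segDist x v := le_segDist x v fun _ _ => norm_nonneg _

lemma exists_norm_sub_smul_lt : ∃ s ∈ Set.Icc (0 : ℝ) 1, ‖x - s • v‖ < 1 + segDist x v := by
  obtain ⟨s, hs⟩ := exists_lt_of_ciInf_lt
    (show (⨅ s : Set.Icc (0 : ℝ) 1, ‖x - (s : ℝ) • v‖) < 1 + segDist x v by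
      rw [← segDist]; linarith)
  exact ⟨s, s.2, hs⟩

lemma segDist_le_norm : segDist x v ≤ ‖x‖ := by
  simpa using segDist_le x v (s := 0) (by simp)

lemma norm_sub_norm_le_segDist : ‖x‖ - ‖v‖ ≤ segDist x v := by
  refine le_segDist x v fun s hs => ?_
  have h1 : ‖s • v‖ ≤ ‖v‖ := by
    rw [norm_smul, Real.norm_of_nonneg hs.1]
    exact mul_le_of_le_one_left (norm_nonneg _) hs.2
  linarith [norm_sub_norm_le x (s • v)]

lemma continuous_segDist : Continuous fun x => segDist x v := by
  refine (LipschitzWith.of_le_add fun x y => ?_ : LipschitzWith 1 _).continuous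
  have : segDist x v - dist x y ≤ segDist y v := by
    refine le_segDist y v fun s hs => ?_
    have h1 := segDist_le x v hs
    have h2 := norm_add_le (x - y) (y - s • v)
    rw [sub_add_sub_cancel] at h2
    rw [dist_eq_norm]; linarith
  linarith

end segDist

section kinN

variable {d : ℕ}

lemma kinN_eq (β : ℝ) (x v : EuclideanSpace ℝ (Fin d)) :
    kinN d β x v = (1 + Real.sqrt (‖x‖ ^ 2 + ‖v‖ ^ 2)) ^ (-(1 + β)) *
      (1 + segDist x v) ^ (1 - β) := rfl

lemma continuous_kinN (β : ℝ) (v : EuclideanSpace ℝ (Fin d)) :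
    Continuous fun x => kinN d β x v := by
  simp only [kinN_eq]
  refine Continuous.mul ?_ ?_
  · refine Continuous.rpow_const (by fun_prop) fun x => Or.inl ?_
    positivity
  · refine Continuous.rpow_const (continuous_const.add (continuous_segDist v)) fun x => Or.inl ?_
    have := segDist_nonneg x v
    positivity

lemma kinN_nonneg (β : ℝ) (x v : EuclideanSpace ℝ (Fin d)) : 0 ≤ kinN d β x v := by
  rw [kinN_eq]
  have := segDist_nonneg x v
  positivity

/-- In the region `‖x‖ ≤ 2 ‖v‖`, the tube profile is bounded by an average of
translated radial profiles along the segment. -/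
lemma ofReal_segDist_rpow_le {β : ℝ} (hβ : 1 < β) {x v : EuclideanSpace ℝ (Fin d)}
    (hx : ‖x‖ ≤ 2 * ‖v‖) :
    ENNReal.ofReal ((1 + segDist x v) ^ (1 - β)) ≤ ENNReal.ofReal (4 * 3 ^ β * (1 + ‖v‖)) *
      ∫⁻ s in Set.Icc (0 : ℝ) 1, ENNReal.ofReal ((1 + ‖x - s • v‖) ^ (-β)) := by
  obtain ⟨s₀, hs₀, hlt⟩ := exists_norm_sub_smul_lt x v
  have hδ0 := segDist_nonneg x v
  have hδx := segDist_le_norm x v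
  have hv := norm_nonneg v
  set D := 1 + segDist x v with hD
  have hD1 : 1 ≤ D := by linarith
  set η := D / (4 * (1 + ‖v‖)) with hη
  have hη0 : 0 < η := by positivity
  have hη1 : η ≤ 1 / 2 := by
    rw [hη, div_le_iff₀ (by positivity)]; linarith
  have hηv : η * ‖v‖ ≤ D := by
    have : η * (4 * (1 + ‖v‖)) = D := by rw [hη]; field_simp
    nlinarith
  have key : ∀ s, |s - s₀| ≤ η → (3 * D) ^ (-β) ≤ (1 + ‖x - s • v‖) ^ (-β) := by
    intro s hs
    refine Real.rpow_le_rpow_of_nonpos (by positivity) ?_ (by linarith)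
    have h1 : x - s • v = (x - s₀ • v) - (s - s₀) • v := by module
    have h2 : ‖(s - s₀) • v‖ ≤ D := by
      rw [norm_smul, Real.norm_eq_abs]
      exact (mul_le_mul_of_nonneg_right hs hv).trans hηv
    have h3 := norm_sub_le (x - s₀ • v) ((s - s₀) • v)
    rw [h1]; linarith
  obtain ⟨a, ha0, ha1, has⟩ : ∃ a, 0 ≤ a ∧ a + η ≤ 1 ∧ ∀ s ∈ Set.Icc a (a + η), |s - s₀| ≤ η := by
    rcases le_total s₀ (1 / 2) with h | h
    · refine ⟨s₀, hs₀.1, by linarith, fun s hs => ?_⟩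
      rw [abs_le]; constructor <;> linarith [hs.1, hs.2]
    · refine ⟨s₀ - η, by linarith, by linarith [hs₀.2], fun s hs => ?_⟩
      rw [abs_le]; constructor <;> linarith [hs.1, hs.2]
  have hint : ENNReal.ofReal ((3 * D) ^ (-β)) * ENNReal.ofReal η ≤
      ∫⁻ s in Set.Icc (0 : ℝ) 1, ENNReal.ofReal ((1 + ‖x - s • v‖) ^ (-β)) := by
    calc _ = ∫⁻ _ in Set.Icc a (a + η), ENNReal.ofReal ((3 * D) ^ (-β)) := by
            rw [setLIntegral_const, Real.volume_Icc, add_sub_cancel_left]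
      _ ≤ ∫⁻ s in Set.Icc a (a + η), ENNReal.ofReal ((1 + ‖x - s • v‖) ^ (-β)) :=
            setLIntegral_mono' measurableSet_Icc fun s hs =>
              ENNReal.ofReal_le_ofReal (key s (has s hs))
      _ ≤ _ := lintegral_mono_set (Set.Icc_subset_Icc ha0 ha1)
  refine le_trans (le_of_eq ?_) (mul_le_mul_right hint _)
  rw [← ENNReal.ofReal_mul (by positivity), ← ENNReal.ofReal_mul (by positivity)]
  congr 1
  rw [Real.mul_rpow (by norm_num) (by positivity), Real.rpow_neg (by norm_num), hη,
    show 1 - β = 1 + -β by ring, Real.rpow_add (by positivity), Real.rpow_one]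
  have : (3 : ℝ) ^ β ≠ 0 := by positivity
  field_simp

lemma le_one_add_sqrt_left (a b : ℝ) : 1 + a ≤ 1 + √(a ^ 2 + b ^ 2) := by
  have := Real.le_sqrt_of_sq_le (show a ^ 2 ≤ a ^ 2 + b ^ 2 by nlinarith [sq_nonneg b])
  linarith

lemma rpow_mul_kinN_le_of_norm_le {β q : ℝ} (hβ : 1 < β) (hq0 : 0 ≤ q)
    {x v : EuclideanSpace ℝ (Fin d)} (hx : ‖x‖ ≤ 2 * ‖v‖) :
    ‖x‖ ^ q * kinN d β x v ≤
      2 ^ q * (1 + ‖v‖) ^ (q - β - 1) * (1 + segDist x v) ^ (1 - β) := by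
  have hδ0 := segDist_nonneg x v
  have h1 : ‖x‖ ^ q ≤ 2 ^ q * (1 + ‖v‖) ^ q := by
    rw [← Real.mul_rpow (by norm_num) (by positivity)]
    exact Real.rpow_le_rpow (norm_nonneg _) (by linarith) hq0
  have h2 : (1 + √(‖x‖ ^ 2 + ‖v‖ ^ 2)) ^ (-(1 + β)) ≤ (1 + ‖v‖) ^ (-(1 + β)) := by
    refine Real.rpow_le_rpow_of_nonpos (by positivity) ?_ (by linarith)
    rw [add_comm (‖x‖ ^ 2)]
    exact le_one_add_sqrt_left _ _
  rw [kinN_eq, ← mul_assoc, show q - β - 1 = q + -(1 + β) by ring,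
    Real.rpow_add (by positivity), ← mul_assoc]
  gcongr

lemma rpow_mul_kinN_le_of_lt_norm {β q : ℝ} (hβ : 1 < β) (hq0 : 0 ≤ q)
    {x v : EuclideanSpace ℝ (Fin d)} (hx : 2 * ‖v‖ < ‖x‖) :
    ‖x‖ ^ q * kinN d β x v ≤ 2 ^ (β - 1) * (1 + ‖v‖) ^ (q - β) *
      ((1 + ‖x‖) ^ (-β) + (1 + ‖x‖) ^ (-(2 * β - q))) := by
  have hδ0 := segDist_nonneg x v
  have hδ := norm_sub_norm_le_segDist x v
  have hv := norm_nonneg v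
  have h1 : ‖x‖ ^ q ≤ (1 + ‖x‖) ^ q :=
    Real.rpow_le_rpow (norm_nonneg _) (by linarith) hq0
  have h2 : (1 + √(‖x‖ ^ 2 + ‖v‖ ^ 2)) ^ (-(1 + β)) ≤ (1 + ‖x‖) ^ (-(1 + β)) :=
    Real.rpow_le_rpow_of_nonpos (by positivity) (le_one_add_sqrt_left _ _) (by linarith)
  have h3 : (1 + segDist x v) ^ (1 - β) ≤ 2 ^ (β - 1) * (1 + ‖x‖) ^ (1 - β) := by
    rw [show β - 1 = -(1 - β) by ring, Real.rpow_neg (by norm_num),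
      ← Real.inv_rpow (by norm_num), ← Real.mul_rpow (by norm_num) (by positivity)]
    exact Real.rpow_le_rpow_of_nonpos (by positivity) (by linarith) (by linarith)
  have h4 : (1 + ‖x‖) ^ (-(2 * β - q)) ≤
      (1 + ‖v‖) ^ (q - β) * ((1 + ‖x‖) ^ (-β) + (1 + ‖x‖) ^ (-(2 * β - q))) := by
    rcases le_total q β with h | h
    · have : (1 + ‖x‖) ^ (q - β) ≤ (1 + ‖v‖) ^ (q - β) :=
        Real.rpow_le_rpow_of_nonpos (by positivity) (by linarith) (by linarith)
      calc (1 + ‖x‖) ^ (-(2 * β - q)) = (1 + ‖x‖) ^ (q - β) * (1 + ‖x‖) ^ (-β) := by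
            rw [← Real.rpow_add (by positivity)]; congr 1; ring
        _ ≤ _ := by
            gcongr
            exact le_add_of_nonneg_right (by positivity)
    · have : 1 ≤ (1 + ‖v‖) ^ (q - β) := Real.one_le_rpow (by linarith) (by linarith)
      calc (1 + ‖x‖) ^ (-(2 * β - q)) = 1 * (1 + ‖x‖) ^ (-(2 * β - q)) := (one_mul _).symm
        _ ≤ _ := by
            gcongr
            exact le_add_of_nonneg_left (by positivity)
  calc ‖x‖ ^ q * kinN d β x v
      ≤ (1 + ‖x‖) ^ q * ((1 + ‖x‖) ^ (-(1 + β)) * (2 ^ (β - 1) * (1 + ‖x‖) ^ (1 - β))) := by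
        rw [kinN_eq]; gcongr
    _ = 2 ^ (β - 1) * (1 + ‖x‖) ^ (-(2 * β - q)) := by
        rw [show -(2 * β - q) = q + -(1 + β) + (1 - β) by ring, Real.rpow_add (by positivity),
          Real.rpow_add (by positivity)]
        ring
    _ ≤ _ := by
        rw [mul_assoc]; gcongr

lemma ofReal_rpow_mul_kinN_le {β q : ℝ} (hβ : 1 < β) (hq0 : 0 ≤ q)
    (x v : EuclideanSpace ℝ (Fin d)) :
    ENNReal.ofReal (‖x‖ ^ q * kinN d β x v) ≤ ENNReal.ofReal ((1 + ‖v‖) ^ (q - β)) *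
      (ENNReal.ofReal (2 ^ q * (4 * 3 ^ β)) *
        (∫⁻ s in Set.Icc (0 : ℝ) 1, ENNReal.ofReal ((1 + ‖x - s • v‖) ^ (-β))) +
      ENNReal.ofReal (2 ^ (β - 1)) * (ENNReal.ofReal ((1 + ‖x‖) ^ (-β)) +
        ENNReal.ofReal ((1 + ‖x‖) ^ (-(2 * β - q))))) := by
  rcases le_or_gt ‖x‖ (2 * ‖v‖) with hx | hx
  · refine (ENNReal.ofReal_le_ofReal (rpow_mul_kinN_le_of_norm_le hβ hq0 hx)).trans ?_
    rw [ENNReal.ofReal_mul (by positivity)]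
    refine (mul_le_mul_right (ofReal_segDist_rpow_le hβ hx) _).trans ?_
    refine le_trans (le_of_eq ?_) (mul_le_mul_right (le_add_of_nonneg_right zero_le) _)
    rw [← mul_assoc, ← mul_assoc, ← ENNReal.ofReal_mul (by positivity),
      ← ENNReal.ofReal_mul (by positivity)]
    congr 2
    rw [Real.rpow_sub_one (by positivity)]
    field_simp
  · refine (ENNReal.ofReal_le_ofReal (rpow_mul_kinN_le_of_lt_norm hβ hq0 hx)).trans ?_
    refine le_trans (le_of_eq ?_) (mul_le_mul_right (le_add_of_nonneg_left zero_le) _)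
    rw [← ENNReal.ofReal_add (by positivity) (by positivity), mul_comm (2 ^ (β - 1)),
      mul_assoc, ENNReal.ofReal_mul (by positivity), ENNReal.ofReal_mul (by positivity)]

lemma lintegral_one_add_norm_rpow_neg_lt_top {r : ℝ} (hr : (d : ℝ) < r) :
    ∫⁻ x : EuclideanSpace ℝ (Fin d), ENNReal.ofReal ((1 + ‖x‖) ^ (-r)) < ∞ :=
  finite_integral_one_add_norm (by simpa using hr)

lemma exists_lintegral_rpow_mul_kinN_le (hd : 1 ≤ d) {β q : ℝ} (hβ : (d : ℝ) < β)
    (hq0 : 0 ≤ q) (hq : q < 2 * β - d) :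
    ∃ K : ℝ, 0 ≤ K ∧ ∀ v : EuclideanSpace ℝ (Fin d),
      ∫⁻ x, ENNReal.ofReal (‖x‖ ^ q * kinN d β x v) ≤
        ENNReal.ofReal (K * (1 + ‖v‖) ^ (q - β)) := by
  have hβ1 : 1 < β := lt_of_le_of_lt (by exact_mod_cast hd) hβ
  set M := ∫⁻ x : EuclideanSpace ℝ (Fin d), ENNReal.ofReal ((1 + ‖x‖) ^ (-β)) with hM
  set M' := ∫⁻ x : EuclideanSpace ℝ (Fin d), ENNReal.ofReal ((1 + ‖x‖) ^ (-(2 * β - q))) with hM'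
  have hMfin : M < ∞ := lintegral_one_add_norm_rpow_neg_lt_top hβ
  have hM'fin : M' < ∞ := lintegral_one_add_norm_rpow_neg_lt_top (by linarith)
  set T := ENNReal.ofReal (2 ^ q * (4 * 3 ^ β)) * M + ENNReal.ofReal (2 ^ (β - 1)) * (M + M')
    with hT
  have hTfin : T ≠ ∞ := by finiteness
  refine ⟨T.toReal, ENNReal.toReal_nonneg, fun v => ?_⟩
  have hmeas : Measurable fun p : EuclideanSpace ℝ (Fin d) × ℝ =>
      ENNReal.ofReal ((1 + ‖p.1 - p.2 • v‖) ^ (-β)) := by fun_prop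
  have hswap : ∫⁻ x : EuclideanSpace ℝ (Fin d), ∫⁻ s in Set.Icc (0 : ℝ) 1,
      ENNReal.ofReal ((1 + ‖x - s • v‖) ^ (-β)) = M := by
    rw [lintegral_lintegral_swap hmeas.aemeasurable]
    have (s : ℝ) : ∫⁻ x : EuclideanSpace ℝ (Fin d),
        ENNReal.ofReal ((1 + ‖x - s • v‖) ^ (-β)) = M :=
      lintegral_sub_right_eq_self
        (fun x : EuclideanSpace ℝ (Fin d) => ENNReal.ofReal ((1 + ‖x‖) ^ (-β))) (s • v)
    simp [this]
  have hm1 : Measurable fun x : EuclideanSpace ℝ (Fin d) =>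
      ∫⁻ s in Set.Icc (0 : ℝ) 1, ENNReal.ofReal ((1 + ‖x - s • v‖) ^ (-β)) :=
    hmeas.lintegral_prod_right'
  refine (lintegral_mono fun x => ofReal_rpow_mul_kinN_le hβ1 hq0 x v).trans (le_of_eq ?_)
  rw [lintegral_const_mul _ (by fun_prop), lintegral_add_left (by fun_prop),
    lintegral_const_mul _ hm1, lintegral_const_mul _ (by fun_prop),
    lintegral_add_left (by fun_prop), hswap, ← hM, ← hM', ← hT,
    ENNReal.ofReal_mul ENNReal.toReal_nonneg, ENNReal.ofReal_toReal hTfin, mul_comm]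

/-- Lower bound for the integrand on the unit balls whose centres run along the outer half
of the segment, shifted outwards by two. -/
lemma le_rpow_mul_kinN {β q : ℝ} (hβ : 1 < β) (hq0 : 0 ≤ q)
    {x v e : EuclideanSpace ℝ (Fin d)} (he : ‖e‖ = 1) (hev : v = ‖v‖ • e) {s : ℝ}
    (hs : s ∈ Set.Icc (1 / 2 : ℝ) 1) (hx : ‖x - (s * ‖v‖ + 2) • e‖ ≤ 1) :
    2⁻¹ ^ q * 4 ^ (-(1 + β)) * 4 ^ (1 - β) * (1 + ‖v‖) ^ (q - β - 1) ≤
      ‖x‖ ^ q * kinN d β x v := by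
  have hv := norm_nonneg v
  have hδ0 := segDist_nonneg x v
  have hsv : 1 / 2 * ‖v‖ ≤ s * ‖v‖ := by gcongr; exact hs.1
  have hsv' : s * ‖v‖ ≤ ‖v‖ := mul_le_of_le_one_left hv hs.2
  have hc : ‖(s * ‖v‖ + 2) • e‖ = s * ‖v‖ + 2 := by
    rw [norm_smul, he, mul_one, Real.norm_of_nonneg (by linarith)]
  have hx1 : 2⁻¹ * (1 + ‖v‖) ≤ ‖x‖ := by
    have := norm_sub_norm_le ((s * ‖v‖ + 2) • e) x
    rw [norm_sub_rev] at this
    linarith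
  have hx2 : ‖x‖ ≤ ‖v‖ + 3 := by
    have := norm_sub_norm_le x ((s * ‖v‖ + 2) • e)
    linarith
  have hδ : 1 + segDist x v ≤ 4 := by
    have h1 := segDist_le x v (s := s) ⟨by linarith [hs.1], hs.2⟩
    have h2 : x - s • v = (x - (s * ‖v‖ + 2) • e) + (2 : ℝ) • e := by
      nth_rewrite 1 [hev]; module
    have h3 := norm_add_le (x - (s * ‖v‖ + 2) • e) ((2 : ℝ) • e)
    have h4 : ‖(2 : ℝ) • e‖ = 2 := by rw [norm_smul, he]; norm_num
    rw [← h2] at h3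
    linarith
  have hz : 1 + √(‖x‖ ^ 2 + ‖v‖ ^ 2) ≤ 4 * (1 + ‖v‖) := by
    have : √(‖x‖ ^ 2 + ‖v‖ ^ 2) ≤ ‖x‖ + ‖v‖ :=
      Real.sqrt_le_iff.2 ⟨by positivity, by nlinarith [norm_nonneg x]⟩
    linarith
  have h1 : 2⁻¹ ^ q * (1 + ‖v‖) ^ q ≤ ‖x‖ ^ q := by
    rw [← Real.mul_rpow (by norm_num) (by positivity)]
    exact Real.rpow_le_rpow (by positivity) hx1 hq0
  have h2 : 4 ^ (-(1 + β)) * (1 + ‖v‖) ^ (-(1 + β)) ≤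
      (1 + √(‖x‖ ^ 2 + ‖v‖ ^ 2)) ^ (-(1 + β)) := by
    rw [← Real.mul_rpow (by norm_num) (by positivity)]
    exact Real.rpow_le_rpow_of_nonpos (by positivity) hz (by linarith)
  have h3 : (4 : ℝ) ^ (1 - β) ≤ (1 + segDist x v) ^ (1 - β) :=
    Real.rpow_le_rpow_of_nonpos (by positivity) hδ (by linarith)
  calc _ = (2⁻¹ ^ q * (1 + ‖v‖) ^ q) *
        ((4 ^ (-(1 + β)) * (1 + ‖v‖) ^ (-(1 + β))) * 4 ^ (1 - β)) := by
        rw [show q - β - 1 = q + -(1 + β) by ring, Real.rpow_add (by positivity)]; ring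
    _ ≤ _ := by rw [kinN_eq]; gcongr

lemma volume_setOf_norm_sub_smul_le {x v e : EuclideanSpace ℝ (Fin d)} (he : ‖e‖ = 1) :
    volume {s ∈ Set.Icc (1 / 2 : ℝ) 1 | ‖x - (s * ‖v‖ + 2) • e‖ ≤ 1} ≤
      ENNReal.ofReal (8 / (1 + ‖v‖)) := by
  have hv := norm_nonneg v
  rcases le_total ‖v‖ 1 with h | h
  · refine (measure_mono (Set.sep_subset _ _)).trans ?_
    rw [Real.volume_Icc]
    refine ENNReal.ofReal_le_ofReal ?_
    rw [le_div_iff₀ (by positivity)]; linarith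
  · rcases Set.eq_empty_or_nonempty
      {s ∈ Set.Icc (1 / 2 : ℝ) 1 | ‖x - (s * ‖v‖ + 2) • e‖ ≤ 1} with h0 | ⟨s₀, -, hs₀⟩
    · rw [h0]; simp
    · have hsub : {s ∈ Set.Icc (1 / 2 : ℝ) 1 | ‖x - (s * ‖v‖ + 2) • e‖ ≤ 1} ⊆
          Set.Icc (s₀ - 2 / ‖v‖) (s₀ + 2 / ‖v‖) := by
        rintro s ⟨-, hs⟩
        have h1 := norm_sub_le (x - (s₀ * ‖v‖ + 2) • e) (x - (s * ‖v‖ + 2) • e)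
        rw [show (x - (s₀ * ‖v‖ + 2) • e) - (x - (s * ‖v‖ + 2) • e) = ((s - s₀) * ‖v‖) • e by
          module, norm_smul, he, mul_one, norm_mul, norm_norm, Real.norm_eq_abs] at h1
        have h2 : |s - s₀| ≤ 2 / ‖v‖ := by
          rw [le_div_iff₀ (by linarith)]; linarith
        rw [abs_le] at h2
        constructor <;> linarith [h2.1, h2.2]
      refine (measure_mono hsub).trans ?_
      rw [Real.volume_Icc]
      refine ENNReal.ofReal_le_ofReal ?_
      rw [show s₀ + 2 / ‖v‖ - (s₀ - 2 / ‖v‖) = 4 / ‖v‖ by ring,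
        div_le_div_iff₀ (by linarith) (by positivity)]
      linarith

lemma exists_norm_eq_one_and_eq_smul (hd : 1 ≤ d) (v : EuclideanSpace ℝ (Fin d)) :
    ∃ e : EuclideanSpace ℝ (Fin d), ‖e‖ = 1 ∧ v = ‖v‖ • e := by
  by_cases hv : v = 0
  · exact ⟨EuclideanSpace.single ⟨0, hd⟩ 1, by simp, by simp [hv]⟩
  · have hv' : ‖v‖ ≠ 0 := norm_ne_zero_iff.2 hv
    exact ⟨‖v‖⁻¹ • v, by rw [norm_smul, norm_inv, norm_norm, inv_mul_cancel₀ hv'],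
      by rw [smul_inv_smul₀ hv']⟩

lemma exists_le_lintegral_rpow_mul_kinN (hd : 1 ≤ d) {β q : ℝ} (hβ : 1 < β) (hq0 : 0 ≤ q) :
    ∃ k : ℝ, 0 < k ∧ ∀ v : EuclideanSpace ℝ (Fin d),
      ENNReal.ofReal (k * (1 + ‖v‖) ^ (q - β)) ≤
        ∫⁻ x, ENNReal.ofReal (‖x‖ ^ q * kinN d β x v) := by
  set c : ℝ := 2⁻¹ ^ q * 4 ^ (-(1 + β)) * 4 ^ (1 - β) with hc
  have hc0 : 0 < c := by positivity
  set b : ℝ≥0∞ := volume (Metric.closedBall (0 : EuclideanSpace ℝ (Fin d)) 1) with hb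
  have hbfin : b ≠ ∞ := measure_closedBall_lt_top.ne
  have hb0 : b ≠ 0 := (Metric.measure_closedBall_pos volume _ one_pos).ne'
  refine ⟨c / 8 * (b.toReal * (1 / 2)), by
    have := ENNReal.toReal_pos hb0 hbfin
    positivity, fun v => ?_⟩
  obtain ⟨e, he, hev⟩ := exists_norm_eq_one_and_eq_smul hd v
  set S : Set (EuclideanSpace ℝ (Fin d) × ℝ) := {p | ‖p.1 - (p.2 * ‖v‖ + 2) • e‖ ≤ 1} with hS
  have hSm : MeasurableSet S := measurableSet_le (by fun_prop) measurable_const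
  set g : EuclideanSpace ℝ (Fin d) → ℝ → ℝ≥0∞ := fun x s => S.indicator 1 (x, s) with hg
  have hgm : Measurable (Function.uncurry g) := measurable_one.indicator hSm
  have hx (x : EuclideanSpace ℝ (Fin d)) : ∫⁻ s in Set.Icc (1 / 2 : ℝ) 1, g x s =
      volume {s ∈ Set.Icc (1 / 2 : ℝ) 1 | ‖x - (s * ‖v‖ + 2) • e‖ ≤ 1} := by
    have hm : MeasurableSet {s : ℝ | ‖x - (s * ‖v‖ + 2) • e‖ ≤ 1} :=
      measurableSet_le (by fun_prop) measurable_const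
    rw [show g x = {s : ℝ | ‖x - (s * ‖v‖ + 2) • e‖ ≤ 1}.indicator 1 from rfl,
      lintegral_indicator_one hm, Measure.restrict_apply hm, Set.inter_comm]
    rfl
  have hs (s : ℝ) : ∫⁻ x, g x s = b := by
    have hball : (fun x => g x s) =
        (Metric.closedBall ((s * ‖v‖ + 2) • e) (1 : ℝ)).indicator 1 := by
      have hset : Metric.closedBall ((s * ‖v‖ + 2) • e) (1 : ℝ) =
          {x | ‖x - (s * ‖v‖ + 2) • e‖ ≤ 1} := by
        ext x
        rw [Metric.mem_closedBall, dist_eq_norm]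
        rfl
      rw [hset]
      rfl
    rw [hball, lintegral_indicator_one Metric.isClosed_closedBall.measurableSet, hb,
      Measure.addHaar_closedBall_center]
  have hswap : ∫⁻ x, ∫⁻ s in Set.Icc (1 / 2 : ℝ) 1, g x s = b * ENNReal.ofReal (1 / 2) := by
    rw [lintegral_lintegral_swap hgm.aemeasurable]
    simp only [hs]
    rw [setLIntegral_const, Real.volume_Icc]
    norm_num
  have hpt (x : EuclideanSpace ℝ (Fin d)) :
      ENNReal.ofReal (c / 8 * (1 + ‖v‖) ^ (q - β)) * ∫⁻ s in Set.Icc (1 / 2 : ℝ) 1, g x s ≤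
        ENNReal.ofReal (‖x‖ ^ q * kinN d β x v) := by
    rw [hx]
    rcases Set.eq_empty_or_nonempty
      {s ∈ Set.Icc (1 / 2 : ℝ) 1 | ‖x - (s * ‖v‖ + 2) • e‖ ≤ 1} with h0 | ⟨s, hsI, hsx⟩
    · rw [h0]; simp
    · refine (mul_le_mul_right (volume_setOf_norm_sub_smul_le he) _).trans ?_
      rw [← ENNReal.ofReal_mul (by positivity)]
      refine ENNReal.ofReal_le_ofReal
        (le_trans (le_of_eq ?_) (le_rpow_mul_kinN hβ hq0 he hev hsI hsx))
      rw [← hc, Real.rpow_sub_one (by positivity)]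
      field_simp
  refine le_trans (le_of_eq ?_) (lintegral_mono hpt)
  have hm : Measurable fun x => ∫⁻ s in Set.Icc (1 / 2 : ℝ) 1, g x s :=
    hgm.lintegral_prod_right'
  rw [lintegral_const_mul _ hm, hswap,
    mul_right_comm, ENNReal.ofReal_mul (by positivity),
    ENNReal.ofReal_mul (p := b.toReal) (by positivity), ENNReal.ofReal_toReal hbfin]

end kinN

/-- two-sided bound for the `q`-th spatial moment of `𝒩_β`
when `0 ≤ q < 2β − d`. -/
theorem stmt_6 (d : ℕ) (hd : 1 ≤ d) (β q : ℝ) (hβ : (d : ℝ) < β)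
    (hq0 : 0 ≤ q) (hq : q < 2 * β - d) :
    ∃ C ≥ (1 : ℝ), ∀ v : EuclideanSpace ℝ (Fin d),
      C⁻¹ * (1 + ‖v‖) ^ (q - β) ≤
          (∫ x : EuclideanSpace ℝ (Fin d), ‖x‖ ^ q * kinN d β x v) ∧
      (∫ x : EuclideanSpace ℝ (Fin d), ‖x‖ ^ q * kinN d β x v) ≤
          C * (1 + ‖v‖) ^ (q - β) := by
  have hβ1 : 1 < β := lt_of_le_of_lt (by exact_mod_cast hd) hβ
  obtain ⟨K, hK0, hK⟩ := exists_lintegral_rpow_mul_kinN_le hd hβ hq0 hq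
  obtain ⟨k, hk0, hk⟩ := exists_le_lintegral_rpow_mul_kinN hd hβ1 hq0
  refine ⟨max 1 (max K k⁻¹), le_max_left _ _, fun v => ?_⟩
  have hint : ∫ x : EuclideanSpace ℝ (Fin d), ‖x‖ ^ q * kinN d β x v =
      (∫⁻ x, ENNReal.ofReal (‖x‖ ^ q * kinN d β x v)).toReal :=
    integral_eq_lintegral_of_nonneg_ae
      (Filter.Eventually.of_forall fun x =>
        mul_nonneg (Real.rpow_nonneg (norm_nonneg _) _) (kinN_nonneg β x v))
      ((continuous_norm.rpow_const fun _ => Or.inr hq0).mul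
        (continuous_kinN β v)).aestronglyMeasurable
  rw [hint]
  constructor
  · have hle : (max 1 (max K k⁻¹))⁻¹ ≤ k :=
      inv_le_of_inv_le₀ hk0 ((le_max_right _ _).trans (le_max_right _ _))
    refine (mul_le_mul_of_nonneg_right hle (by positivity)).trans ?_
    exact (ENNReal.ofReal_le_iff_le_toReal ((hK v).trans_lt ENNReal.ofReal_lt_top).ne).1 (hk v)
  · refine (ENNReal.toReal_le_of_le_ofReal (by positivity) (hK v)).trans ?_
    gcongr
    exact (le_max_left _ _).trans (le_max_right _ _)
end

section
/- Let d ≥ 1 and β > 1. There exists a constant C = C(d,β) ≥ 1 such that for all z = (x,v) ∈ ℝ^d × ℝ^d, setting ω_z := ⟨x/|x|, v/|v|⟩ (with the convention that u/|u| := 0 when u = 0), one has C^{-1} R(z) ≤ 𝒩_β(z) ≤ C R(z), where R(z) := (1+|z|)^{−1−β} · (1 + |x|·√(1 − ω_z²) + ( | 2|x|ω_z − |v| | − |v| )_+ )^{1−β} and a_+ := max(a,0). -/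
open MeasureTheory Real RealInnerProductSpace

/-- The comparison function `R(z)` expressed through the angle
`ω_z = ⟨x/|x|, v/|v|⟩` (with `u/|u| := 0` for `u = 0`). -/
noncomputable def kinR (d : ℕ) (β : ℝ) (x v : EuclideanSpace ℝ (Fin d)) : ℝ :=
  (1 + Real.sqrt (‖x‖ ^ 2 + ‖v‖ ^ 2)) ^ (-1 - β) *
    (1 + ‖x‖ * Real.sqrt (1 - ⟪‖x‖⁻¹ • x, ‖v‖⁻¹ • v⟫ ^ 2) +
        max (|2 * ‖x‖ * ⟪‖x‖⁻¹ • x, ‖v‖⁻¹ • v⟫ - ‖v‖| - ‖v‖) 0) ^ (1 - β)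

theorem norm_mul_inner_normalized_mul_norm {E : Type*} [NormedAddCommGroup E]
    [InnerProductSpace ℝ E] (x v : E) :
    ‖x‖ * ⟪‖x‖⁻¹ • x, ‖v‖⁻¹ • v⟫ * ‖v‖ = ⟪x, v⟫ := by
  rw [real_inner_smul_left, real_inner_smul_right]
  rcases eq_or_ne x 0 with rfl | hx
  · simp
  rcases eq_or_ne v 0 with rfl | hv
  · simp
  have hx' := norm_ne_zero_iff.2 hx
  have hv' := norm_ne_zero_iff.2 hv
  field_simp

theorem sq_inner_normalized_le_one {E : Type*} [NormedAddCommGroup E]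
    [InnerProductSpace ℝ E] (x v : E) :
    ⟪‖x‖⁻¹ • x, ‖v‖⁻¹ • v⟫ ^ 2 ≤ 1 := by
  have norm_le (u : E) : ‖‖u‖⁻¹ • u‖ ≤ 1 := by
    rw [norm_smul, norm_inv, norm_norm]
    exact inv_mul_le_one
  rw [sq_le_one_iff_abs_le_one]
  exact (abs_real_inner_le_norm _ _).trans (mul_le_one₀ (norm_le x) (norm_nonneg _) (norm_le v))

theorem norm_sub_smul_sq_eq {E : Type*} [NormedAddCommGroup E] [InnerProductSpace ℝ E]
    (x v : E) (s : ℝ) :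
    ‖x - s • v‖ ^ 2 = (‖x‖ * √(1 - ⟪‖x‖⁻¹ • x, ‖v‖⁻¹ • v⟫ ^ 2)) ^ 2 +
      (‖x‖ * ⟪‖x‖⁻¹ • x, ‖v‖⁻¹ • v⟫ - s * ‖v‖) ^ 2 := by
  rw [mul_pow, Real.sq_sqrt (sub_nonneg.2 (sq_inner_normalized_le_one x v)), norm_sub_sq_real,
    real_inner_smul_right, norm_smul, mul_pow, Real.norm_eq_abs, sq_abs,
    ← norm_mul_inner_normalized_mul_norm x v]
  ring

/-- The distance from `x` to the segment `[0, v]` is comparable to the sum of the distance to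
the line `ℝ v` and twice the distance of the projection to the segment. -/
theorem iInf_norm_sub_smul_comparable {E : Type*} [NormedAddCommGroup E] [InnerProductSpace ℝ E]
    (x v : E) :
    (⨅ s : Set.Icc (0 : ℝ) 1, ‖x - (s : ℝ) • v‖) ≤
      ‖x‖ * √(1 - ⟪‖x‖⁻¹ • x, ‖v‖⁻¹ • v⟫ ^ 2) +
        max (|2 * ‖x‖ * ⟪‖x‖⁻¹ • x, ‖v‖⁻¹ • v⟫ - ‖v‖| - ‖v‖) 0 ∧
    ‖x‖ * √(1 - ⟪‖x‖⁻¹ • x, ‖v‖⁻¹ • v⟫ ^ 2) +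
        max (|2 * ‖x‖ * ⟪‖x‖⁻¹ • x, ‖v‖⁻¹ • v⟫ - ‖v‖| - ‖v‖) 0 ≤
      3 * ⨅ s : Set.Icc (0 : ℝ) 1, ‖x - (s : ℝ) • v‖ := by
  have key := norm_sub_smul_sq_eq x v
  have hq : 0 ≤ ‖x‖ * √(1 - ⟪‖x‖⁻¹ • x, ‖v‖⁻¹ • v⟫ ^ 2) := by positivity
  have hb := norm_nonneg v
  rw [mul_assoc 2 ‖x‖]
  generalize ‖x‖ * √(1 - ⟪‖x‖⁻¹ • x, ‖v‖⁻¹ • v⟫ ^ 2) = q at *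
  generalize ‖x‖ * ⟪‖x‖⁻¹ • x, ‖v‖⁻¹ • v⟫ = p at *
  generalize hbv : ‖v‖ = b at *
  constructor
  · obtain ⟨s, hs, hle⟩ : ∃ s ∈ Set.Icc (0 : ℝ) 1, |p - s * b| ≤ max (|2 * p - b| - b) 0 := by
      rcases le_or_gt p 0 with hp | hp
      · refine ⟨0, by simp, le_max_of_le_left ?_⟩
        rw [abs_of_nonpos (by linarith), abs_of_nonpos (by linarith)]
        linarith
      rcases le_or_gt b p with hpb | hpb
      · refine ⟨1, by simp, le_max_of_le_left ?_⟩
        rw [abs_of_nonneg (by linarith), abs_of_nonneg (by linarith)]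
        linarith
      · have hb0 : 0 < b := hp.trans hpb
        refine ⟨p / b, ⟨by positivity, (div_le_one hb0).2 hpb.le⟩, le_max_of_le_right ?_⟩
        rw [div_mul_cancel₀ _ hb0.ne', sub_self, abs_zero]
    have hbdd : BddBelow (Set.range fun s : Set.Icc (0 : ℝ) 1 => ‖x - (s : ℝ) • v‖) :=
      ⟨0, by rintro _ ⟨s, rfl⟩; exact norm_nonneg _⟩
    refine (ciInf_le hbdd ⟨s, hs⟩).trans ((?_ : _ ≤ q + |p - s * b|).trans (by gcongr))
    refine abs_le_of_sq_le_sq' ?_ (by positivity) |>.2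
    rw [key s]
    nlinarith [sq_abs (p - s * b), mul_nonneg hq (abs_nonneg (p - s * b))]
  · rw [← div_le_iff₀' (by norm_num)]
    refine le_ciInf fun ⟨s, hs⟩ => ?_
    have h₁ : q ≤ ‖x - s • v‖ :=
      abs_le_of_sq_le_sq' (by rw [key s]; nlinarith [sq_nonneg (p - s * b)]) (norm_nonneg _) |>.2
    have h₂ : |p - s * b| ≤ ‖x - s • v‖ :=
      abs_le_of_sq_le_sq (by rw [key s]; nlinarith [sq_nonneg q]) (norm_nonneg _)
    have h₃ : max (|2 * p - b| - b) 0 ≤ 2 * |p - s * b| := by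
      refine max_le ?_ (by positivity)
      have hsb : 0 ≤ s * b := mul_nonneg hs.1 hb
      have hsb' : s * b ≤ b := mul_le_of_le_one_left hb hs.2
      rw [sub_le_iff_le_add, abs_le]
      constructor <;> linarith [neg_abs_le (p - s * b), le_abs_self (p - s * b)]
    rw [div_le_iff₀' (by norm_num)]
    change _ ≤ 3 * ‖x - s • v‖
    linarith

/-- `𝒩_β` is comparable to the explicit function `R`. -/
theorem stmt_8 (d : ℕ) (hd : 1 ≤ d) (β : ℝ) (hβ : 1 < β) :
    ∃ C ≥ (1 : ℝ), ∀ x v : EuclideanSpace ℝ (Fin d),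
      C⁻¹ * kinR d β x v ≤ kinN d β x v ∧ kinN d β x v ≤ C * kinR d β x v := by
  have hC : (1 : ℝ) ≤ 3 ^ (β - 1) := Real.one_le_rpow (by norm_num) (by linarith)
  refine ⟨3 ^ (β - 1), hC, fun x v => ?_⟩
  obtain ⟨hle, hge⟩ := iInf_norm_sub_smul_comparable x v
  have hD : 0 ≤ ⨅ s : Set.Icc (0 : ℝ) 1, ‖x - (s : ℝ) • v‖ :=
    Real.iInf_nonneg fun _ => norm_nonneg _
  unfold kinR kinN
  rw [add_assoc 1, neg_add']
  generalize ‖x‖ * √(1 - ⟪‖x‖⁻¹ • x, ‖v‖⁻¹ • v⟫ ^ 2) +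
    max (|2 * ‖x‖ * ⟪‖x‖⁻¹ • x, ‖v‖⁻¹ • v⟫ - ‖v‖| - ‖v‖) 0 = F at *
  generalize (⨅ s : Set.Icc (0 : ℝ) 1, ‖x - (s : ℝ) • v‖) = D at *
  have hA : 0 ≤ (1 + √(‖x‖ ^ 2 + ‖v‖ ^ 2)) ^ (-1 - β) := by positivity
  generalize (1 + √(‖x‖ ^ 2 + ‖v‖ ^ 2)) ^ (-1 - β) = A at *
  have hF : 0 ≤ (1 + F) ^ (1 - β) := Real.rpow_nonneg (by linarith) _
  constructor
  · refine (mul_le_of_le_one_left (mul_nonneg hA hF) (inv_le_one_of_one_le₀ hC)).trans ?_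
    exact mul_le_mul_of_nonneg_left
      (Real.rpow_le_rpow_of_nonpos (by linarith) (by linarith) (by linarith)) hA
  · rw [mul_left_comm]
    refine mul_le_mul_of_nonneg_left ?_ hA
    calc (1 + D) ^ (1 - β) ≤ ((1 + F) / 3) ^ (1 - β) :=
          Real.rpow_le_rpow_of_nonpos (by linarith) (by linarith) (by linarith)
      _ = 3 ^ (β - 1) * (1 + F) ^ (1 - β) := by
          rw [Real.div_rpow (by linarith) (by norm_num), ← neg_sub β 1,
            Real.rpow_neg (by norm_num : (0 : ℝ) ≤ 3), div_inv_eq_mul, mul_comm]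
end

section
/- Let d ≥ 1 and β > 1. There exists a constant C = C(d,β) ≥ 1 such that for all x, v ∈ ℝ^d, writing z = (x,v), |z| = (|x|²+|v|²)^{1/2} and ℳ_β(z) := (1 + inf_{s∈[0,1]} |x − s v|)^{1−β}, one has C^{-1} · ℳ_β(z)/(|z|+1) ≤ ∫_0^1 (|x − s v| + 1)^{−β} ds ≤ C · ℳ_β(z)/(|z|+1). -/
open MeasureTheory Real RealInnerProductSpace

/-- The one-sided integral of `(a + R t) ^ (-β)` is bounded uniformly in the length `L`. -/
theorem integral_add_mul_rpow_neg_le {a R β L : ℝ} (ha : 0 < a) (hR : 0 < R) (hβ : 1 < β)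
    (hL : 0 ≤ L) :
    ∫ t in (0 : ℝ)..L, (a + R * t) ^ (-β) ≤ a ^ (1 - β) / ((β - 1) * R) := by
  have hβ' : 0 < β - 1 := by linarith
  have haL : 0 < a + R * L := by positivity
  rw [intervalIntegral.integral_comp_add_mul (fun u : ℝ => u ^ (-β)) hR.ne' a, integral_rpow]
  · have h0 : 0 ≤ (a + R * L) ^ (1 - β) := by positivity
    have hexp : -β + 1 = 1 - β := by ring
    rw [hexp, mul_zero, add_zero, smul_eq_mul]
    have heq : R⁻¹ * (((a + R * L) ^ (1 - β) - a ^ (1 - β)) / (1 - β)) =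
        (a ^ (1 - β) - (a + R * L) ^ (1 - β)) / ((β - 1) * R) := by
      have h1 : 1 - β ≠ 0 := by linarith
      field_simp
      ring
    rw [heq]
    gcongr
    linarith
  · right
    refine ⟨by linarith, ?_⟩
    rw [mul_zero, add_zero]
    exact Set.notMem_uIcc_of_lt ha haL

theorem continuous_add_mul_abs_rpow {a R : ℝ} (ha : 0 < a) (hR : 0 < R) (r s₀ : ℝ) :
    Continuous fun s : ℝ => (a + R * |s - s₀|) ^ r := by
  refine Continuous.rpow_const (by fun_prop) fun s => Or.inl ?_
  positivity

theorem integral_add_mul_abs_sub_rpow_neg_le {a R β s₀ : ℝ} (ha : 0 < a) (hR : 0 < R)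
    (hβ : 1 < β) (hs₀ : s₀ ∈ Set.Icc (0 : ℝ) 1) :
    ∫ s in (0 : ℝ)..1, (a + R * |s - s₀|) ^ (-β) ≤ 2 * (a ^ (1 - β) / ((β - 1) * R)) := by
  have hc := continuous_add_mul_abs_rpow ha hR (-β) s₀
  rw [← intervalIntegral.integral_add_adjacent_intervals (hc.intervalIntegrable 0 s₀)
    (hc.intervalIntegrable s₀ 1)]
  have h1 : ∫ s in (0 : ℝ)..s₀, (a + R * |s - s₀|) ^ (-β) =
      ∫ t in (0 : ℝ)..s₀, (a + R * t) ^ (-β) := by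
    have := intervalIntegral.integral_comp_sub_left (a := 0) (b := s₀)
      (fun t : ℝ => (a + R * t) ^ (-β)) s₀
    rw [sub_self, sub_zero] at this
    rw [← this]
    refine intervalIntegral.integral_congr fun s hs => ?_
    rw [Set.uIcc_of_le hs₀.1] at hs
    rw [abs_sub_comm, abs_of_nonneg (sub_nonneg.2 hs.2)]
  have h2 : ∫ s in s₀..1, (a + R * |s - s₀|) ^ (-β) =
      ∫ t in (0 : ℝ)..(1 - s₀), (a + R * t) ^ (-β) := by
    have := intervalIntegral.integral_comp_sub_right (a := s₀) (b := 1)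
      (fun t : ℝ => (a + R * t) ^ (-β)) s₀
    rw [sub_self] at this
    rw [← this]
    refine intervalIntegral.integral_congr fun s hs => ?_
    rw [Set.uIcc_of_le hs₀.2] at hs
    rw [abs_of_nonneg (sub_nonneg.2 hs.1)]
  have h3 := integral_add_mul_rpow_neg_le ha hR hβ hs₀.1
  have h4 := integral_add_mul_rpow_neg_le ha hR hβ (sub_nonneg.2 hs₀.2)
  rw [h1, h2]
  linarith

section NormedSpace

variable {E : Type*} [NormedAddCommGroup E] [NormedSpace ℝ E]

theorem exists_iInf_norm_sub_smul_eq (x v : E) :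
    ∃ s₀ ∈ Set.Icc (0 : ℝ) 1,
      (⨅ s : Set.Icc (0 : ℝ) 1, ‖x - (s : ℝ) • v‖) = ‖x - s₀ • v‖ ∧
      ∀ s ∈ Set.Icc (0 : ℝ) 1, ‖x - s₀ • v‖ ≤ ‖x - s • v‖ := by
  obtain ⟨s₀, hs₀, hmin⟩ := (isCompact_Icc (a := (0 : ℝ)) (b := 1)).exists_isMinOn
    (Set.nonempty_Icc.2 zero_le_one) (f := fun s : ℝ => ‖x - s • v‖) (by fun_prop)
  refine ⟨s₀, hs₀, le_antisymm ?_ ?_, fun s hs => hmin hs⟩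
  · exact ciInf_le (f := fun s : Set.Icc (0 : ℝ) 1 => ‖x - (s : ℝ) • v‖)
      ⟨0, by rintro _ ⟨s, rfl⟩; exact norm_nonneg _⟩ ⟨s₀, hs₀⟩
  · have : Nonempty (Set.Icc (0 : ℝ) 1) := ⟨⟨s₀, hs₀⟩⟩
    exact le_ciInf fun s => hmin s.2

theorem norm_sub_smul_sub_le (x v : E) (s t : ℝ) :
    |s - t| * ‖v‖ ≤ ‖x - s • v‖ + ‖x - t • v‖ := by
  have h : (s - t) • v = (x - t • v) - (x - s • v) := by rw [sub_smul]; abel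
  rw [← Real.norm_eq_abs, ← norm_smul, h, add_comm]
  exact norm_sub_le _ _

theorem norm_sub_smul_le_add (x v : E) (s t : ℝ) :
    ‖x - s • v‖ ≤ ‖x - t • v‖ + |s - t| * ‖v‖ := by
  have h : x - s • v = (x - t • v) - (s - t) • v := by rw [sub_smul]; abel
  rw [h, ← Real.norm_eq_abs, ← norm_smul]
  exact norm_sub_le _ _

theorem continuous_norm_sub_smul_add_one_rpow (x v : E) (r : ℝ) :
    Continuous fun s : ℝ => (‖x - s • v‖ + 1) ^ r := by
  refine Continuous.rpow_const (by fun_prop) fun s => Or.inl ?_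
  positivity

/-- Lower bound: near the minimiser `s₀`, on an interval of length `a / R`, the integrand is at
least `(2 a) ^ (-β)`. -/
theorem le_integral_norm_sub_smul_rpow_neg (x v : E) {R β s₀ : ℝ} (hβ : 0 ≤ β)
    (hs₀ : s₀ ∈ Set.Icc (0 : ℝ) 1) (hv : ‖v‖ ≤ R) (hR : 1 + ‖x - s₀ • v‖ ≤ R) :
    (2 ^ β)⁻¹ * ((1 + ‖x - s₀ • v‖) ^ (1 - β) / R) ≤
      ∫ s in (0 : ℝ)..1, (‖x - s • v‖ + 1) ^ (-β) := by
  set a := 1 + ‖x - s₀ • v‖ with ha_def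
  have ha : 0 < a := by positivity
  have hR0 : 0 < R := ha.trans_le hR
  obtain ⟨l, hl0, hl1, hls, hsl⟩ :
      ∃ l : ℝ, 0 ≤ l ∧ l + a / R ≤ 1 ∧ l ≤ s₀ ∧ s₀ ≤ l + a / R := by
    have h1 : a / R ≤ 1 := (div_le_one hR0).2 hR
    have h0 : 0 < a / R := by positivity
    obtain ⟨h2, h3⟩ := hs₀
    rcases le_total s₀ (1 - a / R) with h | h
    · exact ⟨s₀, h2, by linarith, le_rfl, by linarith⟩
    · exact ⟨1 - a / R, by linarith, by linarith, h, by linarith⟩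
  have hc := continuous_norm_sub_smul_add_one_rpow x v (-β)
  have hle : l ≤ l + a / R := hls.trans hsl
  calc (2 ^ β)⁻¹ * (a ^ (1 - β) / R) = ∫ _s in l..(l + a / R), (2 * a) ^ (-β) := by
        rw [intervalIntegral.integral_const, smul_eq_mul, add_sub_cancel_left,
          Real.mul_rpow two_pos.le ha.le, Real.rpow_neg two_pos.le, sub_eq_add_neg,
          Real.rpow_add ha, Real.rpow_one]
        ring
    _ ≤ ∫ s in l..(l + a / R), (‖x - s • v‖ + 1) ^ (-β) := by
        refine intervalIntegral.integral_mono_on hle (by simp) (hc.intervalIntegrable _ _)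
          fun s hs => ?_
        refine Real.rpow_le_rpow_of_nonpos (by positivity) ?_ (by linarith)
        have h1 := norm_sub_smul_le_add x v s s₀
        have h2 : |s - s₀| ≤ a / R := by
          rw [abs_le]
          constructor <;> linarith [hs.1, hs.2]
        have h3 : |s - s₀| * ‖v‖ ≤ a / R * R := by gcongr
        rw [div_mul_cancel₀ _ hR0.ne'] at h3
        linarith
    _ ≤ ∫ s in (0 : ℝ)..1, (‖x - s • v‖ + 1) ^ (-β) := by
        refine intervalIntegral.integral_mono_interval hl0 hle hl1
          (Filter.Eventually.of_forall fun s => ?_) (hc.intervalIntegrable _ _)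
        simp only [Pi.zero_apply]
        positivity

/-- Upper bound: the integrand is comparable to `(a + R |s - s₀|) ^ (-β)`. -/
theorem integral_norm_sub_smul_rpow_neg_le (x v : E) {R β s₀ : ℝ} (hβ : 1 < β)
    (hs₀ : s₀ ∈ Set.Icc (0 : ℝ) 1)
    (hmin : ∀ s ∈ Set.Icc (0 : ℝ) 1, ‖x - s₀ • v‖ ≤ ‖x - s • v‖)
    (hR0 : 0 < R) (hR : R ≤ 1 + ‖x‖ + ‖v‖) :
    ∫ s in (0 : ℝ)..1, (‖x - s • v‖ + 1) ^ (-β) ≤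
      6 ^ β * (2 / (β - 1)) * ((1 + ‖x - s₀ • v‖) ^ (1 - β) / R) := by
  set a := 1 + ‖x - s₀ • v‖ with ha_def
  have ha : 0 < a := by positivity
  have hβ' : 0 < β - 1 := by linarith
  have hx : ‖x‖ ≤ ‖x - s₀ • v‖ + ‖v‖ := by
    have h := norm_sub_smul_le_add x v 0 s₀
    rw [zero_smul, sub_zero, zero_sub, abs_neg, abs_of_nonneg hs₀.1] at h
    nlinarith [hs₀.2, norm_nonneg v]
  calc ∫ s in (0 : ℝ)..1, (‖x - s • v‖ + 1) ^ (-β)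
      ≤ ∫ s in (0 : ℝ)..1, 6 ^ β * (a + R * |s - s₀|) ^ (-β) := by
        refine intervalIntegral.integral_mono_on zero_le_one
          ((continuous_norm_sub_smul_add_one_rpow x v (-β)).intervalIntegrable _ _)
          (((continuous_add_mul_abs_rpow ha hR0 (-β) s₀).const_mul _).intervalIntegrable _ _)
          fun s hs => ?_
        have h6 : (6 : ℝ) ^ β * (a + R * |s - s₀|) ^ (-β) =
            (6⁻¹ * (a + R * |s - s₀|)) ^ (-β) := by
          have h0 : 0 ≤ a + R * |s - s₀| := by positivity
          rw [Real.mul_rpow (by norm_num) h0, Real.inv_rpow (by norm_num),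
            Real.rpow_neg (x := 6) (by norm_num) β, inv_inv]
        rw [h6]
        refine Real.rpow_le_rpow_of_nonpos (by positivity) ?_ (by linarith)
        have h1 := hmin s hs
        have h2 := norm_sub_smul_sub_le x v s s₀
        have h3 : |s - s₀| ≤ 1 := by
          rw [abs_le]
          constructor <;> linarith [hs.1, hs.2, hs₀.1, hs₀.2]
        have h4 : R * |s - s₀| ≤ (a + 2 * ‖v‖) * |s - s₀| := by
          gcongr
          linarith
        have h5 : a * |s - s₀| ≤ a := mul_le_of_le_one_right ha.le h3
        linarith
    _ = 6 ^ β * ∫ s in (0 : ℝ)..1, (a + R * |s - s₀|) ^ (-β) :=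
        intervalIntegral.integral_const_mul _ _
    _ ≤ 6 ^ β * (2 * (a ^ (1 - β) / ((β - 1) * R))) := by
        gcongr
        exact integral_add_mul_abs_sub_rpow_neg_le ha hR0 hβ hs₀
    _ = 6 ^ β * (2 / (β - 1)) * (a ^ (1 - β) / R) := by
        field_simp

end NormedSpace

/-- two-sided bound for `∫_0^1 (|x − s v| + 1)^{−β} ds` in terms of
`ℳ_β(z)/(|z|+1)`. -/
theorem stmt_9 (d : ℕ) (hd : 1 ≤ d) (β : ℝ) (hβ : 1 < β) :
    ∃ C ≥ (1 : ℝ), ∀ x v : EuclideanSpace ℝ (Fin d),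
      C⁻¹ * ((1 + ⨅ s : Set.Icc (0 : ℝ) 1, ‖x - (s : ℝ) • v‖) ^ (1 - β) /
            (Real.sqrt (‖x‖ ^ 2 + ‖v‖ ^ 2) + 1)) ≤
          (∫ s in (0 : ℝ)..1, (‖x - s • v‖ + 1) ^ (-β)) ∧
      (∫ s in (0 : ℝ)..1, (‖x - s • v‖ + 1) ^ (-β)) ≤
          C * ((1 + ⨅ s : Set.Icc (0 : ℝ) 1, ‖x - (s : ℝ) • v‖) ^ (1 - β) /
            (Real.sqrt (‖x‖ ^ 2 + ‖v‖ ^ 2) + 1)) := by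
  have hβ' : 0 < β - 1 := by linarith
  have h2 : (1 : ℝ) ≤ 2 ^ β := Real.one_le_rpow (by norm_num) (by linarith)
  have h6 : (0 : ℝ) ≤ 6 ^ β * (2 / (β - 1)) := by positivity
  refine ⟨2 ^ β + 6 ^ β * (2 / (β - 1)), by linarith, fun x v => ?_⟩
  obtain ⟨s₀, hs₀, hinf, hmin⟩ := exists_iInf_norm_sub_smul_eq x v
  rw [hinf]
  have hxz : ‖x‖ ≤ √(‖x‖ ^ 2 + ‖v‖ ^ 2) := Real.le_sqrt_of_sq_le (by nlinarith [sq_nonneg ‖v‖])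
  have hvz : ‖v‖ ≤ √(‖x‖ ^ 2 + ‖v‖ ^ 2) := Real.le_sqrt_of_sq_le (by nlinarith [sq_nonneg ‖x‖])
  have hz : √(‖x‖ ^ 2 + ‖v‖ ^ 2) ≤ ‖x‖ + ‖v‖ :=
    Real.sqrt_le_iff.2 ⟨by positivity, by nlinarith [norm_nonneg x, norm_nonneg v]⟩
  have hm : ‖x - s₀ • v‖ ≤ ‖x‖ := by simpa using hmin 0 (by simp)
  constructor
  · refine le_trans ?_ (le_integral_norm_sub_smul_rpow_neg x v (by linarith) hs₀
      (R := √(‖x‖ ^ 2 + ‖v‖ ^ 2) + 1) (by linarith) (by linarith))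
    gcongr
    linarith
  · refine (integral_norm_sub_smul_rpow_neg_le x v hβ hs₀ hmin
      (R := √(‖x‖ ^ 2 + ‖v‖ ^ 2) + 1) (by positivity) (by linarith)).trans ?_
    gcongr
    linarith
end

section
/- Let d ≥ 1. For every integer n ≥ 2 and every u ∈ ℝ^d with |u| ≤ n, there exist vectors u₁, …, uₙ ∈ ℝ^d such that 1/3 ≤ |u_i| ≤ 1 for every i ∈ {1,…,n} and u₁ + ⋯ + uₙ = u. -/
open MeasureTheory Real

/-- Any real number in `[0, n]`, with `n ≥ 2`, is a sum of `n` reals whose absolute values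
lie in `[1/3, 1]`. -/
theorem exists_sum_eq_of_abs_mem_Icc (n : ℕ) (hn : 2 ≤ n) :
    ∀ r : ℝ, 0 ≤ r → r ≤ n →
      ∃ a : Fin n → ℝ, (∀ i, 1 / 3 ≤ |a i| ∧ |a i| ≤ 1) ∧ ∑ i, a i = r := by
  induction n, hn using Nat.le_induction with
  | base =>
    intro r hr hr2
    push_cast at hr2
    rcases le_total (2 / 3) r with h | h
    · refine ⟨fun _ => r / 2, fun _ => ?_, by rw [Fin.sum_univ_two, add_halves]⟩
      rw [abs_of_nonneg (by positivity)]
      constructor <;> linarith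
    · refine ⟨![-(1 / 3), r + 1 / 3], ?_, by simp [Fin.sum_univ_two]⟩
      rw [Fin.forall_fin_two]
      simp only [Matrix.cons_val_zero, Matrix.cons_val_one]
      rw [abs_neg, abs_of_nonneg (by norm_num : (0 : ℝ) ≤ 1 / 3),
        abs_of_nonneg (by linarith : 0 ≤ r + 1 / 3)]
      refine ⟨⟨?_, ?_⟩, ?_, ?_⟩ <;> linarith
  | succ k hk ih =>
    intro r hr hrk
    push_cast at hrk
    have hk2 : (2 : ℝ) ≤ k := by exact_mod_cast hk
    obtain ⟨x, hx1, hx2, hx3, hx4⟩ :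
        ∃ x : ℝ, 1 / 3 ≤ |x| ∧ |x| ≤ 1 ∧ 0 ≤ r - x ∧ r - x ≤ k := by
      rcases le_total 1 r with h | h
      · refine ⟨1, ?_, ?_, ?_, ?_⟩ <;> norm_num <;> linarith
      · refine ⟨-(1 / 3), ?_, ?_, ?_, ?_⟩
        · rw [abs_neg]; exact le_abs_self _
        · rw [abs_neg, abs_of_nonneg] <;> norm_num
        · linarith
        · linarith
    obtain ⟨a, ha, hsum⟩ := ih (r - x) hx3 hx4
    refine ⟨Fin.cons x a, Fin.cases ⟨hx1, hx2⟩ ha, ?_⟩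
    rw [Fin.sum_cons, hsum]
    ring

/-- any vector of norm at most `n` is a sum of `n` vectors whose norms
lie in `[1/3, 1]`. -/
theorem stmt_10 (d : ℕ) (hd : 1 ≤ d) (n : ℕ) (hn : 2 ≤ n)
    (u : EuclideanSpace ℝ (Fin d)) (hu : ‖u‖ ≤ (n : ℝ)) :
    ∃ f : Fin n → EuclideanSpace ℝ (Fin d),
      (∀ i, 1 / 3 ≤ ‖f i‖ ∧ ‖f i‖ ≤ 1) ∧ ∑ i, f i = u := by
  obtain ⟨e, he, heu⟩ : ∃ e : EuclideanSpace ℝ (Fin d), ‖e‖ = 1 ∧ ‖u‖ • e = u := by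
    rcases eq_or_ne u 0 with rfl | h
    · exact ⟨EuclideanSpace.single ⟨0, hd⟩ 1, by simp, by simp⟩
    · have h' : ‖u‖ ≠ 0 := norm_ne_zero_iff.mpr h
      exact ⟨‖u‖⁻¹ • u, by simp [norm_smul, h'], smul_inv_smul₀ h' u⟩
  obtain ⟨a, ha, hsum⟩ := exists_sum_eq_of_abs_mem_Icc n hn ‖u‖ (norm_nonneg u) hu
  refine ⟨fun i => a i • e, fun i => ?_, ?_⟩
  · simpa only [norm_smul, he, mul_one, Real.norm_eq_abs] using ha i
  · rw [← Finset.sum_smul, hsum, heu]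
end
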